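/- Every connected finite simple graph G on n ≥ 2 vertices contains a spanning closed walk of length at most (13/9)·OPT_LP(G). -/

import Mathlib

open scoped Classical

/-- The total LP value of edges of `G` crossing the cut `(S, Sᶜ)`:
the sum of `x e` over edges `e` of `G` with exactly one endpoint in `S`. -/
noncomputable def cutValue {V : Type*} [Fintype V] (G : SimpleGraph V)
    (x : Sym2 V → ℝ) (S : Set V) : ℝ :=
  ∑ e ∈ Finset.univ.filter
      (fun e : Sym2 V => e ∈ G.edgeSet ∧ ∃ a b, e = s(a, b) ∧ a ∈ S ∧ b ∉ S), x e

/-- The total value `∑_{e ∈ E} x_e` of a putative Held-Karp solution. -/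
noncomputable def lpValue {V : Type*} [Fintype V] (G : SimpleGraph V)
    (x : Sym2 V → ℝ) : ℝ :=
  ∑ e ∈ Finset.univ.filter (fun e : Sym2 V => e ∈ G.edgeSet), x e

/-- `x` is a feasible Held-Karp solution for `G`. -/
def IsHeldKarp {V : Type*} [Fintype V] (G : SimpleGraph V) (x : Sym2 V → ℝ) : Prop :=
  (∀ e ∈ G.edgeSet, 0 ≤ x e) ∧
  ∀ S : Set V, S.Nonempty → S ≠ Set.univ → 2 ≤ cutValue G x S

/-- The Held-Karp value `OPT_LP(G)`. -/
noncomputable def optLP {V : Type*} [Fintype V] (G : SimpleGraph V) : ℝ :=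
  sInf {y | ∃ x, IsHeldKarp G x ∧ lpValue G x = y}

/-- `G` is 2-vertex-connected: it has at least 3 vertices and deleting any single
vertex leaves a connected (induced) graph. -/
def IsTwoVertexConnected {V : Type*} [Fintype V] (G : SimpleGraph V) : Prop :=
  3 ≤ Fintype.card V ∧ ∀ v : V, (G.induce ({v}ᶜ : Set V)).Connected

/-- The indicator of a point with values in `ZMod 2`. -/
noncomputable def ptInd {V : Type*} (u v : V) : ZMod 2 := if u = v then 1 else 0

/-- The mod-2 degree vector of an edge set `E`, in the multigraph whose edge `e` joins
`s e` and `t e`. -/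
noncomputable def bdry {V ι : Type*} (s t : ι → V) (E : Finset ι) (v : V) : ZMod 2 :=
  ∑ e ∈ E, (ptInd (s e) v + ptInd (t e) v)

/-- Reachability along the edges of `E`. -/
def EdgeReach {V ι : Type*} (s t : ι → V) (E : Finset ι) : V → V → Prop :=
  Relation.EqvGen (fun a b => ∃ e ∈ E, s e = a ∧ t e = b)

section Parity

variable {V ι : Type*}

@[simp] lemma ptInd_self (u : V) : ptInd u u = 1 := by simp [ptInd]

lemma ptInd_of_ne {u v : V} (h : u ≠ v) : ptInd u v = 0 := by simp [ptInd, h]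

lemma zmod_two_add_self (a : ZMod 2) : a + a = 0 := CharTwo.add_self_eq_zero a

@[simp] lemma bdry_empty (s t : ι → V) (v : V) : bdry s t ∅ v = 0 := by simp [bdry]

@[simp] lemma bdry_singleton (s t : ι → V) (e : ι) (v : V) :
    bdry s t {e} v = ptInd (s e) v + ptInd (t e) v := by simp [bdry]

lemma bdry_insert [DecidableEq ι] (s t : ι → V) {e : ι} {E : Finset ι} (h : e ∉ E) (v : V) :
    bdry s t (insert e E) v = ptInd (s e) v + ptInd (t e) v + bdry s t E v := by
  simp [bdry, Finset.sum_insert h]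

lemma bdry_sdiff [DecidableEq ι] (s t : ι → V) {D E : Finset ι} (h : D ⊆ E) (v : V) :
    bdry s t (E \ D) v = bdry s t E v + bdry s t D v := by
  have := Finset.sum_sdiff (f := fun e => ptInd (s e) v + ptInd (t e) v) h
  unfold bdry
  rw [← this, add_assoc, zmod_two_add_self, add_zero]

lemma bdry_erase [DecidableEq ι] (s t : ι → V) {e : ι} {E : Finset ι} (h : e ∈ E) (v : V) :
    bdry s t (E.erase e) v = bdry s t E v + (ptInd (s e) v + ptInd (t e) v) := by
  rw [← Finset.sdiff_singleton_eq_erase, bdry_sdiff s t (by simpa using h), bdry_singleton]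

lemma sum_symmDiff_eq [DecidableEq ι] {M : Type*} [AddCommGroup M] (f : ι → M)
    (C D : Finset ι) :
    ∑ e ∈ symmDiff C D, f e = ∑ e ∈ C, f e + ∑ e ∈ D, f e - 2 • ∑ e ∈ C ∩ D, f e := by
  have h1 := Finset.sum_sdiff (f := f) (Finset.inter_subset_left : C ∩ D ⊆ C)
  have h2 := Finset.sum_sdiff (f := f) (Finset.inter_subset_right : C ∩ D ⊆ D)
  rw [Finset.sdiff_inter_self_left] at h1
  rw [Finset.sdiff_inter_self_right] at h2
  rw [symmDiff, Finset.sup_eq_union, Finset.sum_union, ← h1, ← h2, two_nsmul]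
  · abel
  · exact disjoint_sdiff_sdiff

lemma bdry_symmDiff [DecidableEq ι] (s t : ι → V) (C D : Finset ι) (v : V) :
    bdry s t (symmDiff C D) v = bdry s t C v + bdry s t D v := by
  unfold bdry
  rw [sum_symmDiff_eq, two_nsmul, zmod_two_add_self, sub_zero]

lemma exists_join_of_edgeReach [DecidableEq ι] {s t : ι → V} {E : Finset ι} {u v : V}
    (h : EdgeReach s t E u v) :
    ∃ P ⊆ E, ∀ y, bdry s t P y = ptInd u y + ptInd v y := by
  induction h with
  | rel a b h =>
    obtain ⟨e, he, rfl, rfl⟩ := h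
    exact ⟨{e}, by simpa using he, fun y => by simp⟩
  | refl a => exact ⟨∅, by simp, fun y => by simp [zmod_two_add_self]⟩
  | symm a b _ ih =>
    obtain ⟨P, h1, h2⟩ := ih
    exact ⟨P, h1, fun y => by rw [h2, add_comm]⟩
  | trans a b c _ _ ih1 ih2 =>
    obtain ⟨P, h1, h2⟩ := ih1
    obtain ⟨Q, h3, h4⟩ := ih2
    refine ⟨symmDiff P Q, ?_, fun y => ?_⟩
    · intro e he
      rcases Finset.mem_symmDiff.1 he with h | h
      · exact h1 h.1
      · exact h3 h.1
    · rw [bdry_symmDiff, h2, h4]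
      have := zmod_two_add_self (ptInd b y)
      linear_combination this

/-- The edge `e` has exactly one end in `S`. -/
def Crosses (s t : ι → V) (S : Finset V) (e : ι) : Prop := ¬ (s e ∈ S ↔ t e ∈ S)

lemma sum_ptInd (S : Finset V) (u : V) : ∑ v ∈ S, ptInd u v = if u ∈ S then 1 else 0 := by
  simp [ptInd]

lemma sum_bdry (s t : ι → V) (S : Finset V) (E : Finset ι) :
    ∑ v ∈ S, bdry s t E v = ((E.filter (Crosses s t S)).card : ZMod 2) := by
  unfold bdry
  rw [Finset.sum_comm, Finset.card_filter, Nat.cast_sum]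
  refine Finset.sum_congr rfl fun e _ => ?_
  rw [Finset.sum_add_distrib, sum_ptInd, sum_ptInd]
  by_cases h1 : s e ∈ S <;> by_cases h2 : t e ∈ S <;> simp [Crosses, h1, h2]
  decide

lemma bdry_comp [Fintype V] {W : Type*} (φ : V → W) (s t : ι → V) (E : Finset ι) (y : W) :
    bdry (φ ∘ s) (φ ∘ t) E y = ∑ v ∈ Finset.univ.filter (fun v => φ v = y), bdry s t E v := by
  unfold bdry
  rw [Finset.sum_comm]
  refine Finset.sum_congr rfl fun e _ => ?_
  rw [Finset.sum_add_distrib, sum_ptInd, sum_ptInd]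
  simp [ptInd]

lemma EdgeReach.mono {s t : ι → V} {E F : Finset ι} (h : E ⊆ F) {u v : V}
    (h1 : EdgeReach s t E u v) : EdgeReach s t F u v :=
  Relation.EqvGen.mono (fun _ _ ⟨e, he, h2⟩ => ⟨e, h he, h2⟩) _ _ h1

lemma EdgeReach.of_mem {s t : ι → V} {E : Finset ι} {e : ι} (h : e ∈ E) :
    EdgeReach s t E (s e) (t e) := Relation.EqvGen.rel _ _ ⟨e, h, rfl, rfl⟩

lemma EdgeReach.refl {s t : ι → V} {E : Finset ι} (u : V) : EdgeReach s t E u u :=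
  Relation.EqvGen.refl _

lemma EdgeReach.symm {s t : ι → V} {E : Finset ι} {u v : V} (h : EdgeReach s t E u v) :
    EdgeReach s t E v u := Relation.EqvGen.symm _ _ h

lemma EdgeReach.trans {s t : ι → V} {E : Finset ι} {u v w : V} (h : EdgeReach s t E u v)
    (h' : EdgeReach s t E v w) : EdgeReach s t E u w := Relation.EqvGen.trans _ _ _ h h'

lemma EdgeReach.mem_iff {s t : ι → V} {E : Finset ι} {S : Set V}
    (hS : ∀ e ∈ E, (s e ∈ S ↔ t e ∈ S)) {u v : V} (h : EdgeReach s t E u v) :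
    u ∈ S ↔ v ∈ S := by
  induction h with
  | rel a b h => obtain ⟨e, he, rfl, rfl⟩ := h; exact hS e he
  | refl a => rfl
  | symm a b _ ih => exact ih.symm
  | trans a b c _ _ ih1 ih2 => exact ih1.trans ih2

end Parity

section Conservative

variable {V ι : Type*}

/-- The ends of the edge `e` are `b` and `c`. -/
def Joins (s t : ι → V) (e : ι) (b c : V) : Prop := (s e = b ∧ t e = c) ∨ (s e = c ∧ t e = b)

lemma Joins.ptInd_add {s t : ι → V} {e : ι} {b c : V} (h : Joins s t e b c) (y : V) :
    ptInd (s e) y + ptInd (t e) y = ptInd b y + ptInd c y := by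
  rcases h with ⟨rfl, rfl⟩ | ⟨rfl, rfl⟩
  · rfl
  · rw [add_comm]

lemma exists_joins {s t : ι → V} {e : ι} {b : V} (h : s e = b ∨ t e = b) :
    ∃ c, Joins s t e b c := by
  rcases h with h | h
  · exact ⟨t e, .inl ⟨h, rfl⟩⟩
  · exact ⟨s e, .inr ⟨rfl, h⟩⟩

lemma Joins.incident {s t : ι → V} {e : ι} {b c : V} (h : Joins s t e b c) :
    s e = b ∨ t e = b := by
  rcases h with h | h
  · exact .inl h.1
  · exact .inr h.2

lemma Joins.ne {s t : ι → V} {e : ι} {b c : V} (h : Joins s t e b c) (hl : s e ≠ t e) :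
    b ≠ c := by
  rcases h with ⟨rfl, rfl⟩ | ⟨rfl, rfl⟩
  · exact hl
  · exact hl.symm

/-- The edges of `Q` that avoid the vertex `b`. -/
noncomputable def avoiding (s t : ι → V) (Q : Finset ι) (b : V) : Finset ι :=
  Q.filter fun e => ¬ (s e = b ∨ t e = b)

lemma exists_cycle_through [DecidableEq ι] {s t : ι → V} {Q : Finset ι} {b c₁ c₂ : V} {e₁ e₂ : ι}
    (h₁ : e₁ ∈ Q) (h₂ : e₂ ∈ Q) (hne : e₁ ≠ e₂) (j₁ : Joins s t e₁ b c₁) (j₂ : Joins s t e₂ b c₂)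
    (hr : EdgeReach s t (avoiding s t Q b) c₁ c₂) :
    ∃ D ⊆ Q, e₁ ∈ D ∧ e₂ ∈ D ∧ (∀ y, bdry s t D y = 0) ∧
      ∀ e ∈ D, (s e = b ∨ t e = b) → e = e₁ ∨ e = e₂ := by
  obtain ⟨P, hP, hPb⟩ := exists_join_of_edgeReach hr
  have hP' : ∀ e ∈ P, e ∈ Q ∧ ¬ (s e = b ∨ t e = b) := fun e he => by
    simpa [avoiding] using hP he
  have n₁ : e₁ ∉ P := fun h => (hP' _ h).2 j₁.incident
  have n₂ : e₂ ∉ P := fun h => (hP' _ h).2 j₂.incident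
  refine ⟨insert e₁ (insert e₂ P), ?_, by simp, by simp, fun y => ?_, ?_⟩
  · intro e he
    simp only [Finset.mem_insert] at he
    rcases he with rfl | rfl | he
    · exact h₁
    · exact h₂
    · exact (hP' _ he).1
  · rw [bdry_insert _ _ (by simp [hne, n₁]), bdry_insert _ _ n₂, hPb, j₁.ptInd_add,
      j₂.ptInd_add]
    linear_combination zmod_two_add_self (ptInd b y) + zmod_two_add_self (ptInd c₁ y)
      + zmod_two_add_self (ptInd c₂ y)
  · intro e he hb
    simp only [Finset.mem_insert] at he
    rcases he with rfl | rfl | he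
    · exact .inl rfl
    · exact .inr rfl
    · exact absurd hb (hP' _ he).2

lemma exists_second_edge_or [Fintype V] [DecidableEq ι] {s t : ι → V} {Q : Finset ι}
    {b c₁ : V} {e₁ : ι}
    (h₁ : e₁ ∈ Q) (j₁ : Joins s t e₁ b c₁) (hl : s e₁ ≠ t e₁) :
    (∃ e₂ ∈ Q, e₁ ≠ e₂ ∧ ∃ c₂, Joins s t e₂ b c₂ ∧
        EdgeReach s t (avoiding s t Q b) c₁ c₂) ∨
      ∑ v ∈ Finset.univ.filter (fun v => EdgeReach s t (avoiding s t Q b) c₁ v),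
        bdry s t Q v = 1 := by
  by_contra! hcon
  obtain ⟨h2, h3⟩ := hcon
  apply h3
  set S := Finset.univ.filter (fun v => EdgeReach s t (avoiding s t Q b) c₁ v) with hS
  have hmem : ∀ v, v ∈ S ↔ EdgeReach s t (avoiding s t Q b) c₁ v := by simp [hS]
  have hbS : b ∉ S := by
    rw [hmem]
    intro h
    have := EdgeReach.mem_iff (S := {v | v ≠ b}) (fun e he => ?_) h
    · exact (this.1 (j₁.ne hl).symm) rfl
    · simp only [avoiding, Finset.mem_filter, not_or] at he
      simp [he.2.1, he.2.2]
  have hc : c₁ ∈ S := (hmem _).2 (.refl _)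
  have hcr : Q.filter (Crosses s t S) = {e₁} := by
    ext e
    simp only [Finset.mem_filter, Finset.mem_singleton]
    constructor
    · rintro ⟨heQ, hcr⟩
      by_contra hne
      by_cases hi : s e = b ∨ t e = b
      · obtain ⟨c, hj⟩ := exists_joins hi
        refine h2 e heQ (Ne.symm hne) c hj ((hmem _).1 ?_)
        rcases hj with ⟨h, h'⟩ | ⟨h, h'⟩
        · rw [Crosses, h, h'] at hcr; tauto
        · rw [Crosses, h, h'] at hcr; tauto
      · apply hcr
        have : e ∈ avoiding s t Q b := by simp only [avoiding, Finset.mem_filter]; exact ⟨heQ, hi⟩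
        rw [hmem, hmem]
        exact ⟨fun h => h.trans (.of_mem this), fun h => h.trans (.symm (.of_mem this))⟩
    · rintro rfl
      refine ⟨h₁, ?_⟩
      rcases j₁ with ⟨h, h'⟩ | ⟨h, h'⟩
      · rw [Crosses, h, h']; tauto
      · rw [Crosses, h, h']; tauto
  rw [sum_bdry, hcr]
  simp

/-- At the far end of a join of minimum weight there is at most one negative edge. -/
lemma negative_edge_unique [Fintype V] [DecidableEq ι] {s t : ι → V} {E : Finset ι} {w : ι → ℤ}
    (hl : ∀ e ∈ E, s e ≠ t e)
    (hcons : ∀ C ⊆ E, (∀ y, bdry s t C y = 0) → 0 ≤ ∑ e ∈ C, w e)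
    {Q : Finset ι} (hQE : Q ⊆ E) {a b : V}
    (hQ : ∀ y, bdry s t Q y = ptInd a y + ptInd b y)
    (hmin : ∀ Q' ⊆ E, ∀ c d, (∀ y, bdry s t Q' y = ptInd c y + ptInd d y) →
      ∑ e ∈ Q, w e ≤ ∑ e ∈ Q', w e)
    {e₁ e₂ : ι} (h₁ : e₁ ∈ E) (h₂ : e₂ ∈ E) (i₁ : s e₁ = b ∨ t e₁ = b)
    (i₂ : s e₂ = b ∨ t e₂ = b) (n₁ : w e₁ < 0) (n₂ : w e₂ < 0) : e₁ = e₂ := by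
  by_contra hne
  obtain ⟨c₁, j₁⟩ := exists_joins i₁
  obtain ⟨c₂, j₂⟩ := exists_joins i₂
  have key : ∀ Q' ⊆ E, (∀ y, bdry s t Q' y = ptInd a y + ptInd b y) →
      ∑ e ∈ Q', w e ≤ ∑ e ∈ Q, w e → ∀ e ∈ E, (s e = b ∨ t e = b) → w e < 0 → e ∈ Q' := by
    intro Q' hQ'E hQ' hle e he hi hneg
    by_contra hn
    obtain ⟨c, hj⟩ := exists_joins hi
    have := hmin (insert e Q') (Finset.insert_subset he hQ'E) a c (fun y => by
      rw [bdry_insert _ _ hn, hQ', hj.ptInd_add]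
      linear_combination zmod_two_add_self (ptInd b y))
    rw [Finset.sum_insert hn] at this
    omega
  have first : ∀ {e e' : ι} {c c' : V}, e ∈ E → e ∈ Q → e' ∈ Q → e ≠ e' → Joins s t e b c →
      Joins s t e' b c' → w e < 0 → ¬ EdgeReach s t (avoiding s t Q b) c c' := by
    intro e e' c c' heE he he' hne hj hj' hneg hr
    obtain ⟨D, hDQ, h1, -, h3, -⟩ := exists_cycle_through he he' hne hj hj' hr
    have hw := hcons D (hDQ.trans hQE) h3
    have hs := Finset.sum_sdiff (f := w) hDQ
    have := key (Q \ D) (Finset.sdiff_subset.trans hQE)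
      (fun y => by rw [bdry_sdiff _ _ hDQ, hQ, h3, add_zero]) (by omega) e heE hj.incident hneg
    simp [h1] at this
  have q₁ := key Q hQE hQ le_rfl e₁ h₁ i₁ n₁
  have q₂ := key Q hQE hQ le_rfl e₂ h₂ i₂ n₂
  have reach_a : ∀ {e : ι} {c : V}, e ∈ E → e ∈ Q → Joins s t e b c → w e < 0 →
      EdgeReach s t (avoiding s t Q b) c a := by
    intro e c heE he hj hneg
    rcases exists_second_edge_or he hj (hl e heE) with ⟨e', he', hne', c', hj', hr⟩ | h
    · exact absurd hr (first heE he he' hne' hj hj' hneg)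
    · simp_rw [hQ] at h
      rw [Finset.sum_add_distrib, sum_ptInd, sum_ptInd] at h
      by_contra hna
      have hb : ¬ EdgeReach s t (avoiding s t Q b) c b := by
        intro h
        have := EdgeReach.mem_iff (S := {v | v ≠ b}) (fun e he => ?_) h
        · exact (this.1 (hj.ne (hl e heE)).symm) rfl
        · simp only [avoiding, Finset.mem_filter, not_or] at he
          simp [he.2.1, he.2.2]
      simp [hna, hb] at h
  exact first h₁ q₁ q₂ hne j₁ j₂ n₁ ((reach_a h₁ q₁ j₁ n₁).trans (reach_a h₂ q₂ j₂ n₂).symm)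

end Conservative

section Conservative

variable {V ι : Type*}

/-- The weighting obtained from `w` by moving the weights at the vertex `b` towards zero. -/
noncomputable def shrinkAt (s t : ι → V) (w : ι → ℤ) (b : V) (e : ι) : ℤ :=
  if s e = b ∨ t e = b then (if w e < 0 then w e + 1 else w e - 1) else w e

lemma shrinkAt_of_not {s t : ι → V} {w : ι → ℤ} {b : V} {e : ι} (h : ¬ (s e = b ∨ t e = b)) :
    shrinkAt s t w b e = w e := by simp only [shrinkAt, if_neg h]

lemma even_card_incident {s t : ι → V} {b : V} {C : Finset ι} (hl : ∀ e ∈ C, s e ≠ t e)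
    (hC : bdry s t C b = 0) : Even (C.filter fun e => s e = b ∨ t e = b).card := by
  rw [← ZMod.natCast_eq_zero_iff_even, ← hC, Finset.card_filter, Nat.cast_sum]
  refine Finset.sum_congr rfl fun e he => ?_
  have := hl e he
  by_cases h1 : s e = b <;> by_cases h2 : t e = b <;> simp [ptInd, h1, h2]
  exact absurd (h1.trans h2.symm) this

lemma sum_shrinkAt {s t : ι → V} {w : ι → ℤ} {b : V} (C : Finset ι) :
    ∑ e ∈ C, shrinkAt s t w b e = ∑ e ∈ C, w e
      - ((C.filter fun e => s e = b ∨ t e = b).card : ℤ)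
      + 2 * ((C.filter fun e => (s e = b ∨ t e = b) ∧ w e < 0).card : ℤ) := by
  rw [Finset.card_filter, Finset.card_filter]
  push_cast
  rw [Finset.mul_sum, ← Finset.sum_sub_distrib, ← Finset.sum_add_distrib]
  refine Finset.sum_congr rfl fun e _ => ?_
  by_cases h1 : s e = b ∨ t e = b <;> by_cases h2 : w e < 0 <;>
    simp only [shrinkAt, h1, h2, if_true, if_false, and_true, and_false] <;> norm_num
  ring

lemma shrinkAt_conservative [Fintype V] [DecidableEq ι] {s t : ι → V} {E : Finset ι} {w : ι → ℤ}
    (hl : ∀ e ∈ E, s e ≠ t e) (hnz : ∀ e ∈ E, w e ≠ 0)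
    (hcons : ∀ C ⊆ E, (∀ y, bdry s t C y = 0) → 0 ≤ ∑ e ∈ C, w e)
    (heven : ∀ C ⊆ E, (∀ y, bdry s t C y = 0) → Even (∑ e ∈ C, w e))
    {Q : Finset ι} (hQE : Q ⊆ E) {a b : V}
    (hQ : ∀ y, bdry s t Q y = ptInd a y + ptInd b y)
    (hmin : ∀ Q' ⊆ E, ∀ c d, (∀ y, bdry s t Q' y = ptInd c y + ptInd d y) →
      ∑ e ∈ Q, w e ≤ ∑ e ∈ Q', w e) :
    ∀ n, ∀ C ⊆ E, C.card = n → (∀ y, bdry s t C y = 0) →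
      0 ≤ ∑ e ∈ C, shrinkAt s t w b e := by
  intro n
  induction n using Nat.strong_induction_on with
  | _ n ih =>
  intro C hCE hn hC
  by_cases hinc : ∃ e ∈ C, s e = b ∨ t e = b
  swap
  · push Not at hinc
    rw [Finset.sum_congr rfl fun e he => shrinkAt_of_not (by have := hinc e he; tauto)]
    exact hcons C hCE hC
  obtain ⟨e₁, he₁, hi₁⟩ := hinc
  obtain ⟨c₁, j₁⟩ := exists_joins hi₁
  rcases exists_second_edge_or he₁ j₁ (hl _ (hCE he₁)) with h | h
  swap
  · simp [hC] at h
  obtain ⟨e₂, he₂, hne, c₂, j₂, hr⟩ := h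
  obtain ⟨D, hDC, hD₁, hD₂, hD, hDi⟩ := exists_cycle_through he₁ he₂ hne j₁ j₂ hr
  have hs := Finset.sum_sdiff (f := shrinkAt s t w b) hDC
  have hcard : (C \ D).card < n := by
    rw [← hn]
    exact Finset.card_lt_card (Finset.sdiff_ssubset hDC ⟨e₁, hD₁⟩)
  have h1 := ih _ hcard (C \ D) (Finset.sdiff_subset.trans hCE) rfl
    (fun y => by rw [bdry_sdiff _ _ hDC, hC, hD, add_zero])
  have hDE := hDC.trans hCE
  suffices 0 ≤ ∑ e ∈ D, shrinkAt s t w b e by omega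
  have hfil : (D.filter fun e => s e = b ∨ t e = b) = {e₁, e₂} := by
    ext e
    simp only [Finset.mem_filter, Finset.mem_insert, Finset.mem_singleton]
    constructor
    · rintro ⟨h, h'⟩; exact hDi e h h'
    · rintro (rfl | rfl)
      · exact ⟨hD₁, hi₁⟩
      · exact ⟨hD₂, j₂.incident⟩
  have hw := hcons D hDE hD
  rw [sum_shrinkAt, hfil, Finset.card_pair hne]
  by_cases hneg : ∃ e ∈ D, (s e = b ∨ t e = b) ∧ w e < 0
  · obtain ⟨e, he, h⟩ := hneg
    have : 0 < (D.filter fun e => (s e = b ∨ t e = b) ∧ w e < 0).card :=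
      Finset.card_pos.2 ⟨e, by simp only [Finset.mem_filter]; exact ⟨he, h⟩⟩
    push_cast
    omega
  push Not at hneg
  obtain ⟨k, hk⟩ := heven D hDE hD
  rcases (by omega : k ≤ 0 ∨ 1 ≤ k) with hk0 | hk1
  swap
  · push_cast
    omega
  exfalso
  have hD0 : ∑ e ∈ D, w e = 0 := by omega
  have p₁ : 0 < w e₁ := lt_of_le_of_ne (hneg e₁ hD₁ hi₁) (hnz _ (hDE hD₁)).symm
  have p₂ : 0 < w e₂ := lt_of_le_of_ne (hneg e₂ hD₂ j₂.incident) (hnz _ (hDE hD₂)).symm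
  set w' : ι → ℤ := fun e => if e ∈ D then - w e else w e with hw'
  have flip : ∀ C : Finset ι, ∑ e ∈ C, w' e = ∑ e ∈ symmDiff C D, w e := by
    intro C
    rw [sum_symmDiff_eq, hD0, add_zero, two_nsmul]
    have h2 : ∀ e, w' e = w e - (if e ∈ D then 2 * w e else 0) := by
      intro e
      simp only [hw']
      split_ifs <;> ring
    simp_rw [h2]
    rw [Finset.sum_sub_distrib, ← Finset.sum_filter, Finset.filter_mem_eq_inter, ← Finset.mul_sum]
    ring
  have hsub : ∀ C ⊆ E, symmDiff C D ⊆ E := by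
    intro C hC e he
    rcases Finset.mem_symmDiff.1 he with h | h
    · exact hC h.1
    · exact hDE h.1
  refine hne (negative_edge_unique (w := w') (Q := symmDiff Q D) (a := a) (b := b) hl ?_
    (hsub Q hQE) ?_ ?_ (hCE he₁) (hCE he₂) hi₁ j₂.incident ?_ ?_)
  · intro C hC hCb
    rw [flip]
    exact hcons _ (hsub C hC) fun y => by rw [bdry_symmDiff, hCb, hD, add_zero]
  · intro y
    rw [bdry_symmDiff, hD, add_zero, hQ]
  · intro Q' hQ'E c d hQ'
    rw [flip, flip, symmDiff_assoc, symmDiff_self, symmDiff_bot]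
    exact hmin _ (hsub Q' hQ'E) c d fun y => by rw [bdry_symmDiff, hD, add_zero, hQ']
  · simp [hw', hD₁, p₁]
  · simp [hw', hD₂, p₂]

lemma bdry_contract [Fintype V] [DecidableEq ι] {s t : ι → V} {e : ι} (hl : s e ≠ t e)
    {C : Finset ι}
    (hC : ∀ y, bdry ((fun v => if v = t e then s e else v) ∘ s)
      ((fun v => if v = t e then s e else v) ∘ t) C y = 0) :
    (∀ y, bdry s t C y = 0) ∨ ∀ y, bdry s t (symmDiff C {e}) y = 0 := by
  have h1 : ∀ y, y ≠ s e → y ≠ t e → bdry s t C y = 0 := by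
    intro y h h'
    have := hC y
    rw [bdry_comp] at this
    rw [← this]
    have : (Finset.univ.filter fun v => (if v = t e then s e else v) = y) = {y} := by
      ext v
      simp only [Finset.mem_filter, Finset.mem_univ, true_and, Finset.mem_singleton]
      split_ifs with hv
      · subst hv; exact ⟨fun hh => absurd hh.symm h, fun hh => absurd hh.symm h'⟩
      · rfl
    rw [this, Finset.sum_singleton]
  have h2 : bdry s t C (s e) + bdry s t C (t e) = 0 := by
    have := hC (s e)
    rw [bdry_comp] at this
    rw [← this]
    have : (Finset.univ.filter fun v => (if v = t e then s e else v) = s e) = {s e, t e} := by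
      ext v
      simp only [Finset.mem_filter, Finset.mem_univ, true_and, Finset.mem_singleton,
        Finset.mem_insert]
      split_ifs with hv <;> simp [hv]
    rw [this, Finset.sum_pair hl]
  have h3 : ∀ x y : ZMod 2, x + y = 0 → (x = 0 ∧ y = 0) ∨ (x = 1 ∧ y = 1) := by decide
  rcases h3 _ _ h2 with ⟨hs, ht⟩ | ⟨hs, ht⟩
  · left
    intro y
    by_cases hy : y = s e
    · rw [hy, hs]
    by_cases hy' : y = t e
    · rw [hy', ht]
    exact h1 y hy hy'
  · right
    intro y
    rw [bdry_symmDiff, bdry_singleton]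
    by_cases hy : y = s e
    · rw [hy, hs, ptInd_self, ptInd_of_ne hl.symm]; decide
    by_cases hy' : y = t e
    · rw [hy', ht, ptInd_self, ptInd_of_ne hl]; decide
    rw [h1 y hy hy', ptInd_of_ne (Ne.symm hy), ptInd_of_ne (Ne.symm hy')]; decide

lemma bdry_comp_eq_zero [Fintype V] {W : Type*} (φ : V → W) {s t : ι → V} {C : Finset ι}
    (hC : ∀ y, bdry s t C y = 0) (y : W) : bdry (φ ∘ s) (φ ∘ t) C y = 0 := by
  rw [bdry_comp]
  exact Finset.sum_eq_zero fun v _ => hC v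

end Conservative

section Conservative

variable {V ι : Type*}

/-- In a bridgeless multigraph with a conservative weighting, no even edge set weighs more than
twice the whole graph. -/
theorem sum_even_le_two_mul_sum [Fintype V] [DecidableEq ι] (n : ℕ) :
    ∀ (s t : ι → V) (E : Finset ι) (w : ι → ℤ),
    (∑ e ∈ E, (w e).natAbs + E.card + (E.filter fun e => s e ≠ t e).card = n) →
    (∀ C ⊆ E, (∀ y, bdry s t C y = 0) → 0 ≤ ∑ e ∈ C, w e) →
    (∀ C ⊆ E, (∀ y, bdry s t C y = 0) → Even (∑ e ∈ C, w e)) →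
    (∀ e ∈ E, ∃ C ⊆ E, e ∈ C ∧ ∀ y, bdry s t C y = 0) →
    ∀ K ⊆ E, (∀ y, bdry s t K y = 0) → ∑ e ∈ K, w e ≤ 2 * ∑ e ∈ E, w e := by
  induction n using Nat.strong_induction_on with
  | _ n ih =>
  intro s t E w hn hcons heven hbr K hKE hK
  by_cases hloop : ∃ e ∈ E, s e = t e
  · obtain ⟨e, he, hst⟩ := hloop
    have he0 : ∀ y, ptInd (s e) y + ptInd (t e) y = 0 := fun y => by
      rw [hst, zmod_two_add_self]
    have hwe : 0 ≤ w e := by simpa using hcons {e} (by simpa) (by simpa using he0)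
    have hsub : E.erase e ⊆ E := Finset.erase_subset _ _
    have ers : ∀ C, (∀ y, bdry s t C y = 0) → ∀ y, bdry s t (C.erase e) y = 0 := by
      intro C hC y
      by_cases h : e ∈ C
      · rw [bdry_erase _ _ h, hC, he0, add_zero]
      · rw [Finset.erase_eq_of_notMem h, hC]
    have h1 := Finset.add_sum_erase E (fun e => (w e).natAbs) he
    have h2 := Finset.card_erase_add_one he
    have h3 : ((E.erase e).filter fun e => s e ≠ t e).card ≤ (E.filter fun e => s e ≠ t e).card :=
      Finset.card_le_card (Finset.filter_subset_filter _ hsub)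
    have := ih _ (by rw [← hn]; omega) s t (E.erase e) w rfl
      (fun C hC => hcons C (hC.trans hsub)) (fun C hC => heven C (hC.trans hsub))
      (fun e' he' => by
        obtain ⟨C, hCE, heC, hC⟩ := hbr e' (hsub he')
        exact ⟨C.erase e, Finset.erase_subset_erase _ hCE,
          Finset.mem_erase.2 ⟨(Finset.mem_erase.1 he').1, heC⟩, ers C hC⟩)
      (K.erase e) (Finset.erase_subset_erase _ hKE) (ers K hK)
    have hE := Finset.add_sum_erase E w he
    by_cases heK : e ∈ K
    · have hK' := Finset.add_sum_erase K w heK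
      omega
    · rw [Finset.erase_eq_of_notMem heK] at this
      omega
  by_cases hzero : ∃ e ∈ E, w e = 0
  · obtain ⟨e, he, hw⟩ := hzero
    have hl : s e ≠ t e := fun h => hloop ⟨e, he, h⟩
    set φ : V → V := fun v => if v = t e then s e else v with hφ
    have hlt : (E.filter fun e => (φ ∘ s) e ≠ (φ ∘ t) e).card
        < (E.filter fun e => s e ≠ t e).card := by
      refine Finset.card_lt_card ⟨?_, fun h => ?_⟩
      · intro e' he'
        rw [Finset.mem_filter] at he' ⊢
        exact ⟨he'.1, fun h => he'.2 (by simp [h])⟩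
      · have := h (Finset.mem_filter.2 ⟨he, hl⟩)
        simp [hφ] at this
    have lift : ∀ C ⊆ E, (∀ y, bdry (φ ∘ s) (φ ∘ t) C y = 0) →
        ∃ C' ⊆ E, (∀ y, bdry s t C' y = 0) ∧ ∑ e ∈ C', w e = ∑ e ∈ C, w e := by
      intro C hC hCb
      rcases bdry_contract hl hCb with h | h
      · exact ⟨C, hC, h, rfl⟩
      · refine ⟨symmDiff C {e}, ?_, h, ?_⟩
        · intro x hx
          rcases Finset.mem_symmDiff.1 hx with h | h
          · exact hC h.1
          · rw [Finset.mem_singleton.1 h.1]; exact he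
        · rw [sum_symmDiff_eq, Finset.sum_singleton, hw]
          have : ∑ x ∈ C ∩ {e}, w x = 0 := Finset.sum_eq_zero fun x hx => by
            rw [Finset.mem_singleton.1 (Finset.mem_inter.1 hx).2, hw]
          rw [this]; simp
    refine ih _ (by rw [← hn]; omega) (φ ∘ s) (φ ∘ t) E w rfl ?_ ?_ ?_ K hKE
      (bdry_comp_eq_zero φ hK)
    · intro C hC hCb
      obtain ⟨C', h1, h2, h3⟩ := lift C hC hCb
      rw [← h3]; exact hcons C' h1 h2
    · intro C hC hCb
      obtain ⟨C', h1, h2, h3⟩ := lift C hC hCb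
      rw [← h3]; exact heven C' h1 h2
    · intro e' he'
      obtain ⟨C, hCE, heC, hC⟩ := hbr e' he'
      exact ⟨C, hCE, heC, bdry_comp_eq_zero φ hC⟩
  push Not at hloop hzero
  by_cases hneg : ∃ e ∈ E, w e < 0
  swap
  · push Not at hneg
    have h1 := Finset.sum_le_sum_of_subset_of_nonneg (f := w) hKE fun e he _ => hneg e he
    have h2 := Finset.sum_nonneg hneg
    omega
  obtain ⟨g, hgE, hg⟩ := hneg
  obtain ⟨Q, hQmem, hQmin⟩ := Finset.exists_min_image
    (E.powerset.filter fun Q => ∃ a b, ∀ y, bdry s t Q y = ptInd a y + ptInd b y)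
    (fun Q => ∑ e ∈ Q, w e)
    ⟨{g}, by simp only [Finset.mem_filter, Finset.mem_powerset, Finset.singleton_subset_iff]
             exact ⟨hgE, s g, t g, fun y => by simp⟩⟩
  simp only [Finset.mem_filter, Finset.mem_powerset] at hQmem hQmin
  obtain ⟨hQE, a, b, hQ⟩ := hQmem
  have hmin : ∀ Q' ⊆ E, ∀ c d, (∀ y, bdry s t Q' y = ptInd c y + ptInd d y) →
      ∑ e ∈ Q, w e ≤ ∑ e ∈ Q', w e := fun Q' h c d h' => hQmin Q' ⟨h, c, d, h'⟩
  have hQneg : ∑ e ∈ Q, w e < 0 := by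
    have := hmin {g} (by simpa) (s g) (t g) (fun y => by simp)
    rw [Finset.sum_singleton] at this
    omega
  have hab : a ≠ b := by
    rintro rfl
    have := hcons Q hQE fun y => by rw [hQ, zmod_two_add_self]
    omega
  have hf : ∃ f ∈ Q, s f = b ∨ t f = b := by
    by_contra! h
    have h1 := hQ b
    rw [ptInd_self, ptInd_of_ne hab, zero_add] at h1
    have h2 : bdry s t Q b = 0 := Finset.sum_eq_zero fun e he => by
      rw [ptInd_of_ne (h e he).1, ptInd_of_ne (h e he).2, add_zero]
    rw [h2] at h1
    exact zero_ne_one h1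
  obtain ⟨f, hfQ, hfb⟩ := hf
  have hfneg : w f < 0 := by
    by_contra hcon
    have hpos : 0 < w f := lt_of_le_of_ne (not_lt.1 hcon) (hzero f (hQE hfQ)).symm
    obtain ⟨c, hj⟩ := exists_joins hfb
    have h1 := hmin (Q.erase f) ((Finset.erase_subset _ _).trans hQE) a c fun y => by
      rw [bdry_erase _ _ hfQ, hQ, hj.ptInd_add]
      linear_combination zmod_two_add_self (ptInd b y)
    have h2 := Finset.add_sum_erase Q w hfQ
    omega
  have hfE := hQE hfQ
  have huniq : ∀ e ∈ E, (s e = b ∨ t e = b) → w e < 0 → e = f := fun e he hi hn =>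
    negative_edge_unique hloop hcons hQE hQ hmin he hfE hi hfb hn hfneg
  have hneg1 : ∀ C ⊆ E, (C.filter fun e => (s e = b ∨ t e = b) ∧ w e < 0).card
      = if f ∈ C then 1 else 0 := by
    intro C hC
    split_ifs with h
    · rw [Finset.card_eq_one]
      refine ⟨f, ?_⟩
      ext e
      simp only [Finset.mem_filter, Finset.mem_singleton]
      exact ⟨fun ⟨h1, h2, h3⟩ => huniq e (hC h1) h2 h3, by rintro rfl; exact ⟨h, hfb, hfneg⟩⟩
    · rw [Finset.card_eq_zero, Finset.filter_eq_empty_iff]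
      rintro e he ⟨h2, h3⟩
      exact h (huniq e (hC he) h2 h3 ▸ he)
  have habs : ∀ e ∈ E, (shrinkAt s t w b e).natAbs ≤ (w e).natAbs := by
    intro e he
    have := hzero e he
    unfold shrinkAt
    split_ifs <;> omega
  have hlt : ∑ e ∈ E, (shrinkAt s t w b e).natAbs < ∑ e ∈ E, (w e).natAbs := by
    refine Finset.sum_lt_sum habs ⟨f, hfE, ?_⟩
    simp only [shrinkAt, if_pos hfb, if_pos hfneg]
    omega
  have hinc : ∀ C ⊆ E, (∀ y, bdry s t C y = 0) →
      Even (C.filter fun e => s e = b ∨ t e = b).card := fun C hC hCb =>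
    even_card_incident (fun e he => hloop e (hC he)) (hCb b)
  have main := ih _ (by rw [← hn]; omega) s t E (shrinkAt s t w b) rfl
    (fun C hC hCb => shrinkAt_conservative hloop hzero hcons heven hQE hQ hmin _ C hC rfl hCb)
    (fun C hC hCb => by
      rw [sum_shrinkAt]
      obtain ⟨k, hk⟩ := heven C hC hCb
      obtain ⟨l, hl⟩ := hinc C hC hCb
      rw [hk, hl]
      exact ⟨k - l + ((C.filter fun e => (s e = b ∨ t e = b) ∧ w e < 0).card : ℤ), by
        push_cast; ring⟩)
    hbr K hKE hK
  rw [sum_shrinkAt, sum_shrinkAt, hneg1 K hKE, hneg1 E subset_rfl, if_pos hfE] at main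
  have hKcard : (K.filter fun e => s e = b ∨ t e = b).card
      ≤ (E.filter fun e => s e = b ∨ t e = b).card :=
    Finset.card_le_card (Finset.filter_subset_filter _ hKE)
  have hE2 : 2 ≤ (E.filter fun e => s e = b ∨ t e = b).card := by
    obtain ⟨C, hCE, hfC, hC⟩ := hbr f hfE
    have h1 : (C.filter fun e => s e = b ∨ t e = b).card
        ≤ (E.filter fun e => s e = b ∨ t e = b).card :=
      Finset.card_le_card (Finset.filter_subset_filter _ hCE)
    obtain ⟨k, hk⟩ := hinc C hCE hC
    have : 0 < (C.filter fun e => s e = b ∨ t e = b).card :=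
      Finset.card_pos.2 ⟨f, Finset.mem_filter.2 ⟨hfC, hfb⟩⟩
    omega
  obtain ⟨k, hk⟩ := hinc K hKE hK
  by_cases hfK : f ∈ K
  · rw [if_pos hfK] at main
    push_cast at main
    omega
  · rw [if_neg hfK] at main
    push_cast at main
    have : (K.filter fun e => s e = b ∨ t e = b).card
        < (E.filter fun e => s e = b ∨ t e = b).card := by
      refine Finset.card_lt_card ⟨Finset.filter_subset_filter _ hKE, fun h => hfK ?_⟩
      exact (Finset.mem_filter.1 (h (Finset.mem_filter.2 ⟨hfE, hfb⟩))).1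
    omega

/-- Every bridgeless multigraph has, for every weighting, an edge set of at most a third of the
total weight whose complement is even. -/
theorem exists_join_weight_le_third [Fintype V] [DecidableEq ι] (s t : ι → V) (E : Finset ι)
    (c : ι → ℤ) (hbr : ∀ e ∈ E, ∃ C ⊆ E, e ∈ C ∧ ∀ y, bdry s t C y = 0) :
    ∃ J ⊆ E, (∀ y, bdry s t (E \ J) y = 0) ∧ 3 * ∑ e ∈ J, c e ≤ ∑ e ∈ E, c e := by
  obtain ⟨J, hJ, hmin⟩ := Finset.exists_min_image
    (E.powerset.filter fun J => ∀ y, bdry s t (E \ J) y = 0) (fun J => ∑ e ∈ J, c e)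
    ⟨E, by simp⟩
  simp only [Finset.mem_filter, Finset.mem_powerset] at hJ hmin
  obtain ⟨hJE, hJb⟩ := hJ
  refine ⟨J, hJE, hJb, ?_⟩
  have hJ' : ∀ y, bdry s t E y = bdry s t J y := fun y => by
    have h1 := bdry_sdiff s t hJE y
    rw [hJb] at h1
    linear_combination - zmod_two_add_self (bdry s t J y) - h1
  have hsum : ∀ C ⊆ E, ∑ e ∈ C, (if e ∈ J then - (2 * c e) else 2 * c e)
      = 2 * (∑ e ∈ symmDiff J C, c e - ∑ e ∈ J, c e) := by
    intro C _
    rw [sum_symmDiff_eq, two_nsmul]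
    have h2 : ∀ e, (if e ∈ J then - (2 * c e) else 2 * c e)
        = 2 * c e - (if e ∈ J then 4 * c e else 0) := by
      intro e
      split_ifs <;> ring
    simp_rw [h2]
    rw [Finset.sum_sub_distrib, ← Finset.sum_filter, Finset.filter_mem_eq_inter,
      ← Finset.mul_sum, ← Finset.mul_sum, Finset.inter_comm]
    ring
  have main := sum_even_le_two_mul_sum _ s t E (fun e => if e ∈ J then - (2 * c e) else 2 * c e)
    rfl ?_ ?_ hbr (E \ J) Finset.sdiff_subset hJb
  · rw [hsum _ Finset.sdiff_subset, hsum _ subset_rfl] at main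
    have h1 : symmDiff J (E \ J) = E := by
      ext e
      have := @hJE e
      simp only [Finset.mem_symmDiff, Finset.mem_sdiff]
      tauto
    have h2 : symmDiff J E = E \ J := by
      ext e
      have := @hJE e
      simp only [Finset.mem_symmDiff, Finset.mem_sdiff]
      tauto
    have h3 := Finset.sum_sdiff (f := c) hJE
    rw [h1, h2] at main
    omega
  · intro C hC hCb
    rw [hsum C hC]
    have hsub : symmDiff J C ⊆ E := by
      intro e he
      rcases Finset.mem_symmDiff.1 he with h | h
      · exact hJE h.1
      · exact hC h.1
    have := hmin (symmDiff J C) ⟨hsub, fun y => by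
      rw [bdry_sdiff _ _ hsub, bdry_symmDiff, hCb, add_zero, hJ', zmod_two_add_self]⟩
    omega
  · intro C hC _
    rw [hsum C hC]
    exact even_two_mul _

end Conservative

section Rounding

/-- Moving along a line from a nonnegative vector until a further coordinate vanishes. -/
lemma exists_step_to_boundary {J : Type*} [Fintype J] (α β : J → ℝ) (h0 : ∀ j, 0 ≤ α j)
    (h1 : ∀ j, α j = 0 → β j = 0) (h2 : ∃ j, β j < 0) :
    ∃ θ : ℝ, 0 < θ ∧ (∀ j, 0 ≤ α j + θ * β j) ∧ ∃ j, 0 < α j ∧ α j + θ * β j = 0 := by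
  obtain ⟨j0, hj0⟩ := h2
  have hpos : ∀ j, β j < 0 → 0 < α j := fun j hj =>
    lt_of_le_of_ne (h0 j) fun h => by rw [h1 j h.symm] at hj; exact lt_irrefl _ hj
  obtain ⟨j, hj, hmin⟩ := Finset.exists_min_image (Finset.univ.filter fun j => β j < 0)
    (fun j => α j / (- β j)) ⟨j0, by simpa using hj0⟩
  simp only [Finset.mem_filter, Finset.mem_univ, true_and] at hj hmin
  have hθ : 0 < α j / (- β j) := div_pos (hpos j hj) (by linarith)
  refine ⟨α j / (- β j), hθ, fun i => ?_, j, hpos j hj, ?_⟩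
  · rcases lt_or_ge (β i) 0 with h | h
    · have := hmin i h
      rw [le_div_iff₀ (by linarith)] at this
      linarith
    · have := h0 i
      positivity
  · have : β j ≠ 0 := hj.ne
    field_simp
    ring

variable {A N : Type*} [Fintype A]

/-- The net outflow of `x` at the node `n`, where the arc `a` runs from `tl a` to `hd a`. -/
noncomputable def netFlow (tl hd : A → N) (x : A → ℝ) (n : N) : ℝ :=
  ∑ a, x a * ((if tl a = n then 1 else 0) - (if hd a = n then 1 else 0))

lemma netFlow_add_mul (tl hd : A → N) (x d : A → ℝ) (θ : ℝ) (n : N) :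
    netFlow tl hd (fun a => x a + θ * d a) n = netFlow tl hd x n + θ * netFlow tl hd d n := by
  unfold netFlow
  rw [Finset.mul_sum, ← Finset.sum_add_distrib]
  exact Finset.sum_congr rfl fun a _ => by ring

lemma sum_netFlow [Fintype N] (tl hd : A → N) (x : A → ℝ) : ∑ n, netFlow tl hd x n = 0 := by
  unfold netFlow
  rw [Finset.sum_comm]
  refine Finset.sum_eq_zero fun a _ => ?_
  rw [← Finset.mul_sum, Finset.sum_sub_distrib]
  simp

lemma exists_int_sum {ι : Type*} (s : Finset ι) (f : ι → ℝ) (h : ∀ i ∈ s, ∃ k : ℤ, f i = k) :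
    ∃ k : ℤ, ∑ i ∈ s, f i = k := by
  refine Finset.sum_induction f (fun r => ∃ k : ℤ, r = k) ?_ ⟨0, by simp⟩ h
  rintro _ _ ⟨k, rfl⟩ ⟨l, rfl⟩
  exact ⟨k + l, by push_cast; rfl⟩

lemma exists_circulation_on_nonintegral [Fintype N] (tl hd : A → N) (x : A → ℝ)
    (hx : ∀ n, netFlow tl hd x n = 0) {a₀ : A} (ha₀ : ¬ ∃ k : ℤ, x a₀ = k) :
    ∃ d : A → ℝ, d ≠ 0 ∧ (∀ a, (∃ k : ℤ, x a = k) → d a = 0) ∧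
      ∀ n, netFlow tl hd d n = 0 := by
  by_cases hloop : ∃ a, tl a = hd a ∧ ¬ ∃ k : ℤ, x a = k
  · obtain ⟨a, h1, h2⟩ := hloop
    refine ⟨Pi.single a 1, by simp, fun b hb => ?_, fun n => ?_⟩
    · rw [Pi.single_eq_of_ne]
      rintro rfl
      exact h2 hb
    · refine Finset.sum_eq_zero fun b _ => ?_
      by_cases h : b = a
      · subst h; rw [h1, sub_self, mul_zero]
      · rw [Pi.single_eq_of_ne h, zero_mul]
  push Not at hloop
  set A0 : Finset A := Finset.univ.filter fun a => ¬ ∃ k : ℤ, x a = k with hA0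
  have hmem : ∀ a, a ∈ A0 ↔ ¬ ∃ k : ℤ, x a = k := fun a => by simp [hA0]
  have hnl : ∀ a ∈ A0, tl a ≠ hd a := fun a ha h => (hmem a).1 ha (hloop a h)
  set T : Finset N := A0.image tl ∪ A0.image hd with hT
  have hmT : ∀ n, n ∈ T ↔ ∃ a ∈ A0, tl a = n ∨ hd a = n := by
    intro n
    simp only [hT, Finset.mem_union, Finset.mem_image]
    constructor
    · rintro (⟨a, h, h'⟩ | ⟨a, h, h'⟩)
      · exact ⟨a, h, .inl h'⟩
      · exact ⟨a, h, .inr h'⟩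
    · rintro ⟨a, h, h' | h'⟩
      · exact .inl ⟨a, h, h'⟩
      · exact .inr ⟨a, h, h'⟩
  have htwo : ∀ n ∈ T, 2 ≤ (A0.bipartiteAbove (fun n a => tl a = n ∨ hd a = n) n).card := by
    intro n hn
    obtain ⟨a, ha, han⟩ := (hmT n).1 hn
    by_contra hlt
    have huniq : ∀ b ∈ A0, (tl b = n ∨ hd b = n) → b = a := by
      intro b hb hbn
      exact Finset.card_le_one.1 (by omega : (A0.bipartiteAbove
        (fun n a => tl a = n ∨ hd a = n) n).card ≤ 1) b (by simp [Finset.bipartiteAbove, hb, hbn])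
        a (by simp [Finset.bipartiteAbove, ha, han])
    have h := hx n
    unfold netFlow at h
    rw [← Finset.add_sum_erase _ _ (Finset.mem_univ a)] at h
    obtain ⟨k, hk⟩ := exists_int_sum (Finset.univ.erase a)
      (fun a => x a * ((if tl a = n then 1 else 0) - (if hd a = n then 1 else 0))) (by
        intro b hb
        by_cases hbA : b ∈ A0
        · have : ¬ (tl b = n ∨ hd b = n) := fun h => (Finset.mem_erase.1 hb).1 (huniq b hbA h)
          push Not at this
          exact ⟨0, by simp [this.1, this.2]⟩
        · have hb' := (hmem b).not.1 hbA
          rw [not_not] at hb'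
          obtain ⟨k, hk⟩ := hb'
          exact ⟨k * ((if tl b = n then 1 else 0) - (if hd b = n then 1 else 0)), by
            rw [hk]; push_cast; rfl⟩)
    rw [hk] at h
    apply (hmem a).1 ha
    have hne := hnl a ha
    rcases han with h' | h'
    · have h2 : hd a ≠ n := fun h2 => hne (h'.trans h2.symm)
      simp only [h', h2, if_true, if_false] at h
      exact ⟨-k, by push_cast; linarith⟩
    · have h2 : tl a ≠ n := fun h2 => hne (h2.trans h'.symm)
      simp only [h', h2, if_true, if_false] at h
      exact ⟨k, by linarith⟩
  have hcard : T.card ≤ A0.card := by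
    have := Finset.card_mul_le_card_mul (s := T) (t := A0) (m := 2) (n := 2)
      (fun n a => tl a = n ∨ hd a = n) htwo (fun a _ => by
        refine (Finset.card_le_card (t := {tl a, hd a}) ?_).trans Finset.card_le_two
        intro n hn
        have := (Finset.mem_filter.1 hn).2
        simp only [Finset.mem_insert, Finset.mem_singleton]
        exact this.imp Eq.symm Eq.symm)
    omega
  have ha₀' : a₀ ∈ A0 := (hmem _).2 ha₀
  have hn₀ : tl a₀ ∈ T := (hmT _).2 ⟨a₀, ha₀', .inl rfl⟩
  let ext : (A0 → ℝ) → A → ℝ := fun d a => if h : a ∈ A0 then d ⟨a, h⟩ else 0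
  let L : (A0 → ℝ) →ₗ[ℝ] ((T.erase (tl a₀) : Finset N) → ℝ) :=
    { toFun := fun d n => netFlow tl hd (ext d) n
      map_add' := fun d d' => by
        funext n
        have h := netFlow_add_mul tl hd (ext d) (ext d') 1 n
        simp only [one_mul] at h
        rw [Pi.add_apply, ← h]
        congr 1
        funext a
        by_cases ha : a ∈ A0 <;> simp [ext, ha]
      map_smul' := fun r d => by
        funext n
        have h := netFlow_add_mul tl hd 0 (ext d) r n
        have h0 : netFlow tl hd (0 : A → ℝ) n = 0 := by simp [netFlow]
        rw [h0, zero_add] at h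
        simp only [RingHom.id_apply, Pi.smul_apply, smul_eq_mul]
        rw [← h]
        congr 1
        funext a
        by_cases ha : a ∈ A0 <;> simp [ext, ha] }
  have hker : LinearMap.ker L ≠ ⊥ := by
    apply LinearMap.ker_ne_bot_of_finrank_lt
    rw [Module.finrank_fintype_fun_eq_card, Module.finrank_fintype_fun_eq_card,
      Fintype.card_coe, Fintype.card_coe, Finset.card_erase_of_mem hn₀]
    have := Finset.card_pos.2 ⟨_, hn₀⟩
    omega
  obtain ⟨d, hdL, hd0⟩ := (Submodule.ne_bot_iff _).1 hker
  have hL : ∀ n ∈ T, n ≠ tl a₀ → netFlow tl hd (ext d) n = 0 := fun n hn hne =>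
    congrFun (LinearMap.mem_ker.1 hdL) ⟨n, Finset.mem_erase.2 ⟨hne, hn⟩⟩
  have hout : ∀ n, n ∉ T → netFlow tl hd (ext d) n = 0 := by
    intro n hn
    refine Finset.sum_eq_zero fun a _ => ?_
    by_cases ha : a ∈ A0
    · have h1 : tl a ≠ n := fun h => hn ((hmT n).2 ⟨a, ha, .inl h⟩)
      have h2 : hd a ≠ n := fun h => hn ((hmT n).2 ⟨a, ha, .inr h⟩)
      simp [h1, h2]
    · simp [ext, ha]
  have hne : ∀ n, n ≠ tl a₀ → netFlow tl hd (ext d) n = 0 := fun n hn => by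
    by_cases h : n ∈ T
    · exact hL n h hn
    · exact hout n h
  refine ⟨ext d, fun h => hd0 ?_, fun a ha => ?_, fun n => ?_⟩
  · funext a
    have := congrFun h a.1
    simpa [ext] using this
  · have : a ∉ A0 := fun h => (hmem a).1 h ha
    simp [ext, this]
  · by_cases h : n = tl a₀
    · have hs := sum_netFlow tl hd (ext d)
      rw [Finset.sum_eq_single (tl a₀) (fun n _ h => hne n h) (by simp)] at hs
      rw [h, hs]
    · exact hne n h

/-- A real circulation can be rounded to an integral one, arc by arc up or down, without
increasing a given linear cost. -/
theorem exists_integral_circulation [Fintype N] (tl hd : A → N) (c : A → ℝ) (k : ℕ) :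
    ∀ x : A → ℝ, (Finset.univ.filter fun a => ¬ ∃ k : ℤ, x a = k).card = k →
    (∀ n, netFlow tl hd x n = 0) →
    ∃ z : A → ℤ, (∀ n, netFlow tl hd (fun a => (z a : ℝ)) n = 0) ∧
      (∀ a, ⌊x a⌋ ≤ z a ∧ z a ≤ ⌈x a⌉) ∧ ∑ a, c a * z a ≤ ∑ a, c a * x a := by
  induction k using Nat.strong_induction_on with
  | _ k ih =>
  intro x hk hx
  by_cases hall : ∀ a, ∃ k : ℤ, x a = k
  · choose z hz using hall
    obtain rfl : x = fun a => (z a : ℝ) := funext hz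
    exact ⟨z, hx, by simp, le_rfl⟩
  push Not at hall
  obtain ⟨a₀, ha₀⟩ := hall
  have ha₀' : ¬ ∃ k : ℤ, x a₀ = k := by push Not; exact ha₀
  obtain ⟨d, hd0, hdA, hdn, hdc⟩ : ∃ d : A → ℝ, d ≠ 0 ∧ (∀ a, (∃ k : ℤ, x a = k) → d a = 0) ∧
      (∀ n, netFlow tl hd d n = 0) ∧ ∑ a, c a * d a ≤ 0 := by
    obtain ⟨d, h1, h2, h3⟩ := exists_circulation_on_nonintegral tl hd x hx ha₀'
    rcases le_total (∑ a, c a * d a) 0 with h | h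
    · exact ⟨d, h1, h2, h3, h⟩
    · refine ⟨-d, by simpa using h1, fun a ha => by simp [h2 a ha], fun n => ?_, by simpa using h⟩
      have := h3 n
      unfold netFlow at this ⊢
      simp only [Pi.neg_apply, neg_mul, Finset.sum_neg_distrib, this, neg_zero]
  obtain ⟨a₁, ha₁⟩ := Function.ne_iff.1 hd0
  obtain ⟨θ, hθ, hnn, hz⟩ := exists_step_to_boundary (J := A ⊕ A)
    (Sum.elim (fun a => x a - ⌊x a⌋) (fun a => ⌈x a⌉ - x a))
    (Sum.elim d (fun a => - d a))
    (by
      rintro (a | a)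
      · simp
      · simpa using Int.le_ceil (x a))
    (by
      rintro (a | a) h
      · exact hdA a ⟨_, sub_eq_zero.1 h⟩
      · simp only [Sum.elim_inr, neg_eq_zero]
        exact hdA a ⟨_, (sub_eq_zero.1 h).symm⟩)
    (by
      rcases lt_or_gt_of_ne ha₁ with h | h
      · exact ⟨.inl a₁, h⟩
      · exact ⟨.inr a₁, by simpa using h⟩)
  set x' : A → ℝ := fun a => x a + θ * d a with hx'
  have hlo : ∀ a, (⌊x a⌋ : ℝ) ≤ x' a := fun a => by
    have := hnn (.inl a); simp only [Sum.elim_inl] at this; simp only [hx']; linarith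
  have hhi : ∀ a, x' a ≤ (⌈x a⌉ : ℝ) := fun a => by
    have := hnn (.inr a); simp only [Sum.elim_inr] at this; simp only [hx']; linarith
  have hsame : ∀ a, (∃ k : ℤ, x a = k) → x' a = x a := fun a ha => by simp [hx', hdA a ha]
  obtain ⟨a₂, h₂, h₂'⟩ : ∃ a, (¬ ∃ k : ℤ, x a = k) ∧ ∃ k : ℤ, x' a = k := by
    obtain ⟨a | a, h1, h2⟩ := hz
    · simp only [Sum.elim_inl] at h1 h2
      refine ⟨a, ?_, ⌊x a⌋, by simp only [hx']; linarith⟩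
      rintro ⟨k, hk⟩
      simp [hk] at h1
    · simp only [Sum.elim_inr] at h1 h2
      refine ⟨a, ?_, ⌈x a⌉, by simp only [hx']; linarith⟩
      rintro ⟨k, hk⟩
      simp [hk] at h1
  have hlt : (Finset.univ.filter fun a => ¬ ∃ k : ℤ, x' a = k).card < k := by
    rw [← hk]
    apply Finset.card_lt_card
    rw [Finset.ssubset_iff_of_subset]
    · exact ⟨a₂, by simpa using h₂, by simpa using h₂'⟩
    · intro a ha
      simp only [Finset.mem_filter, Finset.mem_univ, true_and] at ha ⊢
      intro h
      rw [hsame a h] at ha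
      exact ha h
  obtain ⟨z, hz1, hz2, hz3⟩ := ih _ hlt x' rfl (fun n => by
    rw [hx', netFlow_add_mul, hx, hdn, mul_zero, add_zero])
  refine ⟨z, hz1, fun a => ⟨?_, ?_⟩, hz3.trans ?_⟩
  · exact (Int.le_floor.2 (hlo a)).trans (hz2 a).1
  · exact (hz2 a).2.trans (Int.ceil_le.2 (hhi a))
  · have : ∑ a, c a * x' a = ∑ a, c a * x a + θ * ∑ a, c a * d a := by
      rw [Finset.mul_sum, ← Finset.sum_add_distrib]
      exact Finset.sum_congr rfl fun a _ => by simp only [hx']; ring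
    nlinarith

end Rounding

section Sparse

lemma exists_basic_solution {E J : Type*} [Fintype E] [Fintype J] (χ : J → E → ℝ) (k : ℕ) :
    ∀ x : E → ℝ, (Finset.univ.filter fun e => x e ≠ 0).card
      + (Finset.univ.filter fun j => ∑ e, χ j e * x e ≠ 2).card = k →
    (∀ e, 0 ≤ x e) → (∀ j, 2 ≤ ∑ e, χ j e * x e) →
    ∃ x' : E → ℝ, (∀ e, 0 ≤ x' e) ∧ (∀ j, 2 ≤ ∑ e, χ j e * x' e) ∧ ∑ e, x' e ≤ ∑ e, x e ∧
      (∀ e, x e = 0 → x' e = 0) ∧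
      ∀ d : E → ℝ, (∀ e, x' e = 0 → d e = 0) →
        (∀ j, ∑ e, χ j e * x' e = 2 → ∑ e, χ j e * d e = 0) → d = 0 := by
  induction k using Nat.strong_induction_on with
  | _ k ih =>
  intro x hk hx hc
  by_cases hbasic : ∀ d : E → ℝ, (∀ e, x e = 0 → d e = 0) →
      (∀ j, ∑ e, χ j e * x e = 2 → ∑ e, χ j e * d e = 0) → d = 0
  · exact ⟨x, hx, hc, le_rfl, fun _ h => h, hbasic⟩
  obtain ⟨d, hd1, hd2, hd0, hds⟩ : ∃ d : E → ℝ, (∀ e, x e = 0 → d e = 0) ∧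
      (∀ j, ∑ e, χ j e * x e = 2 → ∑ e, χ j e * d e = 0) ∧ d ≠ 0 ∧ ∑ e, d e ≤ 0 := by
    push Not at hbasic
    obtain ⟨d, h1, h2, h3⟩ := hbasic
    rcases le_total (∑ e, d e) 0 with h | h
    · exact ⟨d, h1, h2, h3, h⟩
    · exact ⟨-d, fun e he => by simp [h1 e he], fun j hj => by simp [h2 j hj], by simpa using h3,
        by simpa using h⟩
  have hneg : ∃ e, d e < 0 := by
    by_contra! h
    exact hd0 (funext fun e => (Finset.sum_eq_zero_iff_of_nonneg fun e _ => h e).1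
      (le_antisymm hds (Finset.sum_nonneg fun e _ => h e)) e (Finset.mem_univ e))
  obtain ⟨θ, hθ, hnn, hz⟩ := exists_step_to_boundary (J := E ⊕ J)
    (Sum.elim x (fun j => ∑ e, χ j e * x e - 2)) (Sum.elim d (fun j => ∑ e, χ j e * d e))
    (by
      rintro (e | j)
      · exact hx e
      · simpa using hc j)
    (by
      rintro (e | j) h
      · exact hd1 e h
      · exact hd2 j (sub_eq_zero.1 h))
    (by obtain ⟨e, he⟩ := hneg; exact ⟨.inl e, he⟩)
  set x' : E → ℝ := fun e => x e + θ * d e with hx'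
  have hval : ∀ j, ∑ e, χ j e * x' e = ∑ e, χ j e * x e + θ * ∑ e, χ j e * d e := fun j => by
    rw [Finset.mul_sum, ← Finset.sum_add_distrib]
    exact Finset.sum_congr rfl fun e _ => by simp only [hx']; ring
  have hzero : ∀ e, x e = 0 → x' e = 0 := fun e he => by simp [hx', he, hd1 e he]
  have htight : ∀ j, ∑ e, χ j e * x e = 2 → ∑ e, χ j e * x' e = 2 := fun j hj => by
    rw [hval, hj, hd2 j hj]; ring
  have hs1 : (Finset.univ.filter fun e => x' e ≠ 0) ⊆ Finset.univ.filter fun e => x e ≠ 0 :=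
    Finset.monotone_filter_right _ fun e _ h h' => h (hzero e h')
  have hs2 : (Finset.univ.filter fun j => ∑ e, χ j e * x' e ≠ 2) ⊆
      Finset.univ.filter fun j => ∑ e, χ j e * x e ≠ 2 :=
    Finset.monotone_filter_right _ fun e _ h h' => h (htight e h')
  have hlt : (Finset.univ.filter fun e => x' e ≠ 0).card
      + (Finset.univ.filter fun j => ∑ e, χ j e * x' e ≠ 2).card < k := by
    have c1 := Finset.card_le_card hs1
    have c2 := Finset.card_le_card hs2
    obtain ⟨e | j, h1, h2⟩ := hz
    · simp only [Sum.elim_inl] at h1 h2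
      have := Finset.card_lt_card ((Finset.ssubset_iff_of_subset hs1).2
        ⟨e, by simpa using h1.ne', by simpa [hx'] using h2⟩)
      omega
    · simp only [Sum.elim_inr] at h1 h2
      have := Finset.card_lt_card ((Finset.ssubset_iff_of_subset hs2).2
        ⟨j, by simp only [Finset.mem_filter, Finset.mem_univ, true_and]; linarith, by
          simp only [Finset.mem_filter, Finset.mem_univ, true_and, not_not, hval]; linarith⟩)
      omega
  obtain ⟨y, h1, h2, h3, h4, h5⟩ := ih _ hlt x' rfl (fun e => hnn (.inl e)) (fun j => by
    have := hnn (.inr j)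
    simp only [Sum.elim_inr] at this
    rw [hval]; linarith)
  refine ⟨y, h1, h2, h3.trans ?_, fun e he => h4 e (hzero e he), h5⟩
  have : ∑ e, x' e = ∑ e, x e + θ * ∑ e, d e := by
    rw [Finset.mul_sum, ← Finset.sum_add_distrib]
  nlinarith

/-- An intersecting family on which `φ` is modular spans at most `2 |A| - 1` dimensions. -/
theorem exists_span_of_intersecting {α M : Type*} [AddCommGroup M] [Module ℝ M] (k : ℕ) :
    ∀ (A : Finset α) (F : Set (Finset α)) (φ : Finset α → M), A.card = k → A.Nonempty →
    (∀ S ∈ F, S ⊆ A ∧ S.Nonempty) →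
    (∀ S ∈ F, ∀ T ∈ F, (S ∩ T).Nonempty →
      S ∩ T ∈ F ∧ S ∪ T ∈ F ∧ φ S + φ T = φ (S ∩ T) + φ (S ∪ T)) →
    ∃ B : Finset M, B.card + 1 ≤ 2 * A.card ∧ ∀ S ∈ F, φ S ∈ Submodule.span ℝ (B : Set M) := by
  induction k using Nat.strong_induction_on with
  | _ k ih =>
  intro A F φ hk hA hF hclosed
  by_cases hsing : ∀ S ∈ F, S.card ≤ 1
  · refine ⟨A.image fun v => φ {v}, ?_, fun S hS => Submodule.subset_span ?_⟩
    · have h1 := Finset.card_image_le (s := A) (f := fun v => φ {v})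
      have := hA.card_pos
      omega
    · obtain ⟨v, rfl⟩ := Finset.card_eq_one.1
        (le_antisymm (hsing S hS) (hF S hS).2.card_pos)
      exact Finset.mem_coe.2 (Finset.mem_image.2 ⟨v, by simpa using (hF _ hS).1, rfl⟩)
  push Not at hsing
  obtain ⟨M₁, hM₁, hM₁'⟩ := hsing
  obtain ⟨N, hN, hmin⟩ := Finset.exists_min_image
    (A.powerset.filter fun S => S ∈ F ∧ 1 < S.card) Finset.card
    ⟨M₁, by simpa using ⟨(hF _ hM₁).1, hM₁, hM₁'⟩⟩
  simp only [Finset.mem_filter, Finset.mem_powerset] at hN hmin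
  obtain ⟨hNA, hNF, hN2⟩ := hN
  obtain ⟨v₀, hv₀⟩ := (hF N hNF).2
  set A' := A \ (N.erase v₀) with hA'
  set ext : Finset α → Finset α := fun S => if v₀ ∈ S then S ∪ N else S with hext
  have hsub : N.erase v₀ ⊆ A := (Finset.erase_subset _ _).trans hNA
  have hcardA' : A'.card + N.card = A.card + 1 := by
    have h1 : A'.card + _ = _ := Finset.card_sdiff_add_card_eq_card hsub
    have h2 := Finset.card_erase_add_one hv₀
    omega
  have hv₀A' : v₀ ∈ A' := by simp [hA', hNA hv₀]
  have hextF : ∀ S ∈ F, (N ⊆ S ∨ S ∩ N = ∅) →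
      ∃ S' ⊆ A', S'.Nonempty ∧ ext S' = S := by
    intro S hS h
    obtain ⟨hSA, hSn⟩ := hF S hS
    rcases h with h | h
    · refine ⟨S \ (N.erase v₀), Finset.sdiff_subset_sdiff hSA le_rfl,
        ⟨v₀, by simp [h hv₀]⟩, ?_⟩
      have : v₀ ∈ S \ (N.erase v₀) := by simp [h hv₀]
      simp only [hext, this, if_true]
      ext a
      have := @h a
      have h3 := @h v₀ hv₀
      by_cases ha : a = v₀
      · subst ha; simp [h3]
      · simp [ha]; tauto
    · have hn : v₀ ∉ S := fun h' => by
        have : v₀ ∈ S ∩ N := Finset.mem_inter.2 ⟨h', hv₀⟩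
        simp [h] at this
      refine ⟨S, fun a ha => ?_, hSn, by simp [hext, hn]⟩
      have : a ∉ N := fun h' => by
        have : a ∈ S ∩ N := Finset.mem_inter.2 ⟨ha, h'⟩
        simp [h] at this
      simp [hA', hSA ha, this]
  have hdisj : ∀ S ⊆ A', v₀ ∉ S → ∀ a ∈ S, a ∉ N := by
    intro S hS hv a ha haN
    have := hS ha
    simp only [hA', Finset.mem_sdiff, Finset.mem_erase, not_and] at this
    exact this.2 (fun h => hv (h ▸ ha)) haN
  have hmem_ext : ∀ S a, a ∈ ext S ↔ a ∈ S ∨ (v₀ ∈ S ∧ a ∈ N) := by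
    intro S a
    by_cases h : v₀ ∈ S <;> simp [hext, h]
  have hext_inter : ∀ S ⊆ A', ∀ T ⊆ A', ext (S ∩ T) = ext S ∩ ext T := by
    intro S hS T hT
    ext a
    have h1 := fun h => hdisj S hS h a
    have h2 := fun h => hdisj T hT h a
    simp only [hmem_ext, Finset.mem_inter]
    tauto
  have hext_union : ∀ S T, ext (S ∪ T) = ext S ∪ ext T := by
    intro S T
    ext a
    simp only [hmem_ext, Finset.mem_union]
    tauto
  obtain ⟨B', hB'1, hB'2⟩ := ih A'.card (by omega) A' {S | S ⊆ A' ∧ S.Nonempty ∧ ext S ∈ F}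
    (φ ∘ ext) rfl ⟨v₀, hv₀A'⟩ (fun S hS => ⟨hS.1, hS.2.1⟩) (by
      rintro S ⟨hS1, hS2, hS3⟩ T ⟨hT1, hT2, hT3⟩ hST
      have hle : S ∩ T ⊆ ext (S ∩ T) := by
        simp only [hext]; split_ifs
        · exact Finset.subset_union_left
        · exact le_rfl
      have := hclosed _ hS3 _ hT3 (by
        rw [← hext_inter S hS1 T hT1]
        exact hST.mono hle)
      rw [← hext_inter S hS1 T hT1, ← hext_union] at this
      exact ⟨⟨Finset.inter_subset_left.trans hS1, hST, this.1⟩,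
        ⟨Finset.union_subset hS1 hT1, hS2.mono Finset.subset_union_left, this.2.1⟩, this.2.2⟩)
  refine ⟨B' ∪ N.image fun v => φ {v}, ?_, ?_⟩
  · have h1 := Finset.card_union_le B' (N.image fun v => φ {v})
    have h2 := Finset.card_image_le (s := N) (f := fun v => φ {v})
    omega
  have hmono : Submodule.span ℝ (B' : Set M) ≤
      Submodule.span ℝ ((B' ∪ N.image fun v => φ {v} : Finset M) : Set M) :=
    Submodule.span_mono (by simp)
  have hgood : ∀ S ∈ F, (N ⊆ S ∨ S ∩ N = ∅) →
      φ S ∈ Submodule.span ℝ ((B' ∪ N.image fun v => φ {v} : Finset M) : Set M) := by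
    intro S hS h
    obtain ⟨S', h1, h2, rfl⟩ := hextF S hS h
    exact hmono (hB'2 S' ⟨h1, h2, hS⟩)
  intro S hS
  by_cases h : N ⊆ S ∨ S ∩ N = ∅
  · exact hgood S hS h
  push Not at h
  obtain ⟨h1, h2⟩ := h
  obtain ⟨hi, hu, hmod⟩ := hclosed S hS N hNF h2
  have hlt : (S ∩ N).card < N.card := Finset.card_lt_card
    ((Finset.inter_subset_right).ssubset_of_ne fun h => h1 (h ▸ Finset.inter_subset_left))
  have hcard1 : (S ∩ N).card = 1 := by
    by_contra hne
    have := hmin (S ∩ N) ⟨(hF _ hi).1, hi, by have := h2.card_pos; omega⟩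
    omega
  obtain ⟨v, hv⟩ := Finset.card_eq_one.1 hcard1
  have hvN : v ∈ N := Finset.inter_subset_right (hv ▸ Finset.mem_singleton_self v)
  rw [hv] at hmod
  rw [eq_sub_of_add_eq hmod]
  refine Submodule.sub_mem _ (Submodule.add_mem _ (Submodule.subset_span ?_)
    (hgood _ hu (.inl Finset.subset_union_right))) (hgood _ hNF (.inl le_rfl))
  simp only [Finset.coe_union, Set.mem_union, Finset.mem_coe, Finset.mem_image]
  exact .inr ⟨v, hvN, rfl⟩

end Sparse

section HeldKarp

variable {V : Type*}

/-- The incidence vector of the cut of `S`. -/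
noncomputable def cutInd (S : Set V) (e : Sym2 V) : ℝ :=
  if ∃ a b, e = s(a, b) ∧ a ∈ S ∧ b ∉ S then 1 else 0

lemma crosses_mk (S : Set V) (a b : V) :
    (∃ c d, s(a, b) = s(c, d) ∧ c ∈ S ∧ d ∉ S) ↔ ¬ (a ∈ S ↔ b ∈ S) := by
  constructor
  · rintro ⟨c, d, h, hc, hd⟩
    rcases Sym2.eq_iff.1 h with ⟨rfl, rfl⟩ | ⟨rfl, rfl⟩ <;> tauto
  · intro h
    by_cases ha : a ∈ S
    · exact ⟨a, b, rfl, ha, by tauto⟩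
    · exact ⟨b, a, Sym2.eq_swap, by tauto, ha⟩

lemma cutInd_mk (S : Set V) (a b : V) :
    cutInd S s(a, b) = if (a ∈ S ↔ b ∈ S) then 0 else 1 := by
  unfold cutInd
  simp only [crosses_mk]
  by_cases h : a ∈ S ↔ b ∈ S <;> simp [h]

lemma cutInd_compl (S : Set V) (e : Sym2 V) : cutInd Sᶜ e = cutInd S e := by
  induction e with
  | _ a b =>
    rw [cutInd_mk, cutInd_mk]
    simp only [Set.mem_compl_iff, not_iff_not]

lemma cutInd_modular_le (S T : Set V) (e : Sym2 V) :
    cutInd (S ∩ T) e + cutInd (S ∪ T) e ≤ cutInd S e + cutInd T e := by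
  induction e with
  | _ a b =>
    simp only [cutInd_mk, Set.mem_inter_iff, Set.mem_union]
    by_cases h1 : a ∈ S <;> by_cases h2 : b ∈ S <;> by_cases h3 : a ∈ T <;>
      by_cases h4 : b ∈ T <;> simp [h1, h2, h3, h4]

variable [Fintype V]

lemma cutValue_eq_sum (G : SimpleGraph V) {x : Sym2 V → ℝ} (hx : ∀ e ∉ G.edgeSet, x e = 0)
    (S : Set V) : cutValue G x S = ∑ e, cutInd S e * x e := by
  unfold cutValue cutInd
  rw [Finset.sum_filter]
  refine Finset.sum_congr rfl fun e _ => ?_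
  by_cases h : e ∈ G.edgeSet
  · simp [h]
  · simp [h, hx e h]

lemma lpValue_eq_sum (G : SimpleGraph V) {x : Sym2 V → ℝ} (hx : ∀ e ∉ G.edgeSet, x e = 0) :
    lpValue G x = ∑ e, x e := by
  unfold lpValue
  rw [Finset.sum_filter]
  refine Finset.sum_congr rfl fun e _ => ?_
  by_cases h : e ∈ G.edgeSet
  · simp [h]
  · simp [h, hx e h]

/-- Linear independence over a spanning set bounds the size of the support. -/
lemma card_support_le_of_span {E : Type*} [Fintype E] (P : Finset E) (B : Finset (E → ℝ))
    (h : ∀ d : E → ℝ, (∀ e, e ∉ P → d e = 0) → (∀ b ∈ B, ∑ e, b e * d e = 0) → d = 0) :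
    P.card ≤ B.card := by
  by_contra! hlt
  let ext : (P → ℝ) → E → ℝ := fun d e => if h : e ∈ P then d ⟨e, h⟩ else 0
  let L : (P → ℝ) →ₗ[ℝ] (B → ℝ) :=
    { toFun := fun d b => ∑ e, b.1 e * ext d e
      map_add' := fun d d' => by
        funext b
        rw [Pi.add_apply, ← Finset.sum_add_distrib]
        refine Finset.sum_congr rfl fun e _ => ?_
        by_cases he : e ∈ P <;> simp [ext, he, mul_add]
      map_smul' := fun r d => by
        funext b
        simp only [RingHom.id_apply, Pi.smul_apply, smul_eq_mul, Finset.mul_sum]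
        refine Finset.sum_congr rfl fun e _ => ?_
        by_cases he : e ∈ P <;> simp [ext, he, mul_left_comm] }
  have hker : LinearMap.ker L ≠ ⊥ := by
    apply LinearMap.ker_ne_bot_of_finrank_lt
    rwa [Module.finrank_fintype_fun_eq_card, Module.finrank_fintype_fun_eq_card,
      Fintype.card_coe, Fintype.card_coe]
  obtain ⟨d, hd, hd0⟩ := (Submodule.ne_bot_iff _).1 hker
  have := h (ext d) (fun e he => by simp [ext, he])
    (fun b hb => congrFun (LinearMap.mem_ker.1 hd) ⟨b, hb⟩)
  apply hd0
  funext e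
  simpa [ext] using congrFun this e.1

/-- Every Held-Karp solution can be replaced by one of no larger value with at most `2 n - 3`
edges in its support. -/
theorem exists_sparse_heldKarp (G : SimpleGraph V) (hn : 2 ≤ Fintype.card V) {x : Sym2 V → ℝ}
    (hx : IsHeldKarp G x) :
    ∃ x' : Sym2 V → ℝ, IsHeldKarp G x' ∧ lpValue G x' ≤ lpValue G x ∧
      (∀ e ∉ G.edgeSet, x' e = 0) ∧ (∀ e, 0 ≤ x' e) ∧
      (Finset.univ.filter fun e => x' e ≠ 0).card + 3 ≤ 2 * Fintype.card V := by
  set y : Sym2 V → ℝ := fun e => if e ∈ G.edgeSet then x e else 0 with hy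
  have hy0 : ∀ e ∉ G.edgeSet, y e = 0 := fun e he => by simp [hy, he]
  have hcut : ∀ S, cutValue G y S = cutValue G x S := fun S =>
    Finset.sum_congr rfl fun e he => by simp [hy, (Finset.mem_filter.1 he).2.1]
  have hval : lpValue G y = lpValue G x :=
    Finset.sum_congr rfl fun e he => by simp [hy, (Finset.mem_filter.1 he).2]
  obtain ⟨x', hnn, hc, hs, hsupp, hbasic⟩ := exists_basic_solution
    (fun (S : {S : Set V // S.Nonempty ∧ S ≠ Set.univ}) e => cutInd S.1 e) _ y rfl
    (fun e => by
      by_cases he : e ∈ G.edgeSet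
      · simpa [hy, he] using hx.1 e he
      · simp [hy, he])
    (fun S => by
      rw [← cutValue_eq_sum G hy0, hcut]
      exact hx.2 S.1 S.2.1 S.2.2)
  have hx'0 : ∀ e ∉ G.edgeSet, x' e = 0 := fun e he => hsupp e (hy0 e he)
  refine ⟨x', ⟨fun e _ => hnn e, fun S h1 h2 => ?_⟩, ?_, hx'0, hnn, ?_⟩
  · rw [cutValue_eq_sum G hx'0]
    exact hc ⟨S, h1, h2⟩
  · rw [lpValue_eq_sum G hx'0, ← hval, lpValue_eq_sum G hy0]
    exact hs
  have hne : Nonempty V := Fintype.card_pos_iff.1 (by omega)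
  obtain ⟨r⟩ := hne
  set F : Set (Finset V) := {S | r ∉ S ∧ S.Nonempty ∧ ∑ e, cutInd (S : Set V) e * x' e = 2} with hF
  set φ : Finset V → Sym2 V → ℝ := fun S e => if x' e = 0 then 0 else cutInd (S : Set V) e with hφ
  have hge : ∀ S : Finset V, r ∉ S → S.Nonempty → 2 ≤ ∑ e, cutInd (S : Set V) e * x' e :=
    fun S h1 h2 => hc ⟨S, by simpa using h2, fun h => h1 (by
      have : r ∈ (S : Set V) := h ▸ Set.mem_univ r
      simpa using this)⟩
  have hcardA : (Finset.univ.erase r).card + 1 = Fintype.card V :=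
    Finset.card_erase_add_one (Finset.mem_univ r)
  obtain ⟨B, hB1, hB2⟩ := exists_span_of_intersecting _ (Finset.univ.erase r) F φ rfl
    (Finset.card_pos.1 (by omega))
    (fun S hS => ⟨fun a ha => Finset.mem_erase.2 ⟨fun h => hS.1 (h ▸ ha), Finset.mem_univ a⟩,
      hS.2.1⟩)
    (by
      rintro S ⟨hS1, hS2, hS3⟩ T ⟨hT1, hT2, hT3⟩ hST
      have hi1 : r ∉ S ∩ T := fun h => hS1 (Finset.mem_inter.1 h).1
      have hu1 : r ∉ S ∪ T := fun h => (Finset.mem_union.1 h).elim hS1 hT1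
      have hu2 : (S ∪ T).Nonempty := hS2.mono Finset.subset_union_left
      have h1 := hge _ hi1 hST
      have h2 := hge _ hu1 hu2
      have hpt : ∀ e, 0 ≤ (cutInd (S : Set V) e + cutInd (T : Set V) e
          - cutInd ((S ∩ T : Finset V) : Set V) e
          - cutInd ((S ∪ T : Finset V) : Set V) e) * x' e := fun e => by
        rw [Finset.coe_inter, Finset.coe_union]
        have := cutInd_modular_le (S : Set V) T e
        exact mul_nonneg (by linarith) (hnn e)
      have hsum : ∑ e, (cutInd (S : Set V) e + cutInd (T : Set V) e
          - cutInd ((S ∩ T : Finset V) : Set V) e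
          - cutInd ((S ∪ T : Finset V) : Set V) e) * x' e
          = 4 - ∑ e, cutInd ((S ∩ T : Finset V) : Set V) e * x' e
            - ∑ e, cutInd ((S ∪ T : Finset V) : Set V) e * x' e := by
        simp only [sub_mul, add_mul, Finset.sum_sub_distrib, Finset.sum_add_distrib, hS3, hT3]
        ring
      have hge0 := Finset.sum_nonneg fun e (_ : e ∈ Finset.univ) => hpt e
      refine ⟨⟨hi1, hST, by linarith⟩, ⟨hu1, hu2, by linarith⟩, ?_⟩
      have hz := (Finset.sum_eq_zero_iff_of_nonneg fun e _ => hpt e).1 (by linarith)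
      funext e
      by_cases he : x' e = 0
      · simp [hφ, he]
      · have := (mul_eq_zero.1 (hz e (Finset.mem_univ e))).resolve_right he
        simp only [hφ, Pi.add_apply, he, if_false]
        linarith)
  have hcard := card_support_le_of_span (Finset.univ.filter fun e => x' e ≠ 0) B (by
    intro d hd hdB
    have hspan : ∀ b ∈ Submodule.span ℝ (B : Set (Sym2 V → ℝ)), ∑ e, b e * d e = 0 := by
      intro b hb
      induction hb using Submodule.span_induction with
      | mem b hb => exact hdB b hb
      | zero => simp
      | add b c _ _ h1 h2 => simp [add_mul, Finset.sum_add_distrib, h1, h2]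
      | smul r b _ h => simp [mul_assoc, ← Finset.mul_sum, h]
    have hd' : ∀ e, x' e = 0 → d e = 0 := fun e he => hd e (by simpa using he)
    have hφd : ∀ S ∈ F, ∑ e, cutInd (S : Set V) e * d e = 0 := by
      intro S hS
      rw [← hspan _ (hB2 S hS)]
      refine Finset.sum_congr rfl fun e _ => ?_
      by_cases he : x' e = 0
      · simp [hd' e he]
      · simp [hφ, he]
    refine hbasic d hd' ?_
    rintro ⟨S, hS1, hS2⟩ ht
    simp only at ht ⊢
    by_cases hr : r ∈ S
    · have := hφd Sᶜ.toFinset ⟨by simpa using hr, 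
        Set.toFinset_nonempty.2 (Set.nonempty_compl.2 hS2), by simpa [cutInd_compl] using ht⟩
      simpa [cutInd_compl] using this
    · have := hφd S.toFinset ⟨by simpa using hr, by simpa using hS1, by simpa using ht⟩
      simpa using this)
  omega

end HeldKarp

section Dfs

/-- A depth-first search tree of the support graph of the weights `X`, given by its ancestor
order, in which every vertex descends first along an edge of largest weight. -/
structure DfsTree {V : Type*} (X : V → V → ℝ) where
  /-- The root. -/
  root : V
  /-- The ancestor relation. -/
  le : V → V → Prop
  /-- The parent of a vertex; the root is its own parent. -/
  par : V → V
  le_refl : ∀ v, le v v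
  le_trans : ∀ {a b c}, le a b → le b c → le a c
  le_antisymm : ∀ {a b}, le a b → le b a → a = b
  root_le : ∀ v, le root v
  chain : ∀ {a b u}, le a u → le b u → le a b ∨ le b a
  comparable : ∀ {a b}, 0 < X a b → le a b ∨ le b a
  par_root : par root = root
  par_le : ∀ w, le (par w) w
  par_ne : ∀ {w}, w ≠ root → par w ≠ w
  le_par : ∀ {a w}, w ≠ root → le a w → a ≠ w → le a (par w)
  par_pos : ∀ {w}, w ≠ root → 0 < X (par w) w
  par_max : ∀ {w u}, w ≠ root → le w u → X (par w) u ≤ X (par w) w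

variable {V : Type*}

/-- The ancestor order of a depth-first search tree on the vertex set `C` with root `v`. -/
structure IsDfsOrder (X : V → V → ℝ) (C : Finset V) (v : V) (le : V → V → Prop) : Prop where
  mem : ∀ {a b}, le a b → a ∈ C ∧ b ∈ C
  le_refl : ∀ {a}, a ∈ C → le a a
  le_trans : ∀ {a b c}, le a b → le b c → le a c
  le_antisymm : ∀ {a b}, le a b → le b a → a = b
  root_le : ∀ {a}, a ∈ C → le v a
  chain : ∀ {a b u}, le a u → le b u → le a b ∨ le b a
  comparable : ∀ {a b}, a ∈ C → b ∈ C → 0 < X a b → le a b ∨ le b a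
  exists_par : ∀ {w}, w ∈ C → w ≠ v → ∃ q, le q w ∧ q ≠ w ∧ (∀ a, le a w → a ≠ w → le a q) ∧
    0 < X q w ∧ ∀ u, le w u → X q u ≤ X q w

lemma exists_isDfsOrder {X : V → V → ℝ} (hsymm : ∀ a b, X a b = X b a) (k : ℕ) :
    ∀ (C : Finset V) (v : V), C.card = k → v ∈ C →
    (∀ a ∈ C, Relation.ReflTransGen (fun a b => a ∈ C ∧ b ∈ C ∧ 0 < X a b) v a) →
    ∃ le, IsDfsOrder X C v le := by
  induction k using Nat.strong_induction_on with
  | _ k ih =>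
  intro C v hk hv hconn
  by_cases hC : (C.erase v).Nonempty
  swap
  · rw [Finset.not_nonempty_iff_eq_empty, Finset.erase_eq_empty_iff] at hC
    rcases hC with rfl | rfl
    · simp at hv
    refine ⟨fun a b => a = v ∧ b = v, ?_, ?_, ?_, ?_, ?_, ?_, ?_, ?_⟩
    all_goals try simp only [Finset.mem_singleton]
    all_goals intros
    all_goals try tauto
    all_goals grind
  obtain ⟨w, hw, hmax⟩ := Finset.exists_max_image (C.erase v) (X v) hC
  have hwC := Finset.mem_of_mem_erase hw
  have hwv := Finset.ne_of_mem_erase hw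
  have hpos : 0 < X v w := by
    have : ∃ c ∈ C.erase v, 0 < X v c := by
      have h : ∀ b, Relation.ReflTransGen (fun a b => a ∈ C ∧ b ∈ C ∧ 0 < X a b) v b →
          b = v ∨ ∃ c ∈ C.erase v, 0 < X v c := by
        intro b hb
        induction hb with
        | refl => exact .inl rfl
        | @tail b c _ h2 ih =>
          rcases ih with rfl | h
          · by_cases hc : c = b
            · exact .inl hc
            · exact .inr ⟨c, Finset.mem_erase.2 ⟨hc, h2.2.1⟩, h2.2.2⟩
          · exact .inr h
      exact (h w (hconn w hwC)).resolve_left hwv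
    obtain ⟨c, hc, hc'⟩ := this
    exact hc'.trans_le (hmax c hc)
  set R : V → V → Prop := fun a b => a ∈ C.erase v ∧ b ∈ C.erase v ∧ 0 < X a b with hR
  set K : Finset V := (C.erase v).filter fun a => Relation.ReflTransGen R w a with hK
  have hwK : w ∈ K := Finset.mem_filter.2 ⟨hw, .refl⟩
  have hKC : K ⊆ C.erase v := Finset.filter_subset _ _
  have hKC' : ∀ a ∈ K, a ∈ C := fun a ha => Finset.mem_of_mem_erase (hKC ha)
  have hvK : v ∉ K := fun h => Finset.ne_of_mem_erase (hKC h) rfl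
  have hvD : v ∈ C \ K := Finset.mem_sdiff.2 ⟨hv, hvK⟩
  have hclosed : ∀ a ∈ K, ∀ b ∈ C, b ≠ v → 0 < X a b → b ∈ K := fun a ha b hb hbv h => by
    have hb' := Finset.mem_erase.2 ⟨hbv, hb⟩
    exact Finset.mem_filter.2 ⟨hb', (Finset.mem_filter.1 ha).2.tail ⟨hKC ha, hb', h⟩⟩
  have hK1 : K.card < k := by
    rw [← hk]
    exact Finset.card_lt_card ((Finset.ssubset_iff_of_subset hKC').2 ⟨v, hv, hvK⟩)
  have hD1 : (C \ K).card < k := by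
    rw [← hk]
    exact Finset.card_lt_card ((Finset.ssubset_iff_of_subset Finset.sdiff_subset).2
      ⟨w, hwC, by simp [hwK]⟩)
  obtain ⟨le₁, h₁⟩ := ih _ hK1 K w rfl hwK (by
    intro a ha
    have := (Finset.mem_filter.1 ha).2
    clear ha
    induction this with
    | refl => exact .refl
    | @tail b c h1 h2 ih =>
      have hb : b ∈ K := Finset.mem_filter.2 ⟨h2.1, h1⟩
      exact ih.tail ⟨hb, Finset.mem_filter.2 ⟨h2.2.1, h1.tail h2⟩, h2.2.2⟩)
  obtain ⟨le₂, h₂⟩ := ih _ hD1 (C \ K) v rfl hvD (by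
    intro a ha
    have := hconn a (Finset.mem_sdiff.1 ha).1
    induction this with
    | refl => exact .refl
    | @tail b c h1 h2 ih =>
      by_cases hb : b ∈ K
      · by_cases hc : c = v
        · subst hc; exact .refl
        · exact absurd (hclosed b hb c h2.2.1 hc h2.2.2) (Finset.mem_sdiff.1 ha).2
      · have hb' := Finset.mem_sdiff.2 ⟨h2.1, hb⟩
        exact (ih hb').tail ⟨hb', ha, h2.2.2⟩)
  have m1 : ∀ {a b}, le₁ a b → a ∈ K ∧ b ∈ K := h₁.mem
  have m2 : ∀ {a b}, le₂ a b → (a ∈ C ∧ a ∉ K) ∧ (b ∈ C ∧ b ∉ K) := fun h => by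
    simpa using h₂.mem h
  refine ⟨fun a u => le₁ a u ∨ le₂ a u ∨ (a = v ∧ u ∈ K), ?_⟩
  constructor
  · rintro a b (h | h | ⟨rfl, h⟩)
    · exact ⟨hKC' _ (m1 h).1, hKC' _ (m1 h).2⟩
    · exact ⟨(m2 h).1.1, (m2 h).2.1⟩
    · exact ⟨hv, hKC' _ h⟩
  · intro a ha
    by_cases h : a ∈ K
    · exact .inl (h₁.le_refl h)
    · exact .inr (.inl (h₂.le_refl (Finset.mem_sdiff.2 ⟨ha, h⟩)))
  · rintro a b c (h | h | ⟨rfl, h⟩) (h' | h' | ⟨rfl, h'⟩)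
    · exact .inl (h₁.le_trans h h')
    · exact absurd (m1 h).2 (m2 h').1.2
    · exact absurd (m1 h).2 hvK
    · exact absurd (m1 h').1 (m2 h).2.2
    · exact .inr (.inl (h₂.le_trans h h'))
    · refine .inr (.inr ⟨h₂.le_antisymm h (h₂.root_le (h₂.mem h).1), h'⟩)
    · exact .inr (.inr ⟨rfl, (m1 h').2⟩)
    · exact absurd h (m2 h').1.2
    · exact absurd h hvK
  · rintro a b (h | h | ⟨rfl, h⟩) (h' | h' | ⟨rfl, h'⟩)
    · exact h₁.le_antisymm h h'
    · exact absurd (m1 h).2 (m2 h').1.2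
    · exact absurd (m1 h).2 hvK
    · exact absurd (m1 h').1 (m2 h).2.2
    · exact h₂.le_antisymm h h'
    · exact absurd h' (m2 h).1.2
    · exact absurd (m1 h').2 hvK
    · exact absurd h (m2 h').1.2
    · rfl
  · intro a ha
    by_cases h : a ∈ K
    · exact .inr (.inr ⟨rfl, h⟩)
    · exact .inr (.inl (h₂.root_le (Finset.mem_sdiff.2 ⟨ha, h⟩)))
  · rintro a b u (h | h | ⟨rfl, h⟩) (h' | h' | ⟨rfl, h'⟩)
    · exact (h₁.chain h h').imp .inl .inl
    · exact absurd (m1 h).2 (m2 h').2.2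
    · exact .inr (.inr (.inr ⟨rfl, (m1 h).1⟩))
    · exact absurd (m1 h').2 (m2 h).2.2
    · exact (h₂.chain h h').imp (.inr ∘ .inl) (.inr ∘ .inl)
    · exact absurd h' (m2 h).2.2
    · exact .inl (.inr (.inr ⟨rfl, (m1 h').1⟩))
    · exact absurd h (m2 h').2.2
    · exact .inl (.inr (.inl (h₂.le_refl hvD)))
  · intro a b ha hb hab
    by_cases h : a ∈ K <;> by_cases h' : b ∈ K
    · exact (h₁.comparable h h' hab).imp .inl .inl
    · have : b = v := by
        by_contra hbv
        exact h' (hclosed a h b hb hbv hab)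
      exact .inr (.inr (.inr ⟨this, h⟩))
    · have : a = v := by
        by_contra hav
        exact h (hclosed b h' a ha hav (by rwa [hsymm]))
      exact .inl (.inr (.inr ⟨this, h'⟩))
    · exact (h₂.comparable (Finset.mem_sdiff.2 ⟨ha, h⟩) (Finset.mem_sdiff.2 ⟨hb, h'⟩) hab).imp
        (.inr ∘ .inl) (.inr ∘ .inl)
  · intro y hy hyv
    by_cases hyK : y ∈ K
    · by_cases hyw : y = w
      · subst hyw
        refine ⟨v, .inr (.inr ⟨rfl, hyK⟩), Ne.symm hyv, ?_, hpos, ?_⟩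
        · rintro a (h | h | ⟨rfl, h⟩) ha
          · exact absurd (h₁.le_antisymm h (h₁.root_le (m1 h).1)) ha
          · exact absurd hyK (m2 h).2.2
          · exact .inr (.inl (h₂.le_refl hvD))
        · rintro u (h | h | ⟨h, _⟩)
          · exact hmax u (hKC (m1 h).2)
          · exact absurd hyK (m2 h).1.2
          · exact absurd h hyv
      · obtain ⟨q, h1, h2, h3, h4, h5⟩ := h₁.exists_par hyK hyw
        refine ⟨q, .inl h1, h2, ?_, h4, ?_⟩
        · rintro a (h | h | ⟨rfl, h⟩) ha
          · exact .inl (h3 a h ha)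
          · exact absurd hyK (m2 h).2.2
          · exact .inr (.inr ⟨rfl, (m1 h1).1⟩)
        · rintro u (h | h | ⟨h, _⟩)
          · exact h5 u h
          · exact absurd hyK (m2 h).1.2
          · exact absurd h hyv
    · obtain ⟨q, h1, h2, h3, h4, h5⟩ := h₂.exists_par (Finset.mem_sdiff.2 ⟨hy, hyK⟩) hyv
      refine ⟨q, .inr (.inl h1), h2, ?_, h4, ?_⟩
      · rintro a (h | h | ⟨rfl, h⟩) ha
        · exact absurd (m1 h).2 hyK
        · exact .inr (.inl (h3 a h ha))
        · exact absurd h hyK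
      · rintro u (h | h | ⟨h, _⟩)
        · exact absurd (m1 h).1 hyK
        · exact h5 u h
        · exact absurd h hyv

theorem exists_dfsTree [Fintype V] [Nonempty V] {X : V → V → ℝ} (hsymm : ∀ a b, X a b = X b a)
    (hconn : ∀ a b, Relation.ReflTransGen (fun a b => 0 < X a b) a b) :
    Nonempty (DfsTree X) := by
  obtain ⟨r⟩ := ‹Nonempty V›
  obtain ⟨le, h⟩ := exists_isDfsOrder hsymm _ Finset.univ r rfl (Finset.mem_univ r)
    (fun a _ => by simpa using hconn r a)
  have hpar : ∀ w, ∃ q, (w = r → q = r) ∧ (w ≠ r → le q w ∧ q ≠ w ∧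
      (∀ a, le a w → a ≠ w → le a q) ∧ 0 < X q w ∧ ∀ u, le w u → X q u ≤ X q w) := fun w => by
    by_cases hw : w = r
    · exact ⟨r, fun _ => rfl, fun h => absurd hw h⟩
    · obtain ⟨q, hq⟩ := h.exists_par (Finset.mem_univ w) hw
      exact ⟨q, fun h => absurd h hw, fun _ => hq⟩
  choose p hp1 hp2 using hpar
  exact ⟨{
    root := r
    le := le
    par := p
    le_refl := fun v => h.le_refl (Finset.mem_univ v)
    le_trans := h.le_trans
    le_antisymm := h.le_antisymm
    root_le := fun v => h.root_le (Finset.mem_univ v)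
    chain := h.chain
    comparable := h.comparable (Finset.mem_univ _) (Finset.mem_univ _)
    par_root := hp1 r rfl
    par_le := fun w => by
      by_cases hw : w = r
      · rw [hp1 w hw, hw]; exact h.le_refl (Finset.mem_univ r)
      · exact (hp2 w hw).1
    par_ne := fun hw => (hp2 _ hw).2.1
    le_par := fun hw => (hp2 _ hw).2.2.1 _
    par_pos := fun hw => (hp2 _ hw).2.2.2.1
    par_max := fun hw => (hp2 _ hw).2.2.2.2 _ }⟩

end Dfs

namespace DfsTree

variable {V : Type*} {X : V → V → ℝ} (T : DfsTree X)

lemma not_le_par {w : V} (hw : w ≠ T.root) : ¬ T.le w (T.par w) := fun h =>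
  T.par_ne hw (T.le_antisymm (T.par_le w) h)

lemma eq_root_of_le {v : V} (h : T.le v T.root) : v = T.root := T.le_antisymm h (T.root_le v)

lemma ne_root_of_lt {y u : V} (h : T.le y u) (hne : y ≠ u) : u ≠ T.root := by
  rintro rfl
  exact hne (T.eq_root_of_le h)

lemma child_unique {w w' u : V} (hw : w ≠ T.root) (hw' : w' ≠ T.root) (h : T.par w = T.par w')
    (hu : T.le w u) (hu' : T.le w' u) : w = w' := by
  by_contra hne
  rcases T.chain hu hu' with h1 | h1
  · exact T.not_le_par hw (h ▸ T.le_par hw' h1 hne)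
  · exact T.not_le_par hw' (h ▸ T.le_par hw h1 (Ne.symm hne))

variable [Fintype V]

/-- The descendants of a vertex, itself included. -/
noncomputable def desc (w : V) : Finset V := Finset.univ.filter fun u => T.le w u

@[simp] lemma mem_desc {w u : V} : u ∈ T.desc w ↔ T.le w u := by simp [desc]

/-- Induction from the root downwards. -/
lemma induction_down {P : V → Prop} (root : P T.root)
    (step : ∀ w, w ≠ T.root → P (T.par w) → P w) (v : V) : P v := by
  induction h : (Finset.univ.filter fun a => T.le a v).card using Nat.strong_induction_on
    generalizing v with
  | _ k ih =>
  by_cases hv : v = T.root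
  · exact hv ▸ root
  · refine step v hv (ih _ ?_ _ rfl)
    rw [← h]
    refine Finset.card_lt_card ((Finset.ssubset_iff_of_subset ?_).2 ⟨v, ?_, ?_⟩)
    · intro a ha
      simp only [Finset.mem_filter, Finset.mem_univ, true_and] at ha ⊢
      exact T.le_trans ha (T.par_le v)
    · simpa using T.le_refl v
    · simpa using T.not_le_par hv

/-- Induction from the leaves upwards. -/
lemma induction_up {P : V → Prop}
    (step : ∀ v, (∀ w, w ≠ T.root → T.par w = v → P w) → P v) (v : V) : P v := by
  induction h : (T.desc v).card using Nat.strong_induction_on generalizing v with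
  | _ k ih =>
  refine step v fun w hw hwv => ih _ ?_ _ rfl
  rw [← h]
  have hle : T.le v w := hwv ▸ T.par_le w
  refine Finset.card_lt_card ((Finset.ssubset_iff_of_subset ?_).2 ⟨v, ?_, ?_⟩)
  · intro a ha
    simp only [mem_desc] at ha ⊢
    exact T.le_trans hle ha
  · simpa using T.le_refl v
  · simpa using hwv ▸ T.not_le_par hw

lemma exists_child {y u : V} (h : T.le y u) (hne : y ≠ u) :
    ∃ w, w ≠ T.root ∧ T.par w = y ∧ T.le w u := by
  induction u using T.induction_down with
  | root => exact absurd (T.eq_root_of_le h) hne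
  | step u hu ih =>
    by_cases hy : y = T.par u
    · exact ⟨u, hu, hy.symm, T.le_refl u⟩
    · obtain ⟨w, h1, h2, h3⟩ := ih (T.le_par hu h hne) hy
      exact ⟨w, h1, h2, T.le_trans h3 (T.par_le u)⟩

/-- The total weight between `par w` and the proper descendants of `w`. -/
noncomputable def back (w : V) : ℝ := ∑ u ∈ (T.desc w).erase w, X (T.par w) u

/-- The vertices strictly above `v`. -/
noncomputable def above (v : V) : Finset V := Finset.univ.filter fun y => T.le y v ∧ y ≠ v

@[simp] lemma mem_above {v y : V} : y ∈ T.above v ↔ T.le y v ∧ y ≠ v := by simp [above]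

/-- The total weight between the descendants of `w` and the proper ancestors of `par w`. -/
noncomputable def up (w : V) : ℝ := ∑ u ∈ T.desc w, ∑ y ∈ T.above (T.par w), X u y

/-- The local cost of `w`. -/
noncomputable def cost (w : V) : ℝ := max 0 (T.back w - 1) + max 0 (1 - T.up w)

/-- The number of support edges between `par w` and the proper descendants of `w`. -/
noncomputable def num (w : V) : ℕ := (((T.desc w).erase w).filter fun u => 0 < X (T.par w) u).card

/-- The children of a vertex. -/
noncomputable def children (v : V) : Finset V :=
  Finset.univ.filter fun w => w ≠ T.root ∧ T.par w = v

@[simp] lemma mem_children {v w : V} : w ∈ T.children v ↔ w ≠ T.root ∧ T.par w = v := by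
  simp [children]

lemma sum_children (f : V → ℝ) :
    ∑ v, ∑ w ∈ T.children v, f w = ∑ w ∈ Finset.univ.erase T.root, f w := by
  rw [← Finset.sum_fiberwise (Finset.univ.erase T.root) T.par f]
  refine Finset.sum_congr rfl fun v _ => Finset.sum_congr ?_ fun _ _ => rfl
  ext w
  simp

end DfsTree

lemma sum_le_sum_of_pos_mem {ι : Type*} {f : ι → ℝ} {s t : Finset ι} (h0 : ∀ i, 0 ≤ f i)
    (h : ∀ i ∈ s, 0 < f i → i ∈ t) : ∑ i ∈ s, f i ≤ ∑ i ∈ t, f i := by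
  rw [← Finset.sum_filter_add_sum_filter_not s fun i => 0 < f i]
  have h1 : ∑ i ∈ s.filter (fun i => ¬ 0 < f i), f i ≤ 0 :=
    Finset.sum_nonpos fun i hi => not_lt.1 (Finset.mem_filter.1 hi).2
  have h2 : ∑ i ∈ s.filter (fun i => 0 < f i), f i ≤ ∑ i ∈ t, f i :=
    Finset.sum_le_sum_of_subset_of_nonneg (fun i hi =>
      h i (Finset.mem_filter.1 hi).1 (Finset.mem_filter.1 hi).2) fun i _ _ => h0 i
  linarith

/-- A symmetric nonnegative weight matrix all of whose cuts have value at least two. -/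
structure IsCutMatrix {V : Type*} [Fintype V] (X : V → V → ℝ) : Prop where
  symm : ∀ a b, X a b = X b a
  nonneg : ∀ a b, 0 ≤ X a b
  cut : ∀ S : Finset V, S.Nonempty → S ≠ Finset.univ → 2 ≤ ∑ a ∈ S, ∑ b ∈ Sᶜ, X a b

namespace DfsTree

variable {V : Type*} [Fintype V] {X : V → V → ℝ} (T : DfsTree X) (hX : IsCutMatrix X)

include hX

lemma back_nonneg (w : V) : 0 ≤ T.back w := Finset.sum_nonneg fun _ _ => hX.nonneg _ _

lemma up_nonneg (w : V) : 0 ≤ T.up w :=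
  Finset.sum_nonneg fun _ _ => Finset.sum_nonneg fun _ _ => hX.nonneg _ _

omit hX in
lemma par_add_back (w : V) :
    X (T.par w) w + T.back w = ∑ u ∈ T.desc w, X (T.par w) u :=
  Finset.add_sum_erase (T.desc w) (fun u => X (T.par w) u) (by simpa using T.le_refl w)

omit hX in
lemma eq_or_above_of_pos {w u b : V} (hw : w ≠ T.root) (hu : T.le w u) (hb : ¬ T.le w b)
    (h : 0 < X u b) : b = T.par w ∨ b ∈ T.above (T.par w) := by
  have hbu : T.le b u := (T.comparable h).resolve_left fun h' => hb (T.le_trans hu h')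
  have hbw : T.le b w := (T.chain hu hbu).resolve_left hb
  have := T.le_par hw hbw (by rintro rfl; exact hb (T.le_refl b))
  by_cases hne : b = T.par w
  · exact .inl hne
  · exact .inr (by simp [this, hne])

lemma two_le_desc_cut {w : V} (hw : w ≠ T.root) :
    2 ≤ X (T.par w) w + T.back w + T.up w := by
  have h := hX.cut (T.desc w) ⟨w, by simpa using T.le_refl w⟩ (fun h => by
    have := h ▸ Finset.mem_univ T.root
    exact hw (T.eq_root_of_le (by simpa using this)))
  refine h.trans ?_
  rw [par_add_back, up, ← Finset.sum_add_distrib]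
  refine Finset.sum_le_sum fun u hu => ?_
  rw [mem_desc] at hu
  have hp : T.par w ∉ T.above (T.par w) := by simp
  rw [hX.symm, ← Finset.sum_insert (f := fun y => X u y) hp]
  refine sum_le_sum_of_pos_mem (fun b => hX.nonneg _ _) fun b hb hpos => ?_
  rw [Finset.mem_compl, mem_desc] at hb
  rw [Finset.mem_insert]
  exact T.eq_or_above_of_pos hw hu hb hpos

lemma two_le_par_cut {w : V} (hw : w ≠ T.root) (hv : T.par w ≠ T.root) :
    2 ≤ ∑ u, X (T.par w) u - (X (T.par w) w + T.back w) + T.up w := by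
  have hpn : T.par w ∉ T.desc w := by simpa using T.not_le_par hw
  have h := hX.cut (insert (T.par w) (T.desc w)) ⟨w, by simp [T.le_refl w]⟩ (fun h => by
    have := h ▸ Finset.mem_univ T.root
    rcases Finset.mem_insert.1 this with h | h
    · exact hv h.symm
    · exact hw (T.eq_root_of_le (by simpa using h)))
  refine h.trans ?_
  rw [Finset.sum_insert hpn]
  refine add_le_add ?_ ?_
  · rw [par_add_back, ← Finset.sum_compl_add_sum (T.desc w), add_sub_cancel_right]
    refine Finset.sum_le_sum_of_subset_of_nonneg ?_ fun _ _ _ => hX.nonneg _ _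
    rw [Finset.compl_subset_compl]
    exact Finset.subset_insert _ _
  · refine Finset.sum_le_sum fun u hu =>
      sum_le_sum_of_pos_mem (fun b => hX.nonneg _ _) fun b hb hpos => ?_
    rw [mem_desc] at hu
    simp only [Finset.mem_compl, Finset.mem_insert, mem_desc, not_or] at hb
    exact (T.eq_or_above_of_pos hw hu hb.2 hpos).resolve_left hb.1

lemma sum_children_le (v : V) :
    ∑ w ∈ T.children v, (X (T.par w) w + T.back w) ≤ ∑ u, X v u := by
  have h1 : ∀ w ∈ T.children v, X (T.par w) w + T.back w = ∑ u ∈ T.desc w, X v u :=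
    fun w hw => by rw [par_add_back, (T.mem_children.1 hw).2]
  rw [Finset.sum_congr rfl h1, ← Finset.sum_biUnion]
  · exact Finset.sum_le_sum_of_subset_of_nonneg (Finset.subset_univ _) fun _ _ _ => hX.nonneg _ _
  · intro w hw w' hw' hne
    rw [Finset.mem_coe, mem_children] at hw hw'
    rw [Function.onFun, Finset.disjoint_left]
    intro u hu hu'
    exact hne (T.child_unique hw.1 hw'.1 (hw.2.trans hw'.2.symm) (by simpa using hu)
      (by simpa using hu'))

lemma two_le_degree (v : V) (hn : 2 ≤ Fintype.card V) : 2 ≤ ∑ u, X v u := by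
  have h := hX.cut {v} ⟨v, by simp⟩ (fun h => by
    have := congrArg Finset.card h
    rw [Finset.card_singleton, Finset.card_univ] at this
    omega)
  rw [Finset.sum_singleton] at h
  exact h.trans (Finset.sum_le_sum_of_subset_of_nonneg (Finset.subset_univ _)
    fun _ _ _ => hX.nonneg _ _)

omit hX in
lemma back_le {w : V} (hw : w ≠ T.root) : T.back w ≤ T.num w * X (T.par w) w := by
  unfold back num
  rw [← Finset.sum_filter_add_sum_filter_not _ (fun u => 0 < X (T.par w) u)]
  have h1 : ∑ u ∈ ((T.desc w).erase w).filter (fun u => ¬ 0 < X (T.par w) u), X (T.par w) u ≤ 0 :=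
    Finset.sum_nonpos fun u hu => not_lt.1 (Finset.mem_filter.1 hu).2
  have h2 := Finset.sum_le_card_nsmul (((T.desc w).erase w).filter fun u => 0 < X (T.par w) u)
    (fun u => X (T.par w) u) (X (T.par w) w) (fun u hu => T.par_max hw (by
      have := (Finset.mem_filter.1 hu).1
      simpa using (Finset.mem_erase.1 this).2))
  rw [nsmul_eq_mul] at h2
  linarith

omit hX in
lemma excess_le {b x : ℝ} {k : ℕ} (h : b ≤ k * x) :
    max 0 (b - 1) ≤ k / 6 + max 0 (x + b - 2) := by
  have hk : (0 : ℝ) ≤ (k - 2) * (k - 3) := by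
    rcases Nat.lt_or_ge k 3 with h' | h'
    · interval_cases k <;> norm_num
    · have : (3 : ℝ) ≤ k := by exact_mod_cast h'
      nlinarith
  have hk0 : (0 : ℝ) ≤ k := Nat.cast_nonneg k
  refine max_le (by positivity) ?_
  rcases le_total 2 (x + b) with h1 | h1
  · rw [max_eq_right (by linarith)]
    have h3 : 2 ≤ (k + 1) * x := by linarith
    have : 0 ≤ (k + 1) * (k / 6 + x - 1) := by nlinarith
    have := nonneg_of_mul_nonneg_right this (by linarith)
    linarith
  · rw [max_eq_left (by linarith)]
    have h3 : (k + 1) * b ≤ 2 * k := by nlinarith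
    have : 0 ≤ (k + 1) * (k / 6 + 1 - b) := by nlinarith
    have := nonneg_of_mul_nonneg_right this (by linarith)
    linarith

lemma cost_le_of_pos {w : V} (hw : w ≠ T.root) (hc : 0 < T.cost w) :
    1 ≤ X (T.par w) w + T.back w ∧
      T.cost w ≤ T.num w / 6 + (X (T.par w) w + T.back w - 1) := by
  have h1 := excess_le (T.back_le hw)
  have h2 := T.two_le_desc_cut hX hw
  have h3 := T.up_nonneg hX w
  have h4 := hX.nonneg (T.par w) w
  unfold cost at hc ⊢
  have : 1 ≤ X (T.par w) w + T.back w := by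
    by_contra! hlt
    rw [max_eq_left (by linarith), max_eq_left (by linarith)] at hc
    linarith
  refine ⟨this, ?_⟩
  rcases le_total 0 (1 - T.up w) with h | h <;>
    rcases le_total 0 (X (T.par w) w + T.back w - 2) with h' | h' <;>
    simp only [max_eq_left, max_eq_right, h, h'] at h1 ⊢ <;> linarith

lemma cost_le {w : V} (hw : w ≠ T.root) (hv : T.par w ≠ T.root) (hn : 2 ≤ Fintype.card V) :
    T.cost w ≤ T.num w / 6 + (∑ u, X (T.par w) u - 2) := by
  have h1 := excess_le (T.back_le hw)
  have h2 := T.two_le_desc_cut hX hw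
  have h3 := T.up_nonneg hX w
  have h5 := T.two_le_par_cut hX hw hv
  have h6 := two_le_degree hX (T.par w) hn
  have h7 : X (T.par w) w + T.back w ≤ ∑ u, X (T.par w) u := by
    rw [par_add_back]
    exact Finset.sum_le_sum_of_subset_of_nonneg (Finset.subset_univ _)
      fun _ _ _ => hX.nonneg _ _
  unfold cost
  rcases le_total 0 (1 - T.up w) with h | h <;>
    rcases le_total 0 (X (T.par w) w + T.back w - 2) with h' | h' <;>
    simp only [max_eq_left, max_eq_right, h, h'] at h1 ⊢ <;> linarith

omit hX in
lemma cost_nonneg (w : V) : 0 ≤ T.cost w := add_nonneg (le_max_left _ _) (le_max_left _ _)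

lemma sum_children_cost_le (v : V) (hn : 2 ≤ Fintype.card V) :
    ∑ w ∈ T.children v, T.cost w ≤ (∑ w ∈ T.children v, (T.num w : ℝ)) / 6
      + (∑ u, X v u - 2) + if v = T.root then 1 else 0 := by
  have hdeg := two_le_degree hX v hn
  set M := (T.children v).filter fun w => 0 < T.cost w with hM
  have hmem : ∀ w ∈ M, w ≠ T.root ∧ T.par w = v ∧ 0 < T.cost w := fun w hw => by
    simpa [hM, and_assoc] using hw
  have h1 : ∑ w ∈ T.children v, T.cost w = ∑ w ∈ M, T.cost w := by
    rw [hM, Finset.sum_filter]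
    refine Finset.sum_congr rfl fun w _ => ?_
    split_ifs with h
    · rfl
    · exact _root_.le_antisymm (not_lt.1 h) (T.cost_nonneg w)
  have h2 : ∑ w ∈ M, (T.num w : ℝ) ≤ ∑ w ∈ T.children v, (T.num w : ℝ) :=
    Finset.sum_le_sum_of_subset_of_nonneg (Finset.filter_subset _ _) fun _ _ _ =>
      Nat.cast_nonneg _
  have h3 : ∑ w ∈ M, (X (T.par w) w + T.back w) ≤ ∑ u, X v u :=
    (Finset.sum_le_sum_of_subset_of_nonneg (Finset.filter_subset _ _) fun w _ _ =>
      add_nonneg (hX.nonneg _ _) (T.back_nonneg hX w)).trans (T.sum_children_le hX v)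
  have h4 : ∑ w ∈ M, T.cost w ≤ (∑ w ∈ M, (T.num w : ℝ)) / 6
      + ∑ w ∈ M, (X (T.par w) w + T.back w) - M.card := by
    have := Finset.sum_le_sum fun w hw => (T.cost_le_of_pos hX (hmem w hw).1 (hmem w hw).2.2).2
    rw [Finset.sum_add_distrib, Finset.sum_sub_distrib, ← Finset.sum_div] at this
    simp only [Finset.sum_const, nsmul_eq_mul, mul_one] at this
    linarith
  rw [h1]
  have hnum : 0 ≤ ∑ w ∈ T.children v, (T.num w : ℝ) :=
    Finset.sum_nonneg fun _ _ => Nat.cast_nonneg _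
  rcases Finset.eq_empty_or_nonempty M with h | h
  · rw [h, Finset.sum_empty]
    have : (0 : ℝ) ≤ if v = T.root then 1 else 0 := by split_ifs <;> norm_num
    linarith
  by_cases hv : v = T.root
  · rw [if_pos hv]
    have : (1 : ℝ) ≤ M.card := by exact_mod_cast h.card_pos
    linarith
  rw [if_neg hv]
  rcases Nat.lt_or_ge M.card 2 with hc | hc
  · obtain ⟨w, hw⟩ := Finset.card_eq_one.1 (show M.card = 1 by have := h.card_pos; omega)
    have hwM := hmem w (by rw [hw]; simp)
    have := T.cost_le hX hwM.1 (hwM.2.1 ▸ hv) hn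
    rw [hwM.2.1] at this
    rw [hw, Finset.sum_singleton] at h2 ⊢
    linarith
  · have : (2 : ℝ) ≤ M.card := by exact_mod_cast hc
    linarith

lemma sum_cost_le (hn : 2 ≤ Fintype.card V) :
    ∑ w ∈ Finset.univ.erase T.root, T.cost w ≤
      ((∑ w ∈ Finset.univ.erase T.root, T.num w : ℕ) : ℝ) / 6
        + (∑ v, ∑ u, X v u - 2 * Fintype.card V) + 1 := by
  have h := Finset.sum_le_sum fun v (_ : v ∈ Finset.univ) => T.sum_children_cost_le hX v hn
  rw [T.sum_children, Finset.sum_add_distrib, Finset.sum_add_distrib, ← Finset.sum_div,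
    T.sum_children, Finset.sum_sub_distrib] at h
  simp only [Finset.sum_const, Finset.card_univ, nsmul_eq_mul, Finset.sum_ite_eq',
    Finset.mem_univ, if_true] at h
  push_cast
  linarith

omit hX in
/-- Tree edges and back edges are distinct edges of the support. -/
lemma sum_num_add_card_le {P : Finset (Sym2 V)} (hP : ∀ a b, 0 < X a b → s(a, b) ∈ P) :
    ∑ w ∈ Finset.univ.erase T.root, T.num w + Fintype.card V ≤ P.card + 1 := by
  have h1 : ∀ w ∈ Finset.univ.erase T.root,
      ((T.desc w).filter fun u => 0 < X (T.par w) u).card = T.num w + 1 := by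
    intro w hw
    have hw' := Finset.ne_of_mem_erase hw
    have hmem : w ∈ (T.desc w).filter fun u => 0 < X (T.par w) u := by
      simp [T.le_refl w, T.par_pos hw']
    rw [← Finset.card_erase_add_one hmem, num, Finset.filter_erase]
  have h2 : ((Finset.univ.erase T.root).sigma
      fun w => (T.desc w).filter fun u => 0 < X (T.par w) u).card ≤ P.card := by
    refine Finset.card_le_card_of_injOn (fun q => s(T.par q.1, q.2)) ?_ ?_
    · rintro ⟨w, u⟩ h
      simp only [Finset.coe_sigma, Set.mem_sigma_iff, Finset.mem_coe, Finset.mem_filter] at h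
      exact hP _ _ h.2.2
    · rintro ⟨w, u⟩ h ⟨w', u'⟩ h' heq
      simp only [Finset.mem_coe, Finset.mem_sigma, Finset.mem_filter, Finset.mem_erase,
        Finset.mem_univ, and_true, mem_desc] at h h'
      rcases Sym2.eq_iff.1 heq with ⟨e1, e2⟩ | ⟨e1, e2⟩
      · simp only at e1 e2
        subst e2
        obtain rfl := T.child_unique h.1 h'.1 e1 h.2.1 h'.2.1
        rfl
      · simp only at e1 e2
        have : T.le w (T.par w) := by
          rw [e1]
          refine T.le_trans h.2.1 (T.le_trans ?_ h'.2.1)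
          rw [e2]
          exact T.par_le w'
        exact absurd this (T.not_le_par h.1)
  rw [Finset.card_sigma, Finset.sum_congr rfl h1, Finset.sum_add_distrib] at h2
  have h3 := Finset.card_erase_add_one (Finset.mem_univ T.root)
  rw [Finset.card_univ] at h3
  simp only [Finset.sum_const, smul_eq_mul, mul_one] at h2
  omega

end DfsTree

namespace DfsTree

variable {V : Type*} {X : V → V → ℝ} (T : DfsTree X)

/-- Tails of the arcs of the network: tree arcs, entering arcs, and back arcs. -/
def arcTail : V ⊕ V ⊕ V × V → V ⊕ V :=
  Sum.elim .inl (Sum.elim .inl fun e => .inr e.2)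

/-- Heads of the arcs of the network. -/
def arcHead : V ⊕ V ⊕ V × V → V ⊕ V :=
  Sum.elim (fun y => .inl (T.par y)) (Sum.elim .inr fun e => .inl e.1)

variable [Fintype V]

lemma netFlow_inr (x : V ⊕ V ⊕ V × V → ℝ) (w : V) :
    netFlow arcTail T.arcHead x (.inr w) =
      ∑ u, x (.inr (.inr (u, w))) - x (.inr (.inl w)) := by
  unfold netFlow arcTail arcHead
  simp only [Fintype.sum_sum_type, Fintype.sum_prod_type, Sum.elim_inl, Sum.elim_inr,
    Sum.inr.injEq, reduceCtorEq, if_false, sub_zero, mul_zero, Finset.sum_const_zero, zero_add,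
    zero_sub, mul_neg, mul_ite, mul_one, Finset.sum_neg_distrib, Finset.sum_ite_eq',
    Finset.mem_univ, if_true]
  ring

lemma netFlow_inl (x : V ⊕ V ⊕ V × V → ℝ) (v : V) :
    netFlow arcTail T.arcHead x (.inl v) =
      x (.inl v) - ∑ y, (if T.par y = v then x (.inl y) else 0) + x (.inr (.inl v))
        - ∑ w, x (.inr (.inr (v, w))) := by
  unfold netFlow arcTail arcHead
  simp only [Fintype.sum_sum_type, Fintype.sum_prod_type, Sum.elim_inl, Sum.elim_inr,
    Sum.inl.injEq, reduceCtorEq, if_false, mul_zero, Finset.sum_const_zero, zero_add,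
    mul_ite, mul_one, Finset.sum_ite_eq',
    Finset.mem_univ, if_true, mul_sub, Finset.sum_sub_distrib]
  have : ∑ u, ∑ w, (if u = v then x (.inr (.inr (u, w))) else 0)
      = ∑ w, x (.inr (.inr (v, w))) := by
    rw [Finset.sum_comm]
    simp
  rw [this]
  ring

/-- Number of tree arcs of the fundamental cycle of `(u, w)` that enter `v`. -/
lemma sum_path_indicator {u w : V} (v : V) (c : ℝ) :
    ∑ y, (if T.par y = v then (if T.le w y ∧ w ≠ y ∧ T.le y u then c else 0) else 0) =
      if T.le w v ∧ T.le v u ∧ v ≠ u then c else 0 := by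
  split_ifs with h
  · obtain ⟨h1, h2, h3⟩ := h
    obtain ⟨y, hy1, hy2, hy3⟩ := T.exists_child h2 h3
    rw [Finset.sum_eq_single y]
    · have hwy : T.le w y := T.le_trans h1 (hy2 ▸ T.par_le y)
      have : w ≠ y := by
        rintro rfl
        exact T.not_le_par hy1 (hy2 ▸ h1)
      simp [hy2, hwy, this, hy3]
    · intro y' _ hne
      split_ifs with h4 h5
      · refine absurd (T.child_unique (T.ne_root_of_lt h5.1 h5.2.1) hy1 (h4.trans hy2.symm)
          h5.2.2 hy3) hne
      · rfl
      · rfl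
    · simp
  · refine Finset.sum_eq_zero fun y _ => ?_
    split_ifs with h4 h5
    · subst h4
      have hyr := T.ne_root_of_lt h5.1 h5.2.1
      exfalso
      apply h
      refine ⟨T.le_par hyr h5.1 h5.2.1, T.le_trans (T.par_le y) h5.2.2, ?_⟩
      intro h6
      exact T.not_le_par hyr (h6 ▸ h5.2.2)
    · rfl
    · rfl

/-- The flow that sends `f u w` along the fundamental cycle of each pair `(u, w)`. -/
noncomputable def cycleFlow (f : V → V → ℝ) : V ⊕ V ⊕ V × V → ℝ :=
  Sum.elim (fun y => ∑ u, ∑ w, if T.le w y ∧ w ≠ y ∧ T.le y u then f u w else 0)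
    (Sum.elim (fun w => ∑ u, f u w) fun e => f e.1 e.2)

lemma netFlow_cycleFlow {f : V → V → ℝ} (hf : ∀ u w, f u w ≠ 0 → w ≠ T.root ∧ T.le w u)
    (n : V ⊕ V) : netFlow arcTail T.arcHead (T.cycleFlow f) n = 0 := by
  rcases n with v | w
  swap
  · rw [netFlow_inr]
    simp [cycleFlow]
  rw [netFlow_inl]
  simp only [cycleFlow, Sum.elim_inl, Sum.elim_inr]
  have h1 : ∀ y, (if T.par y = v then
      (∑ u, ∑ w, if T.le w y ∧ w ≠ y ∧ T.le y u then f u w else 0) else 0) =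
      ∑ u, ∑ w, (if T.par y = v then
        (if T.le w y ∧ w ≠ y ∧ T.le y u then f u w else 0) else 0) := by
    intro y
    split_ifs
    · rfl
    · simp
  have h2 : ∑ y, (if T.par y = v then
      (∑ u, ∑ w, if T.le w y ∧ w ≠ y ∧ T.le y u then f u w else 0) else 0) =
      ∑ u, ∑ w, if T.le w v ∧ T.le v u ∧ v ≠ u then f u w else 0 := by
    rw [Finset.sum_congr rfl fun y _ => h1 y, Finset.sum_comm]
    refine Finset.sum_congr rfl fun u _ => ?_
    rw [Finset.sum_comm]
    refine Finset.sum_congr rfl fun w _ => ?_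
    exact T.sum_path_indicator v _
  have h3 : ∑ u, f u v = ∑ u, ∑ w, if w = v then f u w else 0 := by simp
  have h4 : ∑ w, f v w = ∑ u, ∑ w, if u = v then f u w else 0 := by
    rw [Finset.sum_comm]
    simp
  rw [h2, h3, h4]
  simp only [← Finset.sum_sub_distrib, ← Finset.sum_add_distrib]
  refine Finset.sum_eq_zero fun u _ => Finset.sum_eq_zero fun w _ => ?_
  by_cases hfz : f u w = 0
  · simp [hfz]
  obtain ⟨hwr, hwu⟩ := hf u w hfz
  by_cases hw : w = v
  · subst hw
    by_cases hu : u = w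
    · subst hu
      simp
    · simp [hu, Ne.symm hu, hwu, T.le_refl w]
  · by_cases hu : u = v
    · subst hu
      simp [hw, hwu, T.le_refl u]
    · have : (T.le w v ∧ T.le v u ∧ v ≠ u) ↔ (T.le w v ∧ w ≠ v ∧ T.le v u) :=
        ⟨fun h => ⟨h.1, hw, h.2.1⟩, fun h => ⟨h.1, h.2.2, Ne.symm hu⟩⟩
      simp only [this, hw, hu, if_false]
      ring

/-- Flow through the tree arc above `y`, in terms of the back arcs. -/
lemma flow_tree_arc {x : V ⊕ V ⊕ V × V → ℝ} (hx : ∀ n, netFlow arcTail T.arcHead x n = 0)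
    {y : V} (hy : y ≠ T.root) :
    x (.inl y) = ∑ u, ∑ w, ((if T.le y u then 1 else 0) - if T.le y w then 1 else 0)
      * x (.inr (.inr (u, w))) := by
  have h1 : ∑ v ∈ T.desc y, netFlow arcTail T.arcHead x (.inl v) = 0 :=
    Finset.sum_eq_zero fun v _ => hx _
  simp only [netFlow_inl, Finset.sum_sub_distrib, Finset.sum_add_distrib] at h1
  have h2 : ∑ v ∈ T.desc y, ∑ c, (if T.par c = v then x (.inl c) else 0)
      = ∑ v ∈ (T.desc y).erase y, x (.inl v) := by
    rw [Finset.sum_comm]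
    have : (T.desc y).erase y = Finset.univ.filter fun c => T.par c ∈ T.desc y := by
      ext c
      simp only [Finset.mem_erase, mem_desc, Finset.mem_filter, Finset.mem_univ, true_and]
      constructor
      · rintro ⟨h1, h2⟩
        exact T.le_par (T.ne_root_of_lt h2 (Ne.symm h1)) h2 (Ne.symm h1)
      · intro h
        refine ⟨?_, T.le_trans h (T.par_le c)⟩
        rintro rfl
        exact T.not_le_par hy h
    rw [this, Finset.sum_filter]
    refine Finset.sum_congr rfl fun c _ => ?_
    rw [Finset.sum_ite_eq]
  have h3 := Finset.add_sum_erase (T.desc y) (fun v => x (.inl v))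
    (by simpa using T.le_refl y : y ∈ T.desc y)
  have h4 : ∑ v ∈ T.desc y, x (.inr (.inl v)) =
      ∑ u, ∑ w, (if T.le y w then 1 else 0) * x (.inr (.inr (u, w))) := by
    rw [Finset.sum_comm, desc, Finset.sum_filter]
    refine Finset.sum_congr rfl fun w _ => ?_
    have := hx (.inr w)
    rw [netFlow_inr] at this
    rw [← Finset.mul_sum]
    split_ifs <;> linarith
  have h5 : ∑ v ∈ T.desc y, ∑ w, x (.inr (.inr (v, w))) =
      ∑ u, ∑ w, (if T.le y u then 1 else 0) * x (.inr (.inr (u, w))) := by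
    rw [desc, Finset.sum_filter]
    refine Finset.sum_congr rfl fun u _ => ?_
    rw [← Finset.mul_sum]
    split_ifs <;> simp
  simp only [sub_mul, Finset.sum_sub_distrib]
  rw [← h4, ← h5]
  rw [h2] at h1
  linarith

/-- Rounding of fractional back edges to a set of back edges. -/
theorem exists_rounding {f : V → V → ℝ} (h0 : ∀ u w, 0 ≤ f u w)
    (hf : ∀ u w, f u w ≠ 0 → w ≠ T.root ∧ T.le w u) :
    ∃ F : Finset (V × V), (∀ e ∈ F, 0 < f e.1 e.2) ∧
      (∀ y, y ≠ T.root →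
        1 ≤ ∑ u, ∑ w, (if T.le w y ∧ w ≠ y ∧ T.le y u then f u w else 0) →
        ∃ e ∈ F, T.le e.2 y ∧ e.2 ≠ y ∧ T.le y e.1) ∧
      (∀ w, 1 ≤ ∑ u, f u w → ∃ e ∈ F, e.2 = w) ∧
      ∀ S : Finset V, (∀ w ∉ S, ∑ u, f u w = 0) →
        ((∑ w ∈ S, ((F.filter fun e => e.2 = w).card - 1) : ℕ) : ℝ)
          ≤ ∑ w ∈ S, max 0 (∑ u, f u w - 1) := by
  obtain ⟨z, hz1, hz2, hz3⟩ := exists_integral_circulation arcTail T.arcHead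
    (Sum.elim 0 (Sum.elim (fun w => if ∑ u, f u w < 1 then 0 else 1) 0)) _ (T.cycleFlow f) rfl
    (T.netFlow_cycleFlow hf)
  set zb : V → V → ℤ := fun u w => z (.inr (.inr (u, w))) with hzb
  set zh : V → ℤ := fun w => z (.inr (.inl w)) with hzh
  have hb0 : ∀ u w, 0 ≤ zb u w := fun u w =>
    (Int.floor_nonneg.2 (h0 u w)).trans (hz2 (.inr (.inr (u, w)))).1
  have hbf : ∀ u w, 1 ≤ zb u w → 0 < f u w := fun u w h =>
    Int.ceil_pos.1 (by
      have : zb u w ≤ ⌈f u w⌉ := (hz2 (.inr (.inr (u, w)))).2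
      omega)
  have hsum : ∀ w, zh w = ∑ u, zb u w := fun w => by
    have := hz1 (.inr w)
    rw [netFlow_inr] at this
    have h : (zh w : ℝ) = ∑ u, (zb u w : ℝ) := by linarith
    exact_mod_cast h
  set F : Finset (V × V) := Finset.univ.filter fun e => 1 ≤ zb e.1 e.2 with hF
  refine ⟨F, fun e he => hbf _ _ (by simpa [hF] using he), ?_, ?_, ?_⟩
  · intro y hy h
    have h1 : 1 ≤ z (.inl y) := (Int.le_floor.2 (by simpa [cycleFlow] using h)).trans
      (hz2 (.inl y)).1
    have h2 := T.flow_tree_arc hz1 hy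
    have h3 : ∃ u w, 0 < ((if T.le y u then (1 : ℝ) else 0) - if T.le y w then 1 else 0)
        * zb u w := by
      by_contra! hcon
      have : (z (.inl y) : ℝ) ≤ 0 := by
        rw [h2]
        exact Finset.sum_nonpos fun u _ => Finset.sum_nonpos fun w _ => hcon u w
      have h1' : (1 : ℝ) ≤ z (.inl y) := by exact_mod_cast h1
      linarith
    obtain ⟨u, w, h3⟩ := h3
    have hz0 : (0 : ℝ) ≤ zb u w := by exact_mod_cast hb0 u w
    have hpos : 1 ≤ zb u w := by
      rcases (hb0 u w).lt_or_eq with h | h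
      · omega
      · rw [← h] at h3; simp at h3
    by_cases hu : T.le y u <;> by_cases hw : T.le y w <;> simp [hu, hw] at h3
    · refine ⟨(u, w), by simpa [hF] using hpos, ?_, ?_, hu⟩
      · exact (T.chain (hf u w (hbf u w hpos).ne').2 hu).resolve_right hw
      · rintro rfl
        exact hw (T.le_refl _)
    · linarith
  · intro w h
    have h1 : 1 ≤ zh w := (Int.le_floor.2 (by simpa [cycleFlow] using h)).trans
      (hz2 (.inr (.inl w))).1
    rw [hsum] at h1
    by_contra! hcon
    have : ∑ u, zb u w ≤ 0 := Finset.sum_nonpos fun u _ => by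
      by_contra! h
      exact hcon (u, w) (by simp only [hF, Finset.mem_filter, Finset.mem_univ, true_and]; omega) rfl
    omega
  · intro S hS
    have hcard : ∀ w, ((F.filter fun e => e.2 = w).card : ℤ) ≤ zh w := by
      intro w
      rw [hsum]
      have h1 : (F.filter fun e => e.2 = w).card
          ≤ (Finset.univ.filter fun u => 1 ≤ zb u w).card := by
        refine Finset.card_le_card_of_injOn Prod.fst ?_ ?_
        · rintro ⟨u, w'⟩ h
          simp only [hF, Finset.coe_filter, Finset.mem_filter, Finset.mem_univ, true_and,
            Set.mem_ofPred_eq] at h ⊢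
          obtain ⟨h, rfl⟩ := h
          exact h
        · rintro ⟨u, w'⟩ h ⟨u', w''⟩ h' heq
          simp only [Finset.coe_filter, Set.mem_ofPred_eq] at h h' heq
          rw [heq, h.2, h'.2]
      have h2 : ((Finset.univ.filter fun u => 1 ≤ zb u w).card : ℤ) ≤ ∑ u, zb u w := by
        rw [Finset.card_filter]
        push_cast
        refine Finset.sum_le_sum fun u _ => ?_
        split_ifs with h
        · exact h
        · exact hb0 u w
      exact _root_.le_trans (by exact_mod_cast h1) h2
    have h1 : ∑ w ∈ S, (if ∑ u, f u w < 1 then (0 : ℝ) else 1) * zh w ≤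
        ∑ w ∈ S, (if ∑ u, f u w < 1 then (0 : ℝ) else 1) * ∑ u, f u w := by
      simp only [Fintype.sum_sum_type, Sum.elim_inl, Sum.elim_inr, Pi.zero_apply, zero_mul,
        Finset.sum_const_zero, zero_add, add_zero, cycleFlow] at hz3
      rw [← Finset.sum_subset (Finset.subset_univ S) (fun w _ hw => by simp [hS w hw]),
        ← Finset.sum_subset (Finset.subset_univ S) (fun w _ hw => by simp [hS w hw])] at hz3
      exact hz3
    push_cast
    have h2 : ∀ w ∈ S, (((F.filter fun e => e.2 = w).card - 1 : ℕ) : ℝ) ≤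
        (if ∑ u, f u w < 1 then (0 : ℝ) else 1) * zh w
          - (if ∑ u, f u w < 1 then (0 : ℝ) else 1) := by
      intro w _
      have hc := hcard w
      split_ifs with h
      · have : zh w ≤ 1 := (hz2 (.inr (.inl w))).2.trans (Int.ceil_le.2 (by
          simpa [cycleFlow] using h.le))
        have : (F.filter fun e => e.2 = w).card - 1 = 0 := by omega
        rw [this]; simp
      · have h1 : 1 ≤ zh w := (Int.le_floor.2 (by simpa [cycleFlow] using not_lt.1 h)).trans
          (hz2 (.inr (.inl w))).1
        have : (((F.filter fun e => e.2 = w).card - 1 : ℕ) : ℤ) ≤ zh w - 1 := by omega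
        have : (((F.filter fun e => e.2 = w).card - 1 : ℕ) : ℝ) ≤ zh w - 1 := by
          exact_mod_cast this
        linarith
    have h3 : ∀ w ∈ S, (if ∑ u, f u w < 1 then (0 : ℝ) else 1) * ∑ u, f u w
          - (if ∑ u, f u w < 1 then (0 : ℝ) else 1) ≤ max 0 (∑ u, f u w - 1) := by
      intro w _
      split_ifs with h
      · simp
      · rw [one_mul]; exact le_max_right _ _
    have h2' := Finset.sum_le_sum h2
    have h3' := Finset.sum_le_sum h3
    rw [Finset.sum_sub_distrib] at h2' h3'
    linarith

end DfsTree

namespace DfsTree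

variable {V : Type*} {X : V → V → ℝ} (T : DfsTree X) [Fintype V]

lemma sum_above_par {y : V} (hy : y ≠ T.root) (g : V → ℝ) :
    ∑ z ∈ T.above (T.par y), g z =
      ∑ w, if w ≠ T.root ∧ T.le w y ∧ w ≠ y then g (T.par w) else 0 := by
  rw [← Finset.sum_filter]
  symm
  refine Finset.sum_nbij T.par ?_ ?_ ?_ fun _ _ => rfl
  · intro w hw
    simp only [Finset.mem_filter, Finset.mem_univ, true_and, mem_above] at hw ⊢
    have h := T.le_par hy hw.2.1 hw.2.2
    refine ⟨T.le_trans (T.par_le w) h, fun h' => T.not_le_par hw.1 (h' ▸ h)⟩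
  · intro w hw w' hw' h
    simp only [Finset.coe_filter, Finset.mem_univ, true_and, Set.mem_ofPred_eq] at hw hw'
    exact T.child_unique hw.1 hw'.1 h hw.2.1 hw'.2.1
  · intro z hz
    simp only [Finset.mem_coe, mem_above] at hz
    obtain ⟨w, hw1, hw2, hw3⟩ := T.exists_child hz.1 hz.2
    refine ⟨w, ?_, hw2⟩
    simp only [Finset.coe_filter, Finset.mem_univ, true_and, Set.mem_ofPred_eq]
    refine ⟨hw1, T.le_trans hw3 (T.par_le y), ?_⟩
    rintro rfl
    exact T.not_le_par hy hw3

/-- The weight of the back edge from `u` to the parent of its proper ancestor `w`. -/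
noncomputable def backWeight (u w : V) : ℝ :=
  if w ≠ T.root ∧ T.le w u ∧ w ≠ u then X u (T.par w) else 0

lemma sum_backWeight {w : V} (hsymm : ∀ a b, X a b = X b a) (hw : w ≠ T.root) :
    ∑ u, T.backWeight u w = T.back w := by
  unfold backWeight back
  rw [← Finset.sum_filter]
  refine Finset.sum_congr ?_ fun u _ => hsymm _ _
  ext u
  simp [hw, and_comm, eq_comm]

lemma up_eq_sum_backWeight {y : V} (hy : y ≠ T.root) :
    T.up y = ∑ u, ∑ w, if T.le w y ∧ w ≠ y ∧ T.le y u then T.backWeight u w else 0 := by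
  rw [up, desc, Finset.sum_filter]
  refine Finset.sum_congr rfl fun u _ => ?_
  split_ifs with hu
  · rw [T.sum_above_par hy]
    refine Finset.sum_congr rfl fun w _ => ?_
    unfold backWeight
    by_cases h : T.le w y ∧ w ≠ y
    · have h1 : T.le w u := T.le_trans h.1 hu
      have h2 : w ≠ u := by
        rintro rfl
        exact h.2 (T.le_antisymm h.1 hu)
      simp [h, hu, h1, h2]
    · have : ¬ (T.le w y ∧ w ≠ y ∧ T.le y u) := fun h' => h ⟨h'.1, h'.2.1⟩
      rw [if_neg this, if_neg fun h' => h h'.2]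
  · simp [hu]

lemma exists_back_of_up_pos {y : V} (hy : y ≠ T.root) (h : 0 < T.up y) :
    ∃ e : V × V, e.2 ≠ T.root ∧ T.le e.2 y ∧ e.2 ≠ y ∧ T.le y e.1 ∧ 0 < X e.1 (T.par e.2) := by
  rw [T.up_eq_sum_backWeight hy] at h
  obtain ⟨u, -, hu⟩ := Finset.exists_lt_of_sum_lt (s := Finset.univ) (f := fun _ => (0 : ℝ))
    (by simpa using h)
  obtain ⟨w, -, hw⟩ := Finset.exists_lt_of_sum_lt (s := Finset.univ) (f := fun _ => (0 : ℝ))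
    (by simpa using hu)
  unfold backWeight at hw
  split_ifs at hw with h1 h2
  · exact ⟨(u, w), h2.1, h1.1, h1.2.1, h1.2.2, hw⟩
  · exact absurd hw (lt_irrefl _)
  · exact absurd hw (lt_irrefl _)

/-- A choice of back edges covering every tree edge outside of `D` that is cheap with respect to
the costs of the vertices. -/
theorem exists_back_edges (hX : IsCutMatrix X) :
    ∃ (D : Finset V) (F : Finset (V × V)), T.root ∉ D ∧
      (∀ e ∈ F, e.2 ≠ T.root ∧ T.le e.2 e.1 ∧ 0 < X e.1 (T.par e.2)) ∧
      (∀ y, y ≠ T.root → y ∉ D → ∃ e ∈ F, T.le e.2 y ∧ e.2 ≠ y ∧ T.le y e.1) ∧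
      (∀ w ∈ D, ∃ e ∈ F, e.2 = w) ∧
      ((∑ w ∈ Finset.univ.erase T.root, ((F.filter fun e => e.2 = w).card - 1) + D.card : ℕ) : ℝ)
        ≤ ∑ w ∈ Finset.univ.erase T.root, T.cost w := by
  set D : Finset V := Finset.univ.filter fun y => y ≠ T.root ∧ T.up y ≤ 0 with hD
  have hmD : ∀ y, y ∈ D ↔ y ≠ T.root ∧ T.up y ≤ 0 := fun y => by simp [hD]
  have hch : ∀ y, ∃ e : V × V, y ≠ T.root → y ∉ D →
      e.2 ≠ T.root ∧ T.le e.2 y ∧ e.2 ≠ y ∧ T.le y e.1 ∧ 0 < X e.1 (T.par e.2) := by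
    intro y
    by_cases h : y ≠ T.root ∧ y ∉ D
    · obtain ⟨e, he⟩ := T.exists_back_of_up_pos h.1 (not_le.1 fun h' => h.2 ((hmD y).2 ⟨h.1, h'⟩))
      exact ⟨e, fun _ _ => he⟩
    · exact ⟨(y, y), fun h1 h2 => absurd ⟨h1, h2⟩ h⟩
  choose c hc using hch
  set δ : V → ℝ := fun y => if y ≠ T.root ∧ y ∉ D then max 0 (1 - T.up y) else 0 with hδ
  have hδ0 : ∀ y, 0 ≤ δ y := fun y => by
    simp only [hδ]
    split_ifs
    · exact le_max_left _ _
    · exact le_rfl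
  set p : V → V → ℝ := fun u w => ∑ y, if c y = (u, w) then δ y else 0 with hp
  have hp0 : ∀ u w, 0 ≤ p u w := fun u w => Finset.sum_nonneg fun y _ => by
    split_ifs
    · exact hδ0 y
    · exact le_rfl
  have hpc : ∀ u w, p u w ≠ 0 → ∃ y, y ≠ T.root ∧ y ∉ D ∧ c y = (u, w) := by
    intro u w h
    obtain ⟨y, -, hy⟩ := Finset.exists_ne_zero_of_sum_ne_zero h
    simp only [hδ] at hy
    by_cases h1 : c y = (u, w)
    · by_cases h2 : y ≠ T.root ∧ y ∉ D
      · exact ⟨y, h2.1, h2.2, h1⟩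
      · simp [h1, if_neg h2] at hy
    · simp [h1] at hy
  have hbw0 : ∀ u w, 0 ≤ T.backWeight u w := fun u w => by
    unfold backWeight
    split_ifs
    · exact hX.nonneg _ _
    · exact le_rfl
  set q : V → V → ℝ := fun u w => if u = w ∧ w ∈ D then max 0 (1 - T.back w) else 0 with hq
  have hq0 : ∀ u w, 0 ≤ q u w := fun u w => by
    simp only [hq]
    split_ifs
    · exact le_max_left _ _
    · exact le_rfl
  set f : V → V → ℝ := fun u w => T.backWeight u w + p u w + q u w with hf
  have hf0 : ∀ u w, 0 ≤ f u w := fun u w => add_nonneg (add_nonneg (hbw0 u w) (hp0 u w)) (hq0 u w)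
  have hsupp : ∀ u w, 0 < f u w → w ≠ T.root ∧ T.le w u ∧ 0 < X u (T.par w) := by
    intro u w h
    by_cases h1 : 0 < T.backWeight u w
    · unfold backWeight at h1
      split_ifs at h1 with h2
      · exact ⟨h2.1, h2.2.1, h1⟩
      · exact absurd h1 (lt_irrefl _)
    · by_cases h2 : p u w = 0
      · have h3 : 0 < q u w := by
          simp only [hf] at h
          linarith
        simp only [hq] at h3
        split_ifs at h3 with h4
        · obtain ⟨rfl, h4⟩ := h4
          have := ((hmD u).1 h4).1
          exact ⟨this, T.le_refl u, by rw [hX.symm]; exact T.par_pos this⟩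
        · exact absurd h3 (lt_irrefl _)
      · obtain ⟨y, hy1, hy2, hy3⟩ := hpc u w h2
        have := hc y hy1 hy2
        rw [hy3] at this
        exact ⟨this.1, T.le_trans this.2.1 this.2.2.2.1, this.2.2.2.2⟩
  have hsum : ∀ w, w ≠ T.root → ∑ u, f u w =
      T.back w + ∑ u, p u w + if w ∈ D then max 0 (1 - T.back w) else 0 := by
    intro w hw
    simp only [hf, Finset.sum_add_distrib]
    rw [T.sum_backWeight hX.symm hw]
    congr 1
    rw [Finset.sum_eq_single w]
    · simp [hq]
    · intro u _ hu
      simp [hq, hu]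
    · simp
  obtain ⟨F, hF1, hF2, hF3, hF4⟩ := T.exists_rounding hf0
    (fun u w h => have := hsupp u w (lt_of_le_of_ne (hf0 u w) h.symm); ⟨this.1, this.2.1⟩)
  refine ⟨D, F, fun h => ((hmD _).1 h).1 rfl, fun e he => hsupp _ _ (hF1 e he), ?_, ?_, ?_⟩
  · intro y hy hyD
    refine hF2 y hy ?_
    have hcy := hc y hy hyD
    have h1 : δ y ≤ ∑ u, ∑ w, if T.le w y ∧ w ≠ y ∧ T.le y u then p u w else 0 := by
      have h2 : δ y ≤ p (c y).1 (c y).2 := by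
        refine _root_.le_trans ?_ (Finset.single_le_sum (f := fun y' =>
          if c y' = ((c y).1, (c y).2) then δ y' else 0) (fun y' _ => ?_) (Finset.mem_univ y))
        · simp
        · split_ifs
          · exact hδ0 y'
          · exact le_rfl
      have h0 : ∀ u w, 0 ≤ if T.le w y ∧ w ≠ y ∧ T.le y u then p u w else 0 := fun u w => by
        split_ifs
        · exact hp0 u w
        · exact le_rfl
      calc δ y ≤ if T.le (c y).2 y ∧ (c y).2 ≠ y ∧ T.le y (c y).1 then
          p (c y).1 (c y).2 else 0 := by
            rw [if_pos ⟨hcy.2.1, hcy.2.2.1, hcy.2.2.2.1⟩]; exact h2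
        _ ≤ ∑ w, if T.le w y ∧ w ≠ y ∧ T.le y (c y).1 then p (c y).1 w else 0 :=
            Finset.single_le_sum (f := fun w => if T.le w y ∧ w ≠ y ∧ T.le y (c y).1 then
              p (c y).1 w else 0) (fun w _ => h0 _ w) (Finset.mem_univ _)
        _ ≤ _ := Finset.single_le_sum (f := fun u => ∑ w, if T.le w y ∧ w ≠ y ∧ T.le y u then
              p u w else 0) (fun u _ => Finset.sum_nonneg fun w _ => h0 u w) (Finset.mem_univ _)
    have h2 : 1 - T.up y ≤ δ y := by
      simp only [hδ]
      rw [if_pos ⟨hy, hyD⟩]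
      exact le_max_right _ _
    have h3 : T.up y + ∑ u, ∑ w, (if T.le w y ∧ w ≠ y ∧ T.le y u then p u w else 0) ≤
        ∑ u, ∑ w, if T.le w y ∧ w ≠ y ∧ T.le y u then f u w else 0 := by
      rw [T.up_eq_sum_backWeight hy, ← Finset.sum_add_distrib]
      refine Finset.sum_le_sum fun u _ => ?_
      rw [← Finset.sum_add_distrib]
      refine Finset.sum_le_sum fun w _ => ?_
      split_ifs
      · simp only [hf]
        linarith [hq0 u w]
      · simp
    linarith
  · intro w hw
    refine hF3 w ?_
    rw [hsum w ((hmD w).1 hw).1, if_pos hw]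
    have h1 : 0 ≤ ∑ u, p u w := Finset.sum_nonneg fun u _ => hp0 u w
    have h2 := le_max_right 0 (1 - T.back w)
    linarith
  · have h1 := hF4 (Finset.univ.erase T.root) (fun w hw => by
      have hw : w = T.root := by simpa using hw
      refine Finset.sum_eq_zero fun u _ => ?_
      by_contra h
      exact (hsupp u w (lt_of_le_of_ne (hf0 u w) (Ne.symm h))).1 hw)
    have h2 : ∑ w ∈ Finset.univ.erase T.root, max 0 (∑ u, f u w - 1) ≤
        ∑ w ∈ Finset.univ.erase T.root, max 0 (T.back w - 1) +
          ∑ w ∈ Finset.univ.erase T.root, ∑ u, p u w := by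
      rw [← Finset.sum_add_distrib]
      refine Finset.sum_le_sum fun w hw => ?_
      rw [hsum w (Finset.ne_of_mem_erase hw)]
      have hp' : 0 ≤ ∑ u, p u w := Finset.sum_nonneg fun u _ => hp0 u w
      have h3 := le_max_left 0 (T.back w - 1)
      have h4 := le_max_right 0 (T.back w - 1)
      refine max_le (by linarith) ?_
      split_ifs
      · rcases max_cases 0 (1 - T.back w) with h | h <;> linarith
      · linarith
    have h3 : ∑ w ∈ Finset.univ.erase T.root, ∑ u, p u w ≤ ∑ y ∈ Finset.univ.erase T.root, δ y := by
      have h4 : ∑ w, ∑ u, p u w = ∑ y, δ y := by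
        simp only [hp]
        rw [Finset.sum_comm, ← Fintype.sum_prod_type', Finset.sum_comm]
        simp
      have h5 : ∑ w ∈ Finset.univ.erase T.root, ∑ u, p u w ≤ ∑ w, ∑ u, p u w :=
        Finset.sum_le_sum_of_subset_of_nonneg (Finset.erase_subset _ _)
          fun w _ _ => Finset.sum_nonneg fun u _ => hp0 u w
      rw [Finset.sum_erase (f := δ) Finset.univ (if_neg fun h => h.1 rfl)]
      exact h5.trans h4.le
    have h4 : ∑ y ∈ Finset.univ.erase T.root, δ y + D.card ≤
        ∑ y ∈ Finset.univ.erase T.root, max 0 (1 - T.up y) := by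
      have h5 : (D.card : ℝ) = ∑ y ∈ Finset.univ.erase T.root, if y ∈ D then (1 : ℝ) else 0 := by
        rw [Finset.sum_erase (f := fun y => if y ∈ D then (1 : ℝ) else 0) Finset.univ
          (if_neg fun h => ((hmD _).1 h).1 rfl)]
        simp
      rw [h5, ← Finset.sum_add_distrib]
      refine Finset.sum_le_sum fun y hy => ?_
      simp only [hδ]
      by_cases hyD : y ∈ D
      · rw [if_neg fun h => h.2 hyD, if_pos hyD]
        have := ((hmD y).1 hyD).2
        have h6 := le_max_right 0 (1 - T.up y)
        linarith
      · rw [if_pos ⟨Finset.ne_of_mem_erase hy, hyD⟩, if_neg hyD]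
        simp
    simp only [cost, Finset.sum_add_distrib]
    push_cast at h1 ⊢
    linarith

end DfsTree

section CubicJoin

variable {V ι : Type*}

/-- The edges of `E` incident with `x`. -/
def incident [DecidableEq V] (s t : ι → V) (E : Finset ι) (x : V) : Finset ι :=
  E.filter fun e => s e = x ∨ t e = x

lemma bdry_eq_card_incident [DecidableEq V] {s t : ι → V} {E : Finset ι}
    (hl : ∀ e ∈ E, s e ≠ t e) (x : V) : bdry s t E x = ((incident s t E x).card : ZMod 2) := by
  unfold bdry incident
  rw [Finset.card_filter, Nat.cast_sum]
  refine Finset.sum_congr rfl fun e he => ?_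
  have := hl e he
  by_cases h1 : s e = x
  · have h2 : t e ≠ x := fun h => this (h1.trans h.symm)
    simp [h1, ptInd_of_ne h2]
  · by_cases h2 : t e = x
    · simp [h2, ptInd_of_ne h1]
    · simp [h1, h2, ptInd_of_ne h1, ptInd_of_ne h2]

lemma exists_cycle_of_edgeReach [DecidableEq ι] {s t : ι → V} {E : Finset ι} {e : ι} (he : e ∈ E)
    (h : EdgeReach s t (E.erase e) (s e) (t e)) :
    ∃ C ⊆ E, e ∈ C ∧ ∀ y, bdry s t C y = 0 := by
  obtain ⟨P, hP, hb⟩ := exists_join_of_edgeReach h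
  refine ⟨insert e P, Finset.insert_subset he (hP.trans (Finset.erase_subset _ _)),
    Finset.mem_insert_self _ _, fun y => ?_⟩
  rw [bdry_insert s t (fun h => Finset.notMem_erase e E (hP h)), hb, zmod_two_add_self]

/-- In a bridgeless multigraph the odd-degree vertices have a join of at most a third of the total
weight that moreover uses exactly one edge at each vertex of a given set of cubic vertices. -/
theorem exists_join_weight_le_third_of_cubic [Fintype V] [DecidableEq V] [DecidableEq ι]
    (s t : ι → V) (E : Finset ι) (c : ι → ℤ)
    (hbr : ∀ e ∈ E, ∃ C ⊆ E, e ∈ C ∧ ∀ y, bdry s t C y = 0) (hl : ∀ e ∈ E, s e ≠ t e)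
    (W : Finset V) (hW : ∀ x ∈ W, (incident s t E x).card = 3) :
    ∃ J ⊆ E, (∀ y, bdry s t (E \ J) y = 0) ∧ (∀ x ∈ W, (incident s t J x).card = 1) ∧
      3 * ∑ e ∈ J, c e ≤ ∑ e ∈ E, c e := by
  set m : ι → ℤ := fun e => ∑ x ∈ W, if s e = x ∨ t e = x then 1 else 0 with hm
  set M : ℤ := 4 * ∑ e ∈ E, |c e| + 1 with hM
  have hsum : ∀ K : Finset ι, ∑ e ∈ K, m e = ∑ x ∈ W, ((incident s t K x).card : ℤ) := by
    intro K
    simp only [hm]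
    rw [Finset.sum_comm]
    refine Finset.sum_congr rfl fun x _ => ?_
    rw [incident, Finset.card_filter]
    push_cast
    rfl
  obtain ⟨J, hJE, hJ, hJc⟩ := exists_join_weight_le_third s t E (fun e => c e + M * m e) hbr
  have hodd : ∀ x ∈ W, 1 ≤ (incident s t J x).card := by
    intro x hx
    by_contra! h
    have h1 := bdry_sdiff s t hJE x
    rw [hJ, bdry_eq_card_incident hl, hW x hx,
      bdry_eq_card_incident (fun e he => hl e (hJE he))] at h1
    have h2 : (incident s t J x).card = 0 := by omega
    rw [h2] at h1
    exact absurd h1 (by decide)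
  simp only [Finset.sum_add_distrib, ← Finset.mul_sum] at hJc
  have hE : ∑ e ∈ E, m e = 3 * W.card := by
    rw [hsum, Finset.sum_congr rfl fun x hx => by rw [hW x hx]]
    simp [mul_comm]
  have hJ1 : (W.card : ℤ) ≤ ∑ e ∈ J, m e := by
    rw [hsum, Finset.card_eq_sum_ones]
    push_cast
    exact Finset.sum_le_sum fun x hx => by exact_mod_cast hodd x hx
  have habs1 : -∑ e ∈ E, |c e| ≤ ∑ e ∈ J, c e := by
    have h1 := Finset.sum_le_sum_of_subset_of_nonneg hJE (f := fun e => |c e|)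
      fun e _ _ => abs_nonneg _
    have h2 : -∑ e ∈ J, |c e| ≤ ∑ e ∈ J, c e := by
      rw [← Finset.sum_neg_distrib]
      exact Finset.sum_le_sum fun e _ => neg_abs_le _
    linarith
  have habs2 : ∑ e ∈ E, c e ≤ ∑ e ∈ E, |c e| := Finset.sum_le_sum fun e _ => le_abs_self _
  have habs0 : 0 ≤ ∑ e ∈ E, |c e| := Finset.sum_nonneg fun e _ => abs_nonneg _
  have hJ2 : ∑ e ∈ J, m e = W.card := by
    refine le_antisymm ?_ hJ1
    by_contra! h
    have h1 : M ≤ M * (∑ e ∈ J, m e - W.card) :=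
      le_mul_of_one_le_right (by omega) (by omega)
    rw [hE] at hJc
    have h2 : 3 * (M * (∑ e ∈ J, m e - W.card)) ≤ 4 * ∑ e ∈ E, |c e| := by linarith
    linarith
  refine ⟨J, hJE, hJ, fun x hx => ?_, ?_⟩
  · rw [hsum, Finset.card_eq_sum_ones] at hJ2
    push_cast at hJ2
    have := (Finset.sum_eq_sum_iff_of_le (f := fun _ => (1 : ℤ)) fun x hx => by
      exact_mod_cast hodd x hx).1 hJ2.symm x hx
    exact_mod_cast this.symm
  · rw [hE, hJ2] at hJc
    linarith

end CubicJoin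

section Euler

variable {V ι : Type*}

/-- A multigraph in `G` in which exactly `u` and `v` have odd degree (or none, if `u = v`) has an
Eulerian trail from `u` to `v` through the component of `u`. -/
theorem exists_walk_of_bdry [Fintype V] [DecidableEq ι] {G : SimpleGraph V} {s t : ι → V}
    (k : ℕ) : ∀ (E : Finset ι) (u v : V), E.card = k → (∀ e ∈ E, G.Adj (s e) (t e)) →
      (∀ y, bdry s t E y = ptInd u y + ptInd v y) →
      ∃ w : G.Walk u v, w.length ≤ E.card ∧ ∀ y, EdgeReach s t E u y → y ∈ w.support := by
  induction k using Nat.strong_induction_on with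
  | _ k ih =>
  intro E u v hk hadj hb
  by_cases hex : ∃ e ∈ E, ∃ c, Joins s t e u c
  swap
  · push Not at hex
    have h1 : ∀ e ∈ E, s e ≠ u ∧ t e ≠ u := fun e he =>
      ⟨fun h => hex e he (t e) (.inl ⟨h, rfl⟩), fun h => hex e he (s e) (.inr ⟨rfl, h⟩)⟩
    have huv : u = v := by
      by_contra hne
      have h2 := hb u
      rw [ptInd_self, ptInd_of_ne (Ne.symm hne)] at h2
      have h3 : bdry s t E u = 0 := Finset.sum_eq_zero fun e he => by
        rw [ptInd_of_ne (h1 e he).1, ptInd_of_ne (h1 e he).2, add_zero]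
      rw [h3] at h2
      exact absurd h2 (by decide)
    subst huv
    refine ⟨.nil, by simp, fun y hy => ?_⟩
    have := EdgeReach.mem_iff (S := {u}) (fun e he => by simp [h1 e he]) hy
    simpa using this
  obtain ⟨e, he, c, hj⟩ := hex
  have huc : G.Adj u c := by
    have := hadj e he
    rcases hj with ⟨rfl, rfl⟩ | ⟨rfl, rfl⟩
    · exact this
    · exact this.symm
  have hb' : ∀ y, bdry s t (E.erase e) y = ptInd c y + ptInd v y := fun y => by
    rw [bdry_erase s t he, hb, hj.ptInd_add]
    have := zmod_two_add_self (ptInd u y)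
    linear_combination this
  have hc1 : (E.erase e).card + 1 = k := by rw [Finset.card_erase_add_one he, hk]
  have hclosed : ∀ Y : Set V, u ∈ Y → c ∈ Y → (∀ e' ∈ E.erase e, s e' ∈ Y ↔ t e' ∈ Y) →
      ∀ y, EdgeReach s t E u y → y ∈ Y := fun Y hu hc h y hy => by
    refine (EdgeReach.mem_iff (fun e' he' => ?_) hy).1 hu
    by_cases hee : e' = e
    · subst hee
      rcases hj with ⟨h1, h2⟩ | ⟨h1, h2⟩ <;> simp [h1, h2, hu, hc]
    · exact h e' (Finset.mem_erase.2 ⟨hee, he'⟩)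
  by_cases hr : EdgeReach s t (E.erase e) c u
  · obtain ⟨w, hw1, hw2⟩ := ih _ (by omega) (E.erase e) c v rfl
      (fun e' he' => hadj e' (Finset.mem_of_mem_erase he')) hb'
    refine ⟨.cons huc w, by simp only [SimpleGraph.Walk.length_cons]; omega, fun y hy => ?_⟩
    rw [SimpleGraph.Walk.support_cons, List.mem_cons]
    right
    exact hw2 y (hclosed {y | EdgeReach s t (E.erase e) c y} hr (.refl c)
      (fun e' he' => ⟨fun h => h.trans (.of_mem he'), fun h => h.trans (.symm (.of_mem he'))⟩) y hy)
  set R : Finset V := Finset.univ.filter fun y => EdgeReach s t (E.erase e) u y with hR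
  have hmR : ∀ y, y ∈ R ↔ EdgeReach s t (E.erase e) u y := fun y => by simp [hR]
  have hRe : ∀ e' ∈ E.erase e, (s e' ∈ R ↔ t e' ∈ R) := fun e' he' => by
    rw [hmR, hmR]
    exact ⟨fun h => h.trans (.of_mem he'), fun h => h.trans (.symm (.of_mem he'))⟩
  have hcR : c ∉ R := fun h => hr ((hmR c).1 h).symm
  set E₁ := (E.erase e).filter fun e' => s e' ∈ R with hE₁
  set E₂ := (E.erase e).filter fun e' => ¬ s e' ∈ R with hE₂
  have hb₁ : ∀ y, bdry s t E₁ y = if y ∈ R then bdry s t (E.erase e) y else 0 := by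
    intro y
    unfold bdry
    rw [hE₁, Finset.sum_filter]
    split_ifs with hy
    · refine Finset.sum_congr rfl fun e' he' => ?_
      split_ifs with h
      · rfl
      · have h' : t e' ∉ R := fun h' => h ((hRe e' he').2 h')
        rw [ptInd_of_ne (by rintro rfl; exact h hy), ptInd_of_ne (by rintro rfl; exact h' hy),
          add_zero]
    · refine Finset.sum_eq_zero fun e' he' => ?_
      split_ifs with h
      · have h' : t e' ∈ R := (hRe e' he').1 h
        rw [ptInd_of_ne (by rintro rfl; exact hy h), ptInd_of_ne (by rintro rfl; exact hy h'),
          add_zero]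
      · rfl
  have hvR : v ∉ R := by
    intro hv
    have h1 := sum_bdry s t R (E.erase e)
    rw [Finset.filter_false_of_mem fun e' he' => by
      rw [Crosses, not_not]; exact hRe e' he'] at h1
    simp only [hb', Finset.sum_add_distrib, sum_ptInd, if_neg hcR, if_pos hv] at h1
    exact absurd h1 (by simp)
  have hz₁ : ∀ y, bdry s t E₁ y = 0 := fun y => by
    rw [hb₁]
    split_ifs with hy
    · rw [hb', ptInd_of_ne (by rintro rfl; exact hcR hy),
        ptInd_of_ne (by rintro rfl; exact hvR hy), add_zero]
    · rfl
  have hz₂ : ∀ y, bdry s t E₂ y = ptInd c y + ptInd v y := fun y => by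
    have h1 : bdry s t E₁ y + bdry s t E₂ y = bdry s t (E.erase e) y :=
      Finset.sum_filter_add_sum_filter_not _ _ _
    rw [← hb', ← h1, hz₁, zero_add]
  have hcard : E₁.card + E₂.card = (E.erase e).card :=
    Finset.card_filter_add_card_filter_not _
  obtain ⟨w₁, hw₁, hs₁⟩ := ih _ (by omega) E₁ u u rfl
    (fun e' he' => hadj e' (Finset.mem_of_mem_erase (Finset.mem_filter.1 he').1))
    (fun y => by rw [hz₁, zmod_two_add_self])
  obtain ⟨w₂, hw₂, hs₂⟩ := ih _ (by omega) E₂ c v rfl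
    (fun e' he' => hadj e' (Finset.mem_of_mem_erase (Finset.mem_filter.1 he').1)) hz₂
  refine ⟨w₁.append (.cons huc w₂), ?_, fun y hy => ?_⟩
  · simp only [SimpleGraph.Walk.length_append, SimpleGraph.Walk.length_cons]
    omega
  have hR₁ : ∀ y ∈ R, EdgeReach s t E₁ u y := by
    intro y hy
    refine ((EdgeReach.mem_iff (S := {y | EdgeReach s t E₁ u y}) (fun e' he' => ?_)
      (?_ : EdgeReach s t (E.erase e) u y)).1 (.refl u))
    · by_cases h : s e' ∈ R
      · have h' : e' ∈ E₁ := Finset.mem_filter.2 ⟨he', h⟩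
        exact ⟨fun h => h.trans (.of_mem h'), fun h => h.trans (.symm (.of_mem h'))⟩
      · have hsub : ∀ z, EdgeReach s t E₁ u z → z ∈ R := fun z hz =>
          (hmR z).2 (hz.mono (Finset.filter_subset _ _))
        have h2 : t e' ∉ R := fun h' => h ((hRe e' he').2 h')
        exact ⟨fun h' => absurd (hsub _ h') h, fun h' => absurd (hsub _ h') h2⟩
    · exact (hmR y).1 hy
  have hcl := hclosed {y | y ∈ R ∨ EdgeReach s t E₂ c y} (.inl ((hmR u).2 (.refl u)))
    (.inr (.refl c)) (fun e' he' => by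
      by_cases h : s e' ∈ R
      · exact ⟨fun _ => .inl ((hRe e' he').1 h), fun _ => .inl h⟩
      · have h2 : t e' ∉ R := fun h' => h ((hRe e' he').2 h')
        have h' : e' ∈ E₂ := Finset.mem_filter.2 ⟨he', h⟩
        exact ⟨fun h3 => .inr ((h3.resolve_left h).trans (.of_mem h')),
          fun h3 => .inr ((h3.resolve_left h2).trans (.symm (.of_mem h')))⟩) y hy
  rw [SimpleGraph.Walk.mem_support_append_iff, SimpleGraph.Walk.support_cons, List.mem_cons]
  rcases hcl with h | h
  · exact .inl (hs₁ y (hR₁ y h))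
  · exact .inr (.inr (hs₂ y h))

end Euler

namespace DfsTree

variable {V : Type*} {X : V → V → ℝ} (T : DfsTree X)

/-- The back edges `F`, where `(u, w)` stands for the edge from `u` to the parent of `w`, cover
every tree edge outside of `D`, and some back edge is attached at each element of `D`. -/
structure IsBackCover (D : Finset V) (F : Finset (V × V)) : Prop where
  root_notMem : T.root ∉ D
  mem : ∀ e ∈ F, e.2 ≠ T.root ∧ T.le e.2 e.1 ∧ 0 < X e.1 (T.par e.2)
  cover : ∀ y, y ≠ T.root → y ∉ D → ∃ e ∈ F, T.le e.2 y ∧ e.2 ≠ y ∧ T.le y e.1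
  exists_mem : ∀ w ∈ D, ∃ e ∈ F, e.2 = w

/-- The upper end of the tree edge above `w` in the gadget multigraph. -/
noncomputable def top (D : Finset V) (w : V) : V ⊕ V := if w ∈ D then .inl (T.par w) else .inr w

/-- First ends of the edges of the gadget multigraph: the edges that join a vertex to the
subdivision vertices below it, the tree edges, and the back edges. -/
noncomputable def gadgetFst (D : Finset V) : V ⊕ V ⊕ V × V → V ⊕ V :=
  Sum.elim (fun w => .inl (T.par w)) (Sum.elim (T.top D) fun e => .inl e.1)

/-- Second ends of the edges of the gadget multigraph, where the back edge `(ρ w, w)` is attached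
to the subdivision vertex of `w`. -/
noncomputable def gadgetSnd (D : Finset V) (ρ : V → V) : V ⊕ V ⊕ V × V → V ⊕ V :=
  Sum.elim .inr (Sum.elim .inl fun e => if ρ e.2 = e.1 then T.top D e.2 else .inl (T.par e.2))

variable [Fintype V]

/-- The edges of the gadget multigraph. -/
noncomputable def gadget (D : Finset V) (F : Finset (V × V)) : Finset (V ⊕ V ⊕ V × V) :=
  ((Finset.univ.erase T.root) \ D).disjSum ((Finset.univ.erase T.root).disjSum F)

section Gadget

variable {T} {D : Finset V} {F : Finset (V × V)} {ρ : V → V}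

@[simp] lemma mem_gadget_inl {w : V} : .inl w ∈ T.gadget D F ↔ w ≠ T.root ∧ w ∉ D := by
  simp [gadget]

@[simp] lemma mem_gadget_inr_inl {w : V} : .inr (.inl w) ∈ T.gadget D F ↔ w ≠ T.root := by
  simp [gadget]

@[simp] lemma mem_gadget_inr_inr {e : V × V} : .inr (.inr e) ∈ T.gadget D F ↔ e ∈ F := by
  simp [gadget]

variable {e₀ : V ⊕ V ⊕ V × V}

variable (T D F ρ e₀) in
/-- Reachability in the gadget multigraph without the edge `e₀`. -/
abbrev GadgetReach : V ⊕ V → V ⊕ V → Prop :=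
  EdgeReach (T.gadgetFst D) (T.gadgetSnd D ρ) ((T.gadget D F).erase e₀)

lemma reach_top {w : V} (hw : w ≠ T.root) (h : e₀ ≠ .inl w) :
    T.GadgetReach D F ρ e₀ (.inl (T.par w)) (T.top D w) := by
  unfold top
  split_ifs with hD
  · exact EdgeReach.refl _
  · exact EdgeReach.of_mem (ι := V ⊕ V ⊕ V × V) (e := .inl w)
      (Finset.mem_erase.2 ⟨h.symm, mem_gadget_inl.2 ⟨hw, hD⟩⟩)

lemma reach_par {w : V} (hw : w ≠ T.root) (h : e₀ ≠ .inl w) (h' : e₀ ≠ .inr (.inl w)) :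
    T.GadgetReach D F ρ e₀ (.inl (T.par w)) (.inl w) :=
  (reach_top hw h).trans (EdgeReach.of_mem (ι := V ⊕ V ⊕ V × V) (e := .inr (.inl w))
    (Finset.mem_erase.2 ⟨h'.symm, mem_gadget_inr_inl.2 hw⟩))

lemma reach_of_le {a b : V} (hab : T.le a b)
    (h : ∀ y, T.le a y → a ≠ y → T.le y b → e₀ ≠ .inl y ∧ e₀ ≠ .inr (.inl y)) :
    T.GadgetReach D F ρ e₀ (.inl a) (.inl b) := by
  induction b using T.induction_down with
  | root => rw [T.eq_root_of_le hab]; exact EdgeReach.refl _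
  | step b hb ih =>
    by_cases hne : a = b
    · rw [hne]; exact EdgeReach.refl _
    have h1 := h b hab hne (T.le_refl b)
    exact (ih (T.le_par hb hab hne) fun y h1 h2 h3 => h y h1 h2 (T.le_trans h3 (T.par_le b))).trans
      (reach_par hb h1.1 h1.2)

lemma reach_back {e : V × V} (hF : T.IsBackCover D F) (he : e ∈ F) (h : e₀ ≠ .inr (.inr e))
    (h' : e₀ ≠ .inl e.2) : T.GadgetReach D F ρ e₀ (.inl e.1) (.inl (T.par e.2)) := by
  have h1 : T.GadgetReach D F ρ e₀ (T.gadgetFst D (.inr (.inr e)))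
      (T.gadgetSnd D ρ (.inr (.inr e))) :=
    .of_mem (Finset.mem_erase.2 ⟨h.symm, mem_gadget_inr_inr.2 he⟩)
  refine .trans h1 ?_
  simp only [gadgetSnd, Sum.elim_inr]
  split_ifs
  · exact (reach_top (hF.mem e he).1 h').symm
  · exact EdgeReach.refl _

lemma reach_around (hF : T.IsBackCover D F) {y : V} (hy : y ≠ T.root) (hyD : y ∉ D)
    (h : e₀ = .inl y ∨ e₀ = .inr (.inl y)) : T.GadgetReach D F ρ e₀ (.inl (T.par y)) (.inl y) := by
  obtain ⟨e, he, h1, h2, h3⟩ := hF.cover y hy hyD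
  have h4 : ∀ z, z ≠ y → e₀ ≠ .inl z ∧ e₀ ≠ .inr (.inl z) := by
    intro z hz
    rcases h with rfl | rfl <;> simp [hz.symm]
  have h5 : T.GadgetReach D F ρ e₀ (.inl (T.par e.2)) (.inl (T.par y)) := by
    refine reach_of_le (T.le_trans (T.par_le _) (T.le_par hy h1 h2)) fun z _ _ hz => h4 z ?_
    rintro rfl
    exact T.not_le_par hy hz
  have h6 : T.GadgetReach D F ρ e₀ (.inl y) (.inl e.1) :=
      reach_of_le h3 fun z _ hz _ => h4 z hz.symm
  exact (h6.trans
      ((reach_back hF he (by rcases h with rfl | rfl <;> simp) (h4 _ h2).1).trans h5)).symm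

/-- The gadget multigraph is bridgeless. -/
lemma gadget_bridgeless (hF : T.IsBackCover D F) (e : V ⊕ V ⊕ V × V) (he : e ∈ T.gadget D F) :
    ∃ C ⊆ T.gadget D F, e ∈ C ∧ ∀ y, bdry (T.gadgetFst D) (T.gadgetSnd D ρ) C y = 0 := by
  refine exists_cycle_of_edgeReach he ?_
  rcases e with y | y | e
  · rw [mem_gadget_inl] at he
    have h1 := reach_around (ρ := ρ) hF he.1 he.2 (e₀ := .inl y) (.inl rfl)
    have h2 : T.GadgetReach D F ρ (.inl y)
        (T.top D y) (.inl y) :=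
            EdgeReach.of_mem (ι := V ⊕ V ⊕ V × V) (e := .inr (.inl y)) (by simp [he.1])
    rw [top, if_neg he.2] at h2
    exact h1.trans h2.symm
  · rw [mem_gadget_inr_inl] at he
    refine (reach_top (e₀ := .inr (.inl y)) he (by simp)).symm.trans ?_
    by_cases hD : y ∈ D
    · obtain ⟨e, heF, rfl⟩ := hF.exists_mem y hD
      refine .trans (reach_back hF heF (by simp) (by simp)).symm ?_
      refine (reach_of_le (hF.mem e heF).2.1 fun z _ hz _ => ⟨by simp, ?_⟩).symm
      simpa using hz
    · exact reach_around hF he hD (.inr rfl)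
  · rw [mem_gadget_inr_inr] at he
    obtain ⟨h1, h2, -⟩ := hF.mem e he
    have h3 : T.GadgetReach D F ρ (.inr (.inr e)) (.inl (T.par e.2)) (.inl e.1) :=
      reach_of_le (T.le_trans (T.par_le _) h2) fun z _ _ _ => ⟨by simp, by simp⟩
    refine h3.symm.trans ?_
    simp only [gadgetSnd, Sum.elim_inr]
    split_ifs
    · exact reach_top (e₀ := .inr (.inr e)) h1 (by simp)
    · exact EdgeReach.refl _

lemma gadget_loopless (hF : T.IsBackCover D F) (e : V ⊕ V ⊕ V × V) (he : e ∈ T.gadget D F) :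
    T.gadgetFst D e ≠ T.gadgetSnd D ρ e := by
  rcases e with y | y | e
  · simp [gadgetFst, gadgetSnd]
  · rw [mem_gadget_inr_inl] at he
    simp only [gadgetFst, gadgetSnd, top, Sum.elim_inr, Sum.elim_inl]
    split_ifs
    · simpa using T.par_ne he
    · simp
  · rw [mem_gadget_inr_inr] at he
    obtain ⟨h1, h2, -⟩ := hF.mem e he
    have : e.1 ≠ T.par e.2 := fun h => T.not_le_par h1 (h ▸ h2)
    simp only [gadgetFst, gadgetSnd, top, Sum.elim_inr]
    split_ifs <;> simp [this]

/-- The subdivision vertices to which a back edge is attached are cubic. -/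
lemma incident_gadget {w : V} (hw : w ≠ T.root) (hD : w ∉ D) (hρ : (ρ w, w) ∈ F) :
    incident (T.gadgetFst D) (T.gadgetSnd D ρ) (T.gadget D F) (.inr w) =
      {.inl w, .inr (.inl w), .inr (.inr (ρ w, w))} := by
  have htop : ∀ z, T.top D z = .inr w ↔ z = w := by
    intro z
    unfold top
    split_ifs with h
    · simp only [false_iff]
      rintro rfl
      exact hD h
    · simp
  ext e
  rcases e with y | y | e
  · rw [incident, Finset.mem_filter, mem_gadget_inl]
    simp [gadgetFst, gadgetSnd]
    rintro rfl
    exact ⟨hw, hD⟩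
  · rw [incident, Finset.mem_filter, mem_gadget_inr_inl]
    simp [gadgetFst, gadgetSnd, htop]
    rintro rfl
    exact hw
  · obtain ⟨u, z⟩ := e
    rw [incident, Finset.mem_filter, mem_gadget_inr_inr]
    simp [gadgetFst, gadgetSnd]
    constructor
    · rintro ⟨h1, h2⟩
      split_ifs at h2 with h3
      obtain rfl := (htop z).1 h2
      exact ⟨h3.symm, rfl⟩
    · rintro ⟨rfl, rfl⟩
      simp [htop, hρ]

end Gadget

end DfsTree

namespace DfsTree

variable {V : Type*} {X : V → V → ℝ} (T : DfsTree X) [Fintype V]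

lemma sum_toLeft_add_sum_toRight {α β M : Type*} [AddCommMonoid M] (S : Finset (α ⊕ β))
    (g : α ⊕ β → M) :
    ∑ e ∈ S, g e = ∑ a ∈ S.toLeft, g (.inl a) + ∑ b ∈ S.toRight, g (.inr b) := by
  conv_lhs => rw [← Finset.toLeft_disjSum_toRight (u := S)]
  exact Finset.sum_disjSum _ _ _

/-- A back cover yields a connected spanning multigraph of support edges with even degrees. -/
theorem exists_even_multigraph {D : Finset V} {F : Finset (V × V)}
    (hF : T.IsBackCover D F) :
    ∃ (s t : (V ⊕ V × V) ⊕ V × Bool → V) (E : Finset ((V ⊕ V × V) ⊕ V × Bool)),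
      (∀ e ∈ E, 0 < X (s e) (t e)) ∧ (∀ y, bdry s t E y = 0) ∧
      (∀ y, EdgeReach s t E T.root y) ∧
      3 * E.card + 4 ≤ 4 * Fintype.card V +
        2 * (∑ w ∈ Finset.univ.erase T.root, ((F.filter fun e => e.2 = w).card - 1) + D.card) := by
  set H : Finset V := Finset.univ.filter fun w => w ≠ T.root ∧ w ∉ D ∧ ∃ e ∈ F, e.2 = w with hH
  have hmH : ∀ w, w ∈ H ↔ w ≠ T.root ∧ w ∉ D ∧ ∃ e ∈ F, e.2 = w := fun w => by simp [hH]
  have hρ : ∀ w, ∃ u, w ∈ H → (u, w) ∈ F := by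
    intro w
    by_cases h : w ∈ H
    · obtain ⟨-, -, ⟨u, w'⟩, he, rfl⟩ := (hmH w).1 h
      exact ⟨u, fun _ => he⟩
    · exact ⟨w, fun h' => absurd h' h⟩
  choose ρ hρ using hρ
  have hinc : ∀ w ∈ H, incident (T.gadgetFst D) (T.gadgetSnd D ρ) (T.gadget D F) (.inr w) =
      {.inl w, .inr (.inl w), .inr (.inr (ρ w, w))} := fun w hw =>
    incident_gadget ((hmH w).1 hw).1 ((hmH w).1 hw).2.1 (hρ w hw)
  set c : V ⊕ V ⊕ V × V → ℤ :=
    Sum.elim (fun _ => 0) (Sum.elim (fun w => if w ∈ H then -1 else 1) fun _ => -1) with hc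
  set r : V ⊕ V ⊕ V × V → ℤ := Sum.elim (fun _ => 0) fun _ => 1 with hr
  obtain ⟨J, hJ, hJb, hJW, hJc⟩ := exists_join_weight_le_third_of_cubic (T.gadgetFst D)
    (T.gadgetSnd D ρ) (T.gadget D F) c (gadget_bridgeless hF)
        (gadget_loopless hF) (H.image .inr) (by
      intro x hx
      obtain ⟨w, hw, rfl⟩ := Finset.mem_image.1 hx
      rw [hinc w hw]
      simp)
  set φ : V ⊕ V → V := Sum.elim id T.par with hφ
  have htop : ∀ w, φ (T.top D w) = T.par w := fun w => by
    unfold top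
    split_ifs <;> rfl
  have hsnd : ∀ e : V × V, φ (T.gadgetSnd D ρ (.inr (.inr e))) = T.par e.2 := fun e => by
    simp only [gadgetSnd, Sum.elim_inr]
    split_ifs
    · exact htop _
    · rfl
  set K := (T.gadget D F \ J).toRight with hK
  set N := J.toRight.toLeft.filter (· ∉ H) with hN
  set s : (V ⊕ V × V) ⊕ V × Bool → V :=
    Sum.elim (fun x => φ (T.gadgetFst D (.inr x))) fun p => T.par p.1 with hs
  set t : (V ⊕ V × V) ⊕ V × Bool → V :=
    Sum.elim (fun x => φ (T.gadgetSnd D ρ (.inr x))) fun p => p.1 with ht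
  set E := K.disjSum (N ×ˢ (Finset.univ : Finset Bool)) with hE
  have hKt : ∀ w, .inl w ∈ K ↔ w ≠ T.root ∧ .inr (.inl w) ∉ J := fun w => by
    simp [hK, Finset.mem_toRight]
  have hKb : ∀ e, .inr e ∈ K ↔ e ∈ F ∧ .inr (.inr e) ∉ J := fun w => by
    simp [hK, Finset.mem_toRight]
  have hmN : ∀ w, w ∈ N ↔ .inr (.inl w) ∈ J ∧ w ∉ H := fun w => by
    simp [hN, Finset.mem_toRight, Finset.mem_toLeft]
  have hJr : ∀ w, .inr (.inl w) ∈ J → w ≠ T.root := fun w h => mem_gadget_inr_inl.1 (hJ h)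
  have hEK : ∀ x ∈ K, EdgeReach s t E (φ (T.gadgetFst D (.inr x))) (φ (T.gadgetSnd D ρ (.inr x))) :=
    fun x hx => EdgeReach.of_mem (ι := (V ⊕ V × V) ⊕ V × Bool) (e := .inl x)
        (by simpa [hE] using hx)
  refine ⟨s, t, E, ?_, ?_, ?_, ?_⟩
  · rintro ((w | e) | ⟨w, b⟩) he
    · simp only [hE, Finset.inl_mem_disjSum, hKt] at he
      simp only [hs, ht, Sum.elim_inl, gadgetFst, Sum.elim_inr, htop]
      exact T.par_pos he.1
    · simp only [hE, Finset.inl_mem_disjSum, hKb] at he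
      simp only [hs, ht, Sum.elim_inl, hsnd]
      exact (hF.mem e he.1).2.2
    · simp only [hE, Finset.inr_mem_disjSum, Finset.mem_product, hmN] at he
      simp only [hs, ht, Sum.elim_inr]
      exact T.par_pos (hJr w he.1.1)
  · intro y
    have h1 := bdry_comp_eq_zero φ hJb y
    unfold bdry at h1 ⊢
    rw [sum_toLeft_add_sum_toRight] at h1
    rw [hE, Finset.sum_disjSum, Finset.sum_product]
    rw [Finset.sum_eq_zero fun a _ => ?_, zero_add] at h1
    · have h2 : ∑ w ∈ N, ∑ b : Bool, (ptInd (s (.inr (w, b))) y + ptInd (t (.inr (w, b))) y) = 0 :=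
        Finset.sum_eq_zero fun w _ => by
          rw [Fintype.sum_bool]; exact zmod_two_add_self _
      rw [h2, add_zero]
      exact h1
    · exact zmod_two_add_self _
  · have key : ∀ v, ∀ u, T.le v u → EdgeReach s t E v u := by
      intro v
      induction v using T.induction_up with
      | step v ih =>
        intro u hu
        by_cases hne : v = u
        · rw [hne]; exact .refl _
        obtain ⟨w, hw, rfl, hwu⟩ := T.exists_child hu hne
        refine .trans ?_ (ih w hw rfl u hwu)
        by_cases hwJ : .inr (.inl w) ∈ J
        · by_cases hwH : w ∈ H
          · have h1 := hJW (.inr w) (Finset.mem_image_of_mem _ hwH)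
            have h2 : .inr (.inr (ρ w, w)) ∉ J := by
              intro h3
              have h4 : ({.inr (.inl w), .inr (.inr (ρ w, w))} : Finset (V ⊕ V ⊕ V × V)) ⊆
                  incident (T.gadgetFst D) (T.gadgetSnd D ρ) J (.inr w) := by
                have h5 : ∀ e ∈ J, e ∈ incident (T.gadgetFst D) (T.gadgetSnd D ρ) (T.gadget D F)
                    (.inr w) → e ∈ incident (T.gadgetFst D) (T.gadgetSnd D ρ) J (.inr w) :=
                  fun e he h => Finset.mem_filter.2 ⟨he, (Finset.mem_filter.1 h).2⟩
                rw [hinc w hwH] at h5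
                intro e he
                rcases Finset.mem_insert.1 he with rfl | he
                · exact h5 _ hwJ (by simp)
                · rw [Finset.mem_singleton.1 he]
                  exact h5 _ h3 (by simp)
              have := Finset.card_le_card h4
              rw [h1, Finset.card_pair (by simp)] at this
              omega
            have h3 := hEK (.inr (ρ w, w)) ((hKb _).2 ⟨hρ w hwH, h2⟩)
            rw [hsnd] at h3
            exact h3.symm.trans (ih w hw rfl _ (hF.mem _ (hρ w hwH)).2.1).symm
          · exact EdgeReach.of_mem (ι := (V ⊕ V × V) ⊕ V × Bool) (e := .inr (w, true))
              (by simp [hE, hmN, hwJ, hwH])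
        · have h3 := hEK (.inl w) ((hKt w).2 ⟨hw, hwJ⟩)
          simp only [gadgetFst, Sum.elim_inr, Sum.elim_inl, htop] at h3
          exact h3
    exact fun y => key _ y (T.root_le y)
  · have hcardK : (K.card : ℤ) = ∑ e ∈ T.gadget D F \ J, r e := by
      rw [sum_toLeft_add_sum_toRight]
      simp [hr, hK]
    have hcardN : 2 * (N.card : ℤ) = ∑ e ∈ J, (r e + c e) := by
      rw [sum_toLeft_add_sum_toRight, sum_toLeft_add_sum_toRight, hN, Finset.card_filter]
      push_cast
      rw [Finset.mul_sum]
      simp only [hr, hc, Sum.elim_inl, Sum.elim_inr, add_zero, Finset.sum_const_zero, zero_add,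
        add_neg_cancel]
      refine Finset.sum_congr rfl fun w _ => ?_
      by_cases h : w ∈ H <;> simp [h]
    have hrsum : ∑ e ∈ T.gadget D F, r e = (Fintype.card V - 1 : ℤ) + F.card := by
      have : 0 < Fintype.card V := Fintype.card_pos_iff.2 ⟨T.root⟩
      rw [gadget, Finset.sum_disjSum, Finset.sum_disjSum]
      simp [hr, Finset.card_erase_of_mem, Finset.card_univ]
      omega
    have hcsum : ∑ e ∈ T.gadget D F, c e = (Fintype.card V - 1 : ℤ) - 2 * H.card - F.card := by
      have h0 : 0 < Fintype.card V := Fintype.card_pos_iff.2 ⟨T.root⟩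
      rw [gadget, Finset.sum_disjSum, Finset.sum_disjSum]
      have h1 : ∀ w, (if w ∈ H then (-1 : ℤ) else 1) = 1 - 2 * if w ∈ H then 1 else 0 := fun w => by
        split_ifs <;> norm_num
      have h2 : (Finset.univ.erase T.root).filter (· ∈ H) = H := by
        ext w
        simp only [Finset.mem_filter, Finset.mem_erase, Finset.mem_univ,
            and_true, and_iff_right_iff_imp]
        exact fun h => ((hmH w).1 h).1
      simp only [hc, Sum.elim_inl, Sum.elim_inr, h1, Finset.sum_sub_distrib, ← Finset.mul_sum,
        ← Finset.sum_filter, h2]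
      simp [Finset.card_erase_of_mem, Finset.card_univ]
      omega
    have hFcard : F.card ≤ ∑ w ∈ Finset.univ.erase T.root,
        ((F.filter fun e => e.2 = w).card - 1) + D.card + H.card := by
      rw [Finset.card_eq_sum_card_fiberwise (f := Prod.snd) (t := Finset.univ.erase T.root)
        (fun e he => by simpa using (hF.mem e he).1)]
      have h1 : ∀ S : Finset V, ∑ w ∈ Finset.univ.erase T.root, (if w ∈ S then 1 else 0)
          ≤ S.card := by
        intro S
        rw [← Finset.card_filter]
        exact Finset.card_le_card fun w hw => (Finset.mem_filter.1 hw).2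
      refine _root_.le_trans ?_ (Nat.add_le_add (Nat.add_le_add_left (h1 D) _) (h1 H))
      rw [← Finset.sum_add_distrib, ← Finset.sum_add_distrib]
      refine Finset.sum_le_sum fun w hw => ?_
      by_cases h2 : (F.filter fun e => e.2 = w).card = 0
      · simp [h2]
      · have h3 : w ∈ D ∨ w ∈ H := by
          by_cases hD : w ∈ D
          · exact .inl hD
          · obtain ⟨e, he⟩ := Finset.card_pos.1 (Nat.pos_of_ne_zero h2)
            rw [Finset.mem_filter] at he
            exact .inr ((hmH w).2 ⟨Finset.ne_of_mem_erase hw, hD, e, he⟩)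
        rcases h3 with h3 | h3 <;> simp only [h3, if_true] <;> omega
    have hEcard : E.card = K.card + N.card * 2 := by
      simp [hE, Finset.card_disjSum, Finset.card_product]
    have hsd := Finset.sum_sdiff (f := r) hJ
    rw [Finset.sum_add_distrib] at hcardN
    omega

end DfsTree

section TSP

variable {V : Type*} [Fintype V]

lemma sum_sum_mk_eq {f : Sym2 V → ℝ} (hf : ∀ a, f s(a, a) = 0) :
    ∑ a, ∑ b, f s(a, b) = 2 * ∑ e, f e := by
  rw [← Fintype.sum_prod_type' (f := fun a b => f s(a, b)),
    ← Finset.sum_fiberwise Finset.univ (fun p : V × V => s(p.1, p.2)), Finset.mul_sum]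
  refine Finset.sum_congr rfl fun e _ => ?_
  induction e with
  | _ a b =>
    rw [Finset.sum_congr rfl (g := fun _ => f s(a, b)) fun p hp => by
      rw [(Finset.mem_filter.1 hp).2]]
    rw [Finset.sum_const, nsmul_eq_mul]
    by_cases hab : a = b
    · subst hab
      rw [hf, mul_zero, mul_zero]
    · have : (Finset.univ.filter fun p : V × V => s(p.1, p.2) = s(a, b)) = {(a, b), (b, a)} := by
        ext ⟨c, d⟩
        simp
      rw [this, Finset.card_pair (by simp [hab])]
      norm_num

lemma sum_cut_eq {x : Sym2 V → ℝ} (S : Finset V) :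
    ∑ a ∈ S, ∑ b ∈ Sᶜ, x s(a, b) = ∑ e, cutInd (S : Set V) e * x e := by
  have h1 := sum_sum_mk_eq (f := fun e => cutInd (S : Set V) e * x e) fun a => by
    simp [cutInd_mk]
  have h2 : ∀ a b, cutInd (S : Set V) s(a, b) * x s(a, b) =
      (if a ∈ S then if b ∈ Sᶜ then x s(a, b) else 0 else 0) +
      (if b ∈ S then if a ∈ Sᶜ then x s(b, a) else 0 else 0) := fun a b => by
    rw [Sym2.eq_swap (a := b) (b := a), cutInd_mk]
    by_cases ha : a ∈ S <;> by_cases hb : b ∈ S <;> simp [ha, hb]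
  have h3 : ∑ a, ∑ b, (if a ∈ S then if b ∈ Sᶜ then x s(a, b) else 0 else 0) =
      ∑ a ∈ S, ∑ b ∈ Sᶜ, x s(a, b) := by
    rw [← Finset.sum_filter_add_sum_filter_not Finset.univ (· ∈ S)]
    rw [Finset.filter_univ_mem, Finset.sum_eq_zero (s := Finset.univ.filter (· ∉ S)), add_zero]
    · refine Finset.sum_congr rfl fun a ha => ?_
      simp only [ha, if_true]
      rw [← Finset.sum_filter, Finset.filter_univ_mem]
    · intro a ha
      simp [(Finset.mem_filter.1 ha).2]
  simp only [h2, Finset.sum_add_distrib] at h1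
  rw [Finset.sum_comm (f := fun a b => if b ∈ S then if a ∈ Sᶜ then x s(b, a) else 0 else 0),
    h3] at h1
  linarith

lemma IsCutMatrix.reflTransGen {X : V → V → ℝ} (hX : IsCutMatrix X) (a b : V) :
    Relation.ReflTransGen (fun a b => 0 < X a b) a b := by
  by_contra h
  set S : Finset V := Finset.univ.filter fun c => Relation.ReflTransGen (fun a b => 0 < X a b) a c
    with hS
  have h1 := hX.cut S ⟨a, by simp [hS, Relation.ReflTransGen.refl]⟩ fun h1 => by
    have : b ∈ S := h1 ▸ Finset.mem_univ b
    simp [hS, h] at this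
  rw [Finset.sum_eq_zero] at h1
  · norm_num at h1
  · refine fun c hc => Finset.sum_eq_zero fun d hd => ?_
    by_contra hne
    have hpos : 0 < X c d := lt_of_le_of_ne (hX.nonneg c d) (Ne.symm hne)
    simp only [hS, Finset.mem_filter, Finset.mem_univ, true_and, Finset.mem_compl] at hc hd
    exact hd (hc.tail hpos)

lemma IsHeldKarp.isCutMatrix {G : SimpleGraph V} {x : Sym2 V → ℝ} (hx : IsHeldKarp G x)
    (h0 : ∀ e ∉ G.edgeSet, x e = 0) : IsCutMatrix fun a b => x s(a, b) where
  symm a b := by rw [Sym2.eq_swap]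
  nonneg a b := by
    by_cases h : s(a, b) ∈ G.edgeSet
    · exact hx.1 _ h
    · exact (h0 _ h).ge
  cut S hS hS' := by
    rw [sum_cut_eq, ← cutValue_eq_sum G h0]
    exact hx.2 _ (by exact_mod_cast hS) (by exact_mod_cast hS')

/-- Every feasible Held-Karp solution bounds the length of some spanning closed walk. -/
theorem exists_spanning_walk_le (G : SimpleGraph V) (hn : 2 ≤ Fintype.card V) {x : Sym2 V → ℝ}
    (hx : IsHeldKarp G x) :
    ∃ (v : V) (w : G.Walk v v), (∀ u : V, u ∈ w.support) ∧
      (w.length : ℝ) ≤ (13 / 9) * lpValue G x := by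
  obtain ⟨x', hx', hle, h0, hnn, hcard⟩ := exists_sparse_heldKarp G hn hx
  have hX := hx'.isCutMatrix h0
  set X : V → V → ℝ := fun a b => x' s(a, b) with hXdef
  have : Nonempty V := Fintype.card_pos_iff.1 (by omega)
  obtain ⟨T⟩ := exists_dfsTree hX.symm hX.reflTransGen
  obtain ⟨D, F, hD, hF, hcov, hmem, hcost⟩ := T.exists_back_edges hX
  obtain ⟨s, t, E, hE, hb, hr, hEcard⟩ := T.exists_even_multigraph ⟨hD, hF, hcov, hmem⟩
  have hadj : ∀ a b, 0 < X a b → G.Adj a b := fun a b hab => by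
    by_contra hne
    rw [hXdef] at hab
    simp only [h0 s(a, b) hne, lt_irrefl] at hab
  obtain ⟨w, hw, hsupp⟩ := exists_walk_of_bdry (G := G) E.card E T.root T.root rfl
    (fun e he => hadj _ _ (hE e he)) fun y => by rw [hb, zmod_two_add_self]
  refine ⟨T.root, w, fun u => hsupp u (hr u), ?_⟩
  have h1 := T.sum_cost_le hX hn
  have h2 := T.sum_num_add_card_le (P := Finset.univ.filter fun e => x' e ≠ 0) fun a b hab => by
    simpa using hab.ne'
  have h3 : ∑ v, ∑ u, X v u = 2 * lpValue G x' := by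
    rw [lpValue_eq_sum G h0]
    exact sum_sum_mk_eq fun a => h0 _ (by simp)
  have h4 : (2 * Fintype.card V : ℝ) ≤ ∑ v, ∑ u, X v u := by
    calc (2 * Fintype.card V : ℝ) = ∑ _v : V, (2 : ℝ) := by simp [mul_comm]
      _ ≤ _ := Finset.sum_le_sum fun v _ => DfsTree.two_le_degree hX v hn
  set K := ∑ w ∈ Finset.univ.erase T.root, T.num w
  set C := ∑ w ∈ Finset.univ.erase T.root, ((F.filter fun e => e.2 = w).card - 1) + D.card
  have h5 : (K : ℝ) + 2 ≤ Fintype.card V := by exact_mod_cast (by omega : K + 2 ≤ Fintype.card V)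
  have h6 : (3 * E.card + 4 : ℝ) ≤ 4 * Fintype.card V + 2 * (C : ℝ) := by exact_mod_cast hEcard
  have h7 : (w.length : ℝ) ≤ E.card := by exact_mod_cast hw
  linarith

lemma exists_isHeldKarp {G : SimpleGraph V} (hconn : G.Connected) : ∃ x, IsHeldKarp G x := by
  refine ⟨fun _ => 2, fun _ _ => by norm_num, fun S hS hS' => ?_⟩
  obtain ⟨a, ha⟩ := hS
  obtain ⟨b, hb⟩ := (Set.ne_univ_iff_exists_notMem S).1 hS'
  obtain ⟨p⟩ := hconn.preconnected a b
  obtain ⟨d, -, hd, hd'⟩ := p.exists_boundary_dart S ha hb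
  have hmem : s(d.fst, d.snd) ∈ Finset.univ.filter
      (fun e : Sym2 V => e ∈ G.edgeSet ∧ ∃ a b, e = s(a, b) ∧ a ∈ S ∧ b ∉ S) := by
    simp only [Finset.mem_filter, Finset.mem_univ, true_and]
    exact ⟨d.adj, _, _, rfl, hd, hd'⟩
  exact Finset.single_le_sum (f := fun _ => (2 : ℝ)) (fun _ _ => by norm_num) hmem

end TSP

theorem graphic_tsp_thirteen_ninths {V : Type*} [Fintype V] (G : SimpleGraph V)
    (hconn : G.Connected) (hn : 2 ≤ Fintype.card V) :
    ∃ (v : V) (w : G.Walk v v), (∀ u : V, u ∈ w.support) ∧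
      (w.length : ℝ) ≤ (13 / 9) * optLP G := by
  obtain ⟨x₀, hx₀⟩ := exists_isHeldKarp hconn
  have hex : ∃ k, ∃ (v : V) (w : G.Walk v v), (∀ u : V, u ∈ w.support) ∧ w.length = k := by
    obtain ⟨v, w, h, -⟩ := exists_spanning_walk_le G hn hx₀
    exact ⟨_, v, w, h, rfl⟩
  obtain ⟨v, w, h, hlen⟩ := Nat.find_spec hex
  refine ⟨v, w, h, ?_⟩
  have : (w.length : ℝ) * (9 / 13) ≤ optLP G := by
    refine le_csInf ⟨_, x₀, hx₀, rfl⟩ ?_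
    rintro _ ⟨x, hx, rfl⟩
    obtain ⟨v', w', h', hle⟩ := exists_spanning_walk_le G hn hx
    have : w.length ≤ w'.length := hlen ▸ Nat.find_min' hex ⟨v', w', h', rfl⟩
    have : (w.length : ℝ) ≤ w'.length := by exact_mod_cast this
    linarith
  linarith
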